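/- If H is a subgroup generated by two elements of a one-relator group with torsion, then H is either isomorphic to a freely indecomposable one-relator group with torsion or isomorphic to a free product of cyclic groups. -/

import Mathlib

/-- A group is *virtually-ℤ* if it has a finite-index subgroup isomorphic to `ℤ`. -/
def VirtuallyZ (G : Type*) [Group G] : Prop :=
  ∃ H : Subgroup G, H.FiniteIndex ∧ Nonempty (H ≃* Multiplicative ℤ)

/-- A subgroup `M` of `G` is *malnormal* if `g M g⁻¹ ∩ M ≠ 1` implies `g ∈ M`. -/
def Subgroup.IsMalnormal {G : Type*} [Group G] (M : Subgroup G) : Prop :=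
  ∀ g : G, (∃ x : G, x ≠ 1 ∧ x ∈ M ∧ g * x * g⁻¹ ∈ M) → g ∈ M

/-- A group is a *free product of cyclic groups* if it is isomorphic to the free product
(`Monoid.CoprodI`) of a family of cyclic groups; every cyclic group is isomorphic to
`Multiplicative (ZMod m)` for some `m : ℕ` (with `m = 0` giving the infinite cyclic group). -/
def IsFreeProductOfCyclics (G : Type*) [Group G] : Prop :=
  ∃ (ι : Type) (m : ι → ℕ),
    Nonempty (G ≃* Monoid.CoprodI fun i => Multiplicative (ZMod (m i)))

/-- A group is *freely decomposable* if it is isomorphic to a free product of two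
nontrivial groups. -/
def FreelyDecomposable (G : Type*) [Group G] : Prop :=
  ∃ (H K : Type) (gH : Group H) (gK : Group K),
    Nontrivial H ∧ Nontrivial K ∧
      Nonempty (G ≃* (letI := gH; letI := gK; Monoid.Coprod H K))

/-- A group is *freely indecomposable* if it is not isomorphic to a free product of two
nontrivial groups. -/
def FreelyIndecomposable (G : Type*) [Group G] : Prop := ¬ FreelyDecomposable G
/-- A group is a *one-relator group with torsion* if it is isomorphic to some
`⟨X; Rⁿ⟩` with `|X| > 1`, `n > 1`, and `R` not a proper power in the free group on `X`. -/
def IsOneRelatorGroupWithTorsion (G : Type*) [Group G] : Prop :=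
  ∃ (X : Type) (R : FreeGroup X) (n : ℕ), Nontrivial X ∧ 1 < n ∧
    (∀ (S : FreeGroup X) (k : ℕ), 1 ≤ k → R = S ^ k → k = 1) ∧
    Nonempty (G ≃* PresentedGroup {R ^ n})


namespace Pride
open Classical in
/-- a nontrivial character of a noncyclic free group killing a given element -/
theorem exists_char {H : Type} [Group H] [IsFreeGroup H] (r : H)
    (h : Nontrivial (IsFreeGroup.Generators H)) :
    ∃ χ : H →* Multiplicative ℤ, χ ≠ 1 ∧ χ r = 1 := by
  obtain ⟨i, j, hij⟩ := h
  let e (i : IsFreeGroup.Generators H) : H →* Multiplicative ℤ :=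
    IsFreeGroup.lift (fun k => if k = i then Multiplicative.ofAdd 1 else 1)
  have he : ∀ i k, e i (IsFreeGroup.of k) = if k = i then Multiplicative.ofAdd 1 else 1 := by
    intro i k
    simp [e]
  by_cases hi : e i r = 1
  · refine ⟨e i, fun h => ?_, hi⟩
    have := he i i
    rw [h] at this
    simp at this
    have := congrArg Multiplicative.toAdd this
    simp at this
  · refine ⟨(e j) ^ (Multiplicative.toAdd (e i r)) * (e i) ^ (- Multiplicative.toAdd (e j r)), fun h => ?_, ?_⟩
    · have := DFunLike.congr_fun h (IsFreeGroup.of j)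
      rw [MonoidHom.mul_apply] at this
      have h1 : ∀ (f : H →* Multiplicative ℤ) (k : ℤ) (g : H), (f ^ k) g = (f g) ^ k := by
        intro f k g; cases k <;> simp
      rw [h1, h1, he, he] at this
      simp [hij.symm] at this
      apply hi
      have h2 := congrArg Multiplicative.toAdd this
      simp at h2
      exact h2
    · have h1 : ∀ (f : H →* Multiplicative ℤ) (k : ℤ) (g : H), (f ^ k) g = (f g) ^ k := by
        intro f k g; cases k <;> simp
      rw [MonoidHom.mul_apply, h1, h1]
      apply Multiplicative.toAdd.injective
      simp [mul_comm]

theorem order_exists {X : Type} (R : FreeGroup X)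
    (hR : ∀ (S : FreeGroup X) (k : ℕ), 1 ≤ k → R = S ^ k → k = 1) (c : ℕ) :
    ∀ (S : Finset (FreeGroup X)), S.card = c → (∀ s ∈ S, s ∉ Subgroup.zpowers R) →
    ∃ P : Set (FreeGroup X), (∀ a ∈ P, ∀ b ∈ P, a * b ∈ P) ∧
      (∀ a ∈ P, ∀ z ∈ Subgroup.zpowers R, z * a ∈ P ∧ a * z ∈ P) ∧
      (∀ z ∈ Subgroup.zpowers R, z ∉ P) ∧ ∀ s ∈ S, s ∈ P ∨ s⁻¹ ∈ P := by
  classical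
  induction c using Nat.strong_induction_on with
  | _ c ih =>
  intro S hc hS
  by_cases hSe : S = ∅
  · exact ⟨∅, by simp, by simp, by simp, by simp [hSe]⟩
  obtain ⟨s0, hs0⟩ := Finset.nonempty_iff_ne_empty.mpr hSe
  let H : Subgroup (FreeGroup X) := Subgroup.closure ((S : Set (FreeGroup X)) ∪ {R})
  have hRH : R ∈ H := Subgroup.subset_closure (by simp)
  have hSH : ∀ s ∈ S, s ∈ H := fun s hs => Subgroup.subset_closure (by simp [hs])
  have hnt : Nontrivial (IsFreeGroup.Generators H) := by
    by_contra hn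
    rw [not_nontrivial_iff_subsingleton] at hn
    -- H is cyclic
    have hcyc : IsCyclic H := by
      have : IsCyclic (FreeGroup (IsFreeGroup.Generators H)) := by
        rcases isEmpty_or_nonempty (IsFreeGroup.Generators H) with he | ⟨⟨i⟩⟩
        · infer_instance
        · have : Unique (IsFreeGroup.Generators H) := ⟨⟨i⟩, fun a => Subsingleton.elim _ _⟩
          refine ⟨FreeGroup.of i, fun g => ?_⟩
          change g ∈ Subgroup.zpowers (FreeGroup.of i)
          induction g using FreeGroup.induction_on with
          | C1 => exact one_mem _
          | of x => rw [Subsingleton.elim x i]; exact Subgroup.mem_zpowers _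
          | inv_of x hx => exact inv_mem hx
          | mul x y hx hy => exact mul_mem hx hy
      exact isCyclic_of_surjective (IsFreeGroup.mulEquiv H) (IsFreeGroup.mulEquiv H).surjective
    obtain ⟨z, hz⟩ := hcyc
    obtain ⟨k, hk⟩ := hz ⟨R, hRH⟩
    obtain ⟨l, hl⟩ := hz ⟨s0, hSH _ hs0⟩
    have hk' : (z : FreeGroup X) ^ k = R := by simpa using congrArg Subtype.val hk
    have hl' : (z : FreeGroup X) ^ l = s0 := by simpa using congrArg Subtype.val hl
    have hz' : (z : FreeGroup X) ∈ Subgroup.zpowers R := by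
      rcases lt_trichotomy k 0 with hk0 | hk0 | hk0
      · have := hR (z⁻¹ : FreeGroup X) (k.natAbs) (by omega) (by
          rw [← hk', ← zpow_natCast, inv_zpow', Int.natCast_natAbs, abs_of_neg hk0]; simp)
        have h3 : k = -1 := by omega
        rw [h3] at hk'
        refine ⟨-1, ?_⟩
        rw [← hk']; simp
      · exfalso
        have := hR 1 2 (by norm_num) (by rw [← hk', hk0]; simp)
        omega
      · have := hR (z : FreeGroup X) (k.natAbs) (by omega) (by
          rw [← hk', ← zpow_natCast, Int.natCast_natAbs, abs_of_pos hk0])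
        have h3 : k = 1 := by omega
        rw [h3] at hk'
        refine ⟨1, ?_⟩
        rw [← hk']; simp
    exact hS s0 hs0 (hl' ▸ zpow_mem hz' l)
  obtain ⟨χ, hχ, hχR⟩ := exists_char (⟨R, hRH⟩ : H) hnt
  let S0 := S.filter (fun s => ∀ h : s ∈ H, χ ⟨s, h⟩ = 1)
  have hlt : S0.card < c := by
    rw [← hc]
    apply Finset.card_lt_card
    refine ⟨Finset.filter_subset _ _, fun hsub => hχ ?_⟩
    -- χ trivial on generators
    ext ⟨g, hg⟩
    induction hg using Subgroup.closure_induction with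
    | mem x hx =>
      rcases hx with hx | hx
      · have := (Finset.mem_filter.mp (hsub hx)).2 (hSH x hx)
        rw [this]; rfl
      · have hx' : x = R := hx
        subst hx'
        rw [hχR]; rfl
    | one => exact congrArg Multiplicative.toAdd (map_one χ)
    | mul x y hx hy h1 h2 =>
      have : (⟨x * y, mul_mem hx hy⟩ : H) = ⟨x, hx⟩ * ⟨y, hy⟩ := rfl
      rw [this, map_mul]; simp at h1 h2 ⊢; rw [h1, h2]; rfl
    | inv x hx h1 =>
      have : (⟨x⁻¹, inv_mem hx⟩ : H) = (⟨x, hx⟩)⁻¹ := rfl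
      rw [this, map_inv]; simp at h1 ⊢; exact h1
  obtain ⟨P0, h1, h2, h3, h4⟩ := ih _ hlt S0 rfl (fun s hs => hS s (Finset.mem_filter.mp hs).1)
  have hzH : ∀ z ∈ Subgroup.zpowers R, ∃ h : z ∈ H, χ ⟨z, h⟩ = 1 := by
    rintro z ⟨k, rfl⟩
    refine ⟨zpow_mem hRH k, ?_⟩
    have : (⟨R ^ k, zpow_mem hRH k⟩ : H) = ⟨R, hRH⟩ ^ k := rfl
    show χ ⟨R ^ k, _⟩ = 1
    rw [this, map_zpow, hχR, one_zpow]
  have key : ∀ a b (ha : a ∈ H) (hb : b ∈ H), χ ⟨a * b, mul_mem ha hb⟩ = χ ⟨a, ha⟩ * χ ⟨b, hb⟩ := by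
    intro a b ha hb
    rw [← map_mul]; rfl
  refine ⟨{g | ∃ h : g ∈ H, 1 < χ ⟨g, h⟩ ∨ (χ ⟨g, h⟩ = 1 ∧ g ∈ P0)}, ?_, ?_, ?_, ?_⟩
  · rintro a ⟨ha, ha'⟩ b ⟨hb, hb'⟩
    refine ⟨mul_mem ha hb, ?_⟩
    rw [key a b ha hb]
    rcases ha' with ha' | ⟨ha', ha''⟩ <;> rcases hb' with hb' | ⟨hb', hb''⟩
    · exact Or.inl (one_lt_mul'' ha' hb')
    · left; rw [hb', mul_one]; exact ha'
    · left; rw [ha', one_mul]; exact hb'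
    · right; exact ⟨by rw [ha', hb', one_mul], h1 _ ha'' _ hb''⟩
  · rintro a ⟨ha, ha'⟩ z hz
    obtain ⟨hz1, hz2⟩ := hzH z hz
    refine ⟨⟨mul_mem hz1 ha, ?_⟩, ⟨mul_mem ha hz1, ?_⟩⟩
    · rw [key z a hz1 ha, hz2, one_mul]
      exact ha'.imp id fun ⟨h, h'⟩ => ⟨h, (h2 a h' z hz).1⟩
    · rw [key a z ha hz1, hz2, mul_one]
      exact ha'.imp id fun ⟨h, h'⟩ => ⟨h, (h2 a h' z hz).2⟩
  · rintro z hz ⟨h, h'⟩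
    obtain ⟨hz1, hz2⟩ := hzH z hz
    rcases h' with h' | ⟨_, h'⟩
    · rw [hz2] at h'; exact lt_irrefl _ h'
    · exact h3 z hz h'
  · intro s hs
    have hsi : χ ⟨s⁻¹, inv_mem (hSH s hs)⟩ = (χ ⟨s, hSH s hs⟩)⁻¹ := by rw [← map_inv]; rfl
    rcases lt_trichotomy (χ ⟨s, hSH s hs⟩) 1 with hlt | heq | hgt
    · right; refine ⟨inv_mem (hSH s hs), Or.inl ?_⟩
      rw [hsi]; exact one_lt_inv'.mpr hlt
    · have : s ∈ S0 := Finset.mem_filter.mpr ⟨hs, fun _ => heq⟩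
      rcases h4 s this with h | h
      · left; exact ⟨hSH s hs, Or.inr ⟨heq, h⟩⟩
      · right; exact ⟨inv_mem (hSH s hs), Or.inr ⟨by rw [hsi, heq, inv_one], h⟩⟩
    · left; exact ⟨hSH s hs, Or.inl hgt⟩
end Pride

namespace Pride
variable {X Ω : Type} [MulAction (FreeGroup X) Ω]

/-- right action -/
def act (ω : Ω) (g : FreeGroup X) : Ω := g⁻¹ • ω

theorem act_one (ω : Ω) : act ω (1 : FreeGroup X) = ω := by simp [act]
theorem act_mul (ω : Ω) (g h : FreeGroup X) : act ω (g * h) = act (act ω g) h := by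
  simp [act, mul_smul]
theorem act_act_inv (ω : Ω) (g : FreeGroup X) : act (act ω g) g⁻¹ = ω := by
  rw [← act_mul, mul_inv_cancel, act_one]
theorem act_inv_act (ω : Ω) (g : FreeGroup X) : act (act ω g⁻¹) g = ω := by
  rw [← act_mul, inv_mul_cancel, act_one]
theorem act_inj {ω ω' : Ω} {g : FreeGroup X} (h : act ω g = act ω' g) : ω = ω' := by
  rw [← act_act_inv ω g, h, act_act_inv]
theorem act_eq_iff {ω ω' : Ω} {g : FreeGroup X} : act ω g = ω' ↔ ω = act ω' g⁻¹ := by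
  constructor
  · rintro rfl; rw [act_act_inv]
  · rintro rfl; rw [act_inv_act]

/-- the group element of a letter -/
def ltr (a : X × Bool) : FreeGroup X := FreeGroup.mk [a]
/-- the inverse letter -/
def linv (a : X × Bool) : X × Bool := (a.1, !a.2)

theorem ltr_true (x : X) : ltr (x, true) = FreeGroup.of x := rfl
theorem ltr_false (x : X) : ltr (x, false) = (FreeGroup.of x)⁻¹ := rfl
theorem ltr_linv (a : X × Bool) : ltr (linv a) = (ltr a)⁻¹ := by
  obtain ⟨x, _ | _⟩ := a <;> simp [linv, ltr_true, ltr_false]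
theorem linv_linv (a : X × Bool) : linv (linv a) = a := by simp [linv]

/-- the edge crossed by the letter `a` starting at `ω` -/
def edge (ω : Ω) (a : X × Bool) : Ω × X := (if a.2 then ω else act ω (ltr a), a.1)

theorem edge_true (ω : Ω) (x : X) : edge ω (x, true) = (ω, x) := rfl
theorem edge_false (ω : Ω) (x : X) : edge ω (x, false) = (act ω (FreeGroup.of x)⁻¹, x) := rfl
theorem edge_linv (ω : Ω) (a : X × Bool) : edge (act ω (ltr a)) (linv a) = edge ω a := by
  obtain ⟨x, _ | _⟩ := a
  · simp [linv, edge]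
  · simp [linv, edge, ltr_true, ltr_false, act_act_inv]

theorem edge_eq_cases {ω ω' : Ω} {a a' : X × Bool} (h : edge ω a = edge ω' a') :
    (a = a' ∧ ω = ω') ∨ (a' = linv a ∧ ω' = act ω (ltr a)) := by
  obtain ⟨x, b⟩ := a
  obtain ⟨x', b'⟩ := a'
  have hx : x = x' := congrArg Prod.snd h
  subst hx
  have h1 := congrArg Prod.fst h
  cases b <;> cases b' <;> simp [edge, linv, ltr_true, ltr_false] at h1 ⊢
  · exact act_inj h1
  · exact h1.symm
  · rw [h1, act_inv_act]
  · exact h1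

theorem edge_surj (e : Ω × X) : ∃ ω a, edge ω a = e := ⟨e.1, (e.2, true), rfl⟩

/-- `g` is represented by a path in `E` from `ω` -/
inductive Trav (E : Finset (Ω × X)) : Ω → FreeGroup X → Prop
  | one (ω : Ω) : Trav E ω 1
  | cons (ω : Ω) (a : X × Bool) (g : FreeGroup X) (h : edge ω a ∈ E) (t : Trav E (act ω (ltr a)) g) :
      Trav E ω (ltr a * g)

namespace Trav
variable {E E' : Finset (Ω × X)}

theorem mul {ω : Ω} {g h : FreeGroup X} (h1 : Trav E ω g) (h2 : Trav E (act ω g) h) :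
    Trav E ω (g * h) := by
  induction h1 with
  | one ω => simpa [act_one] using h2
  | cons ω a g he t ih =>
    rw [mul_assoc]
    refine Trav.cons ω a _ he (ih ?_)
    rwa [act_mul] at h2

theorem single {ω : Ω} {a : X × Bool} (h : edge ω a ∈ E) : Trav E ω (ltr a) := by
  simpa using Trav.cons ω a 1 h (Trav.one _)

theorem inv {ω : Ω} {g : FreeGroup X} (h1 : Trav E ω g) : Trav E (act ω g) g⁻¹ := by
  induction h1 with
  | one ω => simpa using Trav.one _
  | cons ω a g he t ih =>
    rw [mul_inv_rev, act_mul]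
    refine ih.mul ?_
    rw [act_act_inv, ← ltr_linv]
    apply single
    rwa [edge_linv]

theorem inv' {ω : Ω} {g : FreeGroup X} (h1 : Trav E (act ω g) g⁻¹) : Trav E ω g := by
  simpa [act_act_inv] using h1.inv

theorem mono (hE : E ⊆ E') {ω : Ω} {g : FreeGroup X} (h1 : Trav E ω g) : Trav E' ω g := by
  induction h1 with
  | one ω => exact Trav.one _
  | cons ω a g he t ih => exact Trav.cons ω a g (hE he) ih

theorem of_mul {ω : Ω} {g h : FreeGroup X} (h1 : Trav E ω g) (h2 : Trav E ω (g * h)) :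
    Trav E (act ω g) h := by
  have := h1.inv.mul (by rw [act_act_inv]; exact h2)
  simpa using this

end Trav

/-- The fundamental group -/
def pi1 (E : Finset (Ω × X)) (v : Ω) : Subgroup (FreeGroup X) where
  carrier := {g | act v g = v ∧ Trav E v g}
  one_mem' := ⟨act_one _, Trav.one _⟩
  mul_mem' := by
    rintro a b ⟨h1, h2⟩ ⟨h3, h4⟩
    exact ⟨by rw [act_mul, h1, h3], h2.mul (by rw [h1]; exact h4)⟩
  inv_mem' := by
    rintro a ⟨h1, h2⟩
    have := h2.inv
    rw [h1] at this
    exact ⟨by rw [act_eq_iff, inv_inv, h1], this⟩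

theorem mem_pi1 {E : Finset (Ω × X)} {v : Ω} {g : FreeGroup X} :
    g ∈ pi1 E v ↔ act v g = v ∧ Trav E v g := Iff.rfl

theorem pi1_mono {E E' : Finset (Ω × X)} (h : E ⊆ E') (v : Ω) : pi1 E v ≤ pi1 E' v :=
  fun _ hg => ⟨hg.1, hg.2.mono h⟩

/-- two paths to the same point differ by a loop -/
theorem mul_inv_mem_pi1 {E : Finset (Ω × X)} {v : Ω} {g h : FreeGroup X}
    (hg : Trav E v g) (hh : Trav E v h) (e : act v g = act v h) : g * h⁻¹ ∈ pi1 E v := by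
  refine ⟨by rw [act_mul, e, act_act_inv], hg.mul ?_⟩
  rw [e]; exact hh.inv

theorem conj_mem_pi1 {E : Finset (Ω × X)} {v : Ω} {t g : FreeGroup X}
    (ht : Trav E v t) (hg : g ∈ pi1 E (act v t)) : t * g * t⁻¹ ∈ pi1 E v :=
  mul_inv_mem_pi1 (ht.mul hg.2) ht (by rw [act_mul, hg.1])

/-- Holonomy -/
noncomputable def holHom {P : Type} [Group P] (f : Ω × X → P) :
    FreeGroup X →* (Ω → P) ⋊[mulAutArrow] (FreeGroup X) :=
  FreeGroup.lift fun x => ⟨fun ω => f (ω, x), FreeGroup.of x⟩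

theorem holHom_right {P : Type} [Group P] (f : Ω × X → P) (g : FreeGroup X) :
    (holHom f g).right = g := by
  have : (SemidirectProduct.rightHom.comp (holHom f)) = MonoidHom.id _ := by
    ext x; simp [holHom]
  exact DFunLike.congr_fun this g

/-- Holonomy along `g` from `ω` -/
noncomputable def hol {P : Type} [Group P] (f : Ω × X → P) (ω : Ω) (g : FreeGroup X) : P :=
  (holHom f g).left ω

theorem hol_one {P : Type} [Group P] (f : Ω × X → P) (ω : Ω) : hol f ω 1 = 1 := by simp [hol]
theorem hol_mul {P : Type} [Group P] (f : Ω × X → P) (ω : Ω) (g h : FreeGroup X) :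
    hol f ω (g * h) = hol f ω g * hol f (act ω g) h := by
  simp only [hol, map_mul, SemidirectProduct.mul_left, Pi.mul_apply, holHom_right]
  rfl
theorem hol_of {P : Type} [Group P] (f : Ω × X → P) (ω : Ω) (x : X) :
    hol f ω (FreeGroup.of x) = f (ω, x) := by
  simp [hol, holHom]
theorem hol_inv {P : Type} [Group P] (f : Ω × X → P) (ω : Ω) (g : FreeGroup X) :
    hol f (act ω g) g⁻¹ = (hol f ω g)⁻¹ := by
  rw [eq_inv_iff_mul_eq_one, ← act_act_inv ω g, act_act_inv]
  have := hol_mul f (act ω g) g⁻¹ g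
  rw [inv_mul_cancel, hol_one, act_act_inv] at this
  exact this.symm

/-- Holonomy on the fundamental group is a homomorphism -/
noncomputable def holPi {P : Type} [Group P] (f : Ω × X → P) (E : Finset (Ω × X)) (v : Ω) :
    pi1 E v →* P where
  toFun g := hol f v g
  map_one' := hol_one _ _
  map_mul' a b := by
    show hol f v (a * b : FreeGroup X) = _
    rw [hol_mul, a.2.1]

/-- cocycle lemma: a gauge description of holonomy along paths in `E` -/
theorem hol_eq_of_gauge {P : Type} [Group P] (f : Ω × X → P) (E : Finset (Ω × X))
    (c : Ω → FreeGroup X → P)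
    (hc1 : ∀ ω, c ω 1 = 1)
    (hc : ∀ ω (g h : FreeGroup X), Trav E ω g → Trav E (act ω g) h → c ω (g * h) = c ω g * c (act ω g) h)
    (hf : ∀ ω x, (ω, x) ∈ E → f (ω, x) = c ω (FreeGroup.of x))
    {ω : Ω} {g : FreeGroup X} (h : Trav E ω g) : hol f ω g = c ω g := by
  have hedge : ∀ ω a, edge ω a ∈ E → hol f ω (ltr a) = c ω (ltr a) := by
    rintro ω ⟨x, b⟩ hE
    cases b
    · rw [ltr_false]
      rw [edge_false] at hE
      have h1 := hol_inv f (act ω (FreeGroup.of x)⁻¹) (FreeGroup.of x)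
      rw [act_inv_act, hol_of, hf _ _ hE] at h1
      rw [h1, inv_eq_iff_mul_eq_one]
      have ht : Trav E (act ω (FreeGroup.of x)⁻¹) (FreeGroup.of x) :=
        Trav.single (a := (x, true)) (by rwa [edge_true])
      have h2 := hc _ (FreeGroup.of x) (FreeGroup.of x)⁻¹ ht ht.inv
      rw [act_inv_act, mul_inv_cancel, hc1] at h2
      exact h2.symm
    · rw [ltr_true, hol_of]
      exact hf _ _ hE
  induction h with
  | one ω => rw [hol_one, hc1]
  | cons ω a g he t ih =>
    rw [hol_mul, hc _ _ _ (Trav.single he) t, hedge _ _ he, ih]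

/-- generation lemma -/
theorem gen_of_gauge (E : Finset (Ω × X)) (Γ : Subgroup (FreeGroup X)) (T : Ω → FreeGroup X)
    (hf : ∀ ω x, (ω, x) ∈ E → T ω * FreeGroup.of x * (T (act ω (FreeGroup.of x)))⁻¹ ∈ Γ)
    {ω : Ω} {g : FreeGroup X} (h : Trav E ω g) : T ω * g * (T (act ω g))⁻¹ ∈ Γ := by
  induction h with
  | one ω => simp [act_one, one_mem]
  | cons ω a g he t ih =>
    have h1 : T ω * ltr a * (T (act ω (ltr a)))⁻¹ ∈ Γ := by
      obtain ⟨x, b⟩ := a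
      cases b
      · rw [edge_false] at he
        have := inv_mem (hf _ _ he)
        rw [act_inv_act] at this
        simpa [ltr_false, mul_assoc] using this
      · exact hf _ _ he
    have := mul_mem h1 ih
    rw [act_mul]
    simpa [mul_assoc] using this

/-- Cyclically reduced primitive words, as periodic sequences of letters -/
structure CW (X : Type) where
  L : ℕ
  hL : 0 < L
  l : ℕ → X × Bool
  per : ∀ i, l (i + L) = l i
  red : ∀ i, l (i + 1) ≠ linv (l i)

namespace CW
variable (C : CW X)
/-- prefixes -/
def h : ℕ → FreeGroup X
  | 0 => 1
  | (i+1) => h i * ltr (C.l i)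
/-- the word -/
def R : FreeGroup X := C.h C.L

/-- not a proper power -/
def Prim : Prop := ∀ (S : FreeGroup X) (k : ℕ), 1 ≤ k → C.R = S ^ k → k = 1

theorem h_zero : C.h 0 = 1 := rfl
theorem h_succ (i : ℕ) : C.h (i + 1) = C.h i * ltr (C.l i) := rfl

theorem h_add_L (i : ℕ) : C.h (i + C.L) = C.R * C.h i := by
  induction i with
  | zero => simp [h_zero, R]
  | succ i ih =>
    rw [Nat.add_right_comm, h_succ, ih, h_succ, C.per, mul_assoc]

theorem h_add_mul_L (i k : ℕ) : C.h (i + k * C.L) = C.R ^ k * C.h i := by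
  induction k with
  | zero => simp
  | succ k ih =>
    rw [Nat.succ_mul, ← add_assoc, h_add_L, ih, pow_succ', mul_assoc]

theorem h_mul_L (k : ℕ) : C.h (k * C.L) = C.R ^ k := by
  simpa [h_zero] using C.h_add_mul_L 0 k

theorem l_add_mul_L (i k : ℕ) : C.l (i + k * C.L) = C.l i := by
  induction k with
  | zero => simp
  | succ k ih => rw [Nat.succ_mul, ← add_assoc, C.per, ih]

theorem h_eq_mk (i : ℕ) : C.h i = FreeGroup.mk ((List.range i).map C.l) := by
  induction i with
  | zero => rfl
  | succ i ih =>
    rw [h_succ, ih, List.range_succ, List.map_append, ← FreeGroup.mul_mk]; rfl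

open Classical in
theorem norm_h (i : ℕ) : (C.h i).norm = i := by
  have hr : FreeGroup.IsReduced ((List.range i).map C.l) := by
    unfold FreeGroup.IsReduced
    rw [List.isChain_iff_getElem]
    intro k hk
    simp only [List.getElem_map, List.getElem_range]
    intro h1
    by_contra h2
    apply C.red k
    refine Prod.ext h1.symm ?_
    simp only [linv]
    cases h3 : (C.l k).2 <;> cases h4 : (C.l (k+1)).2 <;> simp_all
  rw [h_eq_mk, FreeGroup.norm, FreeGroup.toWord_mk, hr.reduce_eq]
  simp

open Classical in
/-- distinct positions are not related by a power of `R` -/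
theorem h_inj_mod {i j : ℕ} (hj : j < C.L) (hi : i < C.L) (k : ℤ)
    (h : C.h j = C.R ^ k * C.h i) : i = j := by
  rcases lt_or_ge k 0 with hk | hk
  · obtain ⟨m, rfl⟩ : ∃ m : ℕ, k = -m := ⟨k.natAbs, by omega⟩
    have h' : C.h (j + m * C.L) = C.h i := by
      rw [h_add_mul_L, h]; simp
    have := congrArg FreeGroup.norm h'
    rw [norm_h, norm_h] at this
    have hm : m = 0 ∨ 1 ≤ m := by omega
    rcases hm with rfl | hm
    · omega
    · have := Nat.mul_le_mul_right C.L hm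
      omega
  · obtain ⟨m, rfl⟩ : ∃ m : ℕ, k = m := ⟨k.natAbs, by omega⟩
    have h' : C.h j = C.h (i + m * C.L) := by
      rw [h_add_mul_L, h]; simp
    have := congrArg FreeGroup.norm h'
    rw [norm_h, norm_h] at this
    have hm : m = 0 ∨ 1 ≤ m := by omega
    rcases hm with rfl | hm
    · omega
    · have := Nat.mul_le_mul_right C.L hm
      omega

end CW
end Pride

namespace Pride
variable {X Ω : Type} [MulAction (FreeGroup X) Ω]

namespace CW
variable (C : CW X)

theorem l_mod (i : ℕ) : C.l (i % C.L) = C.l i := by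
  conv_rhs => rw [← Nat.mod_add_div i C.L, mul_comm C.L, l_add_mul_L]

theorem l_congr {i j : ℕ} (h : i % C.L = j % C.L) : C.l i = C.l j := by
  rw [← l_mod, h, l_mod]

theorem h_mod (i : ℕ) : C.h i = C.R ^ (i / C.L) * C.h (i % C.L) := by
  conv_lhs => rw [← Nat.mod_add_div i C.L, mul_comm C.L, h_add_mul_L]

theorem exists_height (hp : C.Prim) : ∃ ρ : ℕ → ℕ, (∀ i j, ρ i = ρ j ↔ i % C.L = j % C.L) ∧
    (∀ i j, C.l i = C.l j → (ρ i < ρ j ↔ ρ (i+1) < ρ (j+1))) ∧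
    (∀ i j, C.l j = linv (C.l i) → (ρ i < ρ (j+1) ↔ ρ (i+1) < ρ j)) := by
  classical
  let S : Finset (FreeGroup X) := ((Finset.range C.L ×ˢ Finset.range C.L).filter
    (fun p => p.1 ≠ p.2)).image (fun p => C.h p.2 * (C.h p.1)⁻¹)
  obtain ⟨P, h1, h2, h3, h4⟩ := order_exists C.R hp _ S rfl (by
    intro s hs
    simp only [S, Finset.mem_image, Finset.mem_filter, Finset.mem_product, Finset.mem_range] at hs
    obtain ⟨⟨i, j⟩, ⟨⟨hi, hj⟩, hij⟩, rfl⟩ := hs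
    rintro ⟨k, hk⟩
    exact hij (C.h_inj_mod hj hi k (by simp only at hk; rw [hk]; simp)))
  have hRz : ∀ k : ℕ, C.R ^ k ∈ Subgroup.zpowers C.R := fun k => ⟨k, by simp⟩
  let lt : ℕ → ℕ → Prop := fun i j => C.h j * (C.h i)⁻¹ ∈ P
  have lt_mod : ∀ i j, lt i j ↔ lt (i % C.L) (j % C.L) := by
    intro i j
    simp only [lt]
    rw [C.h_mod i, C.h_mod j]
    have e : C.R ^ (j / C.L) * C.h (j % C.L) * (C.R ^ (i / C.L) * C.h (i % C.L))⁻¹ =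
      C.R ^ (j / C.L) * (C.h (j % C.L) * (C.h (i % C.L))⁻¹) * (C.R ^ (i / C.L))⁻¹ := by group
    rw [e]
    constructor
    · intro h
      have h' := (h2 _ h _ (inv_mem (hRz (j / C.L)))).1
      have := (h2 _ h' _ (hRz (i / C.L))).2
      simpa [mul_assoc] using this
    · intro h
      exact (h2 _ (h2 _ h _ (hRz (j / C.L))).1 _ (inv_mem (hRz (i / C.L)))).2
  have lt_trans : ∀ i j k, lt i j → lt j k → lt i k := by
    intro i j k hij hjk
    have := h1 _ hjk _ hij
    simpa [lt, mul_assoc] using this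
  have lt_irrefl : ∀ i, ¬ lt i i := by
    intro i hi
    simp only [lt, mul_inv_cancel] at hi
    exact h3 1 (one_mem _) hi
  have lt_total : ∀ i j, i % C.L ≠ j % C.L → lt i j ∨ lt j i := by
    intro i j hij
    rw [lt_mod i, lt_mod j]
    have := h4 (C.h (j % C.L) * (C.h (i % C.L))⁻¹) (by
      simp only [S, Finset.mem_image, Finset.mem_filter, Finset.mem_product, Finset.mem_range]
      exact ⟨(i % C.L, j % C.L), ⟨⟨Nat.mod_lt _ C.hL, Nat.mod_lt _ C.hL⟩, hij⟩, rfl⟩)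
    simpa [lt] using this
  let ρ : ℕ → ℕ := fun i => ((Finset.range C.L).filter (fun k => lt k i)).card
  have ρ_mod : ∀ i, ρ i = ρ (i % C.L) := by
    intro i
    simp only [ρ]
    congr 1
    apply Finset.filter_congr
    intro k hk
    rw [lt_mod k i, lt_mod k (i % C.L), Nat.mod_mod]
  have hlt : ∀ i j, lt i j → ρ i < ρ j := by
    intro i j hij
    apply Finset.card_lt_card
    refine ⟨fun k hk => ?_, fun hsub => ?_⟩
    · rw [Finset.mem_filter] at hk ⊢
      exact ⟨hk.1, lt_trans _ _ _ hk.2 hij⟩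
    · have : i % C.L ∈ (Finset.range C.L).filter (fun k => lt k j) := by
        rw [Finset.mem_filter]
        refine ⟨Finset.mem_range.mpr (Nat.mod_lt _ C.hL), ?_⟩
        rw [lt_mod, Nat.mod_mod, ← lt_mod]; exact hij
      have := (Finset.mem_filter.mp (hsub this)).2
      rw [lt_mod, Nat.mod_mod, ← lt_mod] at this
      exact lt_irrefl _ this
  have hiff : ∀ i j, ρ i < ρ j ↔ lt i j := by
    intro i j
    refine ⟨fun h => ?_, hlt i j⟩
    by_cases hij : i % C.L = j % C.L
    · rw [ρ_mod i, ρ_mod j, hij] at h; omega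
    · rcases lt_total i j hij with h' | h'
      · exact h'
      · have := hlt _ _ h'; omega
  refine ⟨ρ, ?_, ?_, ?_⟩
  · intro i j
    constructor
    · intro h
      by_contra hne
      rcases lt_total i j hne with h' | h' <;> have := hlt _ _ h' <;> omega
    · intro h
      rw [ρ_mod i, ρ_mod j, h]
  · intro i j hij
    rw [hiff, hiff]
    simp only [lt, h_succ, hij]
    simp [mul_assoc]
  · intro i j hij
    rw [hiff, hiff]
    simp only [lt, h_succ, hij, ltr_linv]
    simp [mul_assoc]
end CW

/-- starting points of lifts of `R ^ n` lying in `E` -/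
def W0 (C : CW X) (n : ℕ) (E : Finset (Ω × X)) : Set Ω :=
  {u | act u (C.R ^ n) = u ∧ ∀ i : ℕ, edge (act u (C.h i)) (C.l i) ∈ E}

open Classical in
/-- endpoints of edges -/
noncomputable def verts (E : Finset (Ω × X)) : Finset Ω :=
  E.image Prod.fst ∪ E.image (fun e => act e.1 (FreeGroup.of e.2))

theorem mem_verts {E : Finset (Ω × X)} {v : Ω} :
    v ∈ verts E ↔ ∃ a, edge v a ∈ E := by
  classical
  simp only [verts, Finset.mem_union, Finset.mem_image]
  constructor
  · rintro (⟨⟨ω, x⟩, h, rfl⟩ | ⟨⟨ω, x⟩, h, rfl⟩)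
    · exact ⟨(x, true), h⟩
    · exact ⟨(x, false), by rw [edge_false, act_act_inv]; exact h⟩
  · rintro ⟨⟨x, b⟩, h⟩
    cases b
    · right
      exact ⟨_, h, by rw [edge_false]; exact act_inv_act _ _⟩
    · left; exact ⟨_, h, rfl⟩

/-- every edge is crossed at least twice -/
def Irred (C : CW X) (n : ℕ) (E : Finset (Ω × X)) : Prop :=
  ∀ e ∈ E, ∃ u u' i i', u ∈ W0 C n E ∧ u' ∈ W0 C n E ∧ i < C.L ∧ i' < C.L ∧ (u, i) ≠ (u', i') ∧
    edge (act u (C.h i)) (C.l i) = e ∧ edge (act u' (C.h i')) (C.l i') = e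

section
variable {C : CW X} {n : ℕ} {E : Finset (Ω × X)}

theorem W0_R {u : Ω} (h : u ∈ W0 C n E) : act u C.R ∈ W0 C n E := by
  refine ⟨?_, fun i => ?_⟩
  · rw [← act_mul, ← pow_succ', pow_succ, act_mul, h.1]
  · rw [← act_mul, ← C.h_add_L, ← C.per]; exact h.2 _

theorem W0_R_pow {u : Ω} (h : u ∈ W0 C n E) (k : ℕ) : act u (C.R ^ k) ∈ W0 C n E := by
  induction k with
  | zero => simpa [act_one] using h
  | succ k ih => rw [pow_succ, act_mul]; exact W0_R ih

theorem W0_R_inv (hn : 0 < n) {u : Ω} (h : u ∈ W0 C n E) : act u (C.R)⁻¹ ∈ W0 C n E := by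
  have : act u (C.R)⁻¹ = act u (C.R ^ (n - 1)) := by
    rw [← h.1, ← act_mul, h.1]
    congr 1
    rw [mul_inv_eq_iff_eq_mul, ← pow_succ, Nat.sub_add_cancel hn]
  rw [this]; exact W0_R_pow h _

theorem W0_R_iff (hn : 0 < n) {u : Ω} : act u C.R ∈ W0 C n E ↔ u ∈ W0 C n E := by
  refine ⟨fun h => ?_, W0_R⟩
  have := W0_R_inv hn h
  rwa [act_act_inv] at this

theorem W0_R_pow_iff (hn : 0 < n) {u : Ω} (k : ℕ) : act u (C.R ^ k) ∈ W0 C n E ↔ u ∈ W0 C n E := by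
  induction k with
  | zero => simp [act_one]
  | succ k ih => rw [pow_succ, act_mul, W0_R_iff hn, ih]

theorem W0_finite : (W0 C n E).Finite := by
  apply Set.Finite.of_finite_image (f := fun u => edge u (C.l 0))
  · apply E.finite_toSet.subset
    rintro _ ⟨u, hu, rfl⟩
    simpa [C.h_zero, act_one] using hu.2 0
  · intro u _ u' _ h
    rcases edge_eq_cases h with h | h
    · exact h.2
    · exfalso
      have := congrArg Prod.snd h.1
      simp [linv] at this

theorem W0_mono {E' : Finset (Ω × X)} (h : E ⊆ E') : W0 C n E ⊆ W0 C n E' :=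
  fun _ hu => ⟨hu.1, fun i => h (hu.2 i)⟩

/-- positions -/
def IsPos (C : CW X) (n : ℕ) (E : Finset (Ω × X)) (p : Ω) (i : ℕ) : Prop :=
  act p (C.h i)⁻¹ ∈ W0 C n E

theorem isPos_of (u : Ω) (h : u ∈ W0 C n E) (i : ℕ) : IsPos C n E (act u (C.h i)) i := by
  unfold IsPos; rwa [act_act_inv]

theorem isPos_succ {p : Ω} {i : ℕ} : IsPos C n E (act p (ltr (C.l i))) (i + 1) ↔ IsPos C n E p i := by
  unfold IsPos
  rw [C.h_succ, mul_inv_rev, act_mul, act_act_inv]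

theorem isPos_add_L (hn : 0 < n) {p : Ω} {i : ℕ} : IsPos C n E p (i + C.L) ↔ IsPos C n E p i := by
  unfold IsPos
  rw [C.h_add_L, mul_inv_rev, act_mul, ← W0_R_iff hn, act_inv_act]

theorem isPos_add_mul_L (hn : 0 < n) {p : Ω} {i : ℕ} (k : ℕ) :
    IsPos C n E p (i + k * C.L) ↔ IsPos C n E p i := by
  induction k with
  | zero => simp
  | succ k ih => rw [Nat.succ_mul, ← add_assoc, isPos_add_L hn, ih]

theorem isPos_congr (hn : 0 < n) {p : Ω} {i j : ℕ} (h : i % C.L = j % C.L) :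
    IsPos C n E p i ↔ IsPos C n E p j := by
  rw [← Nat.mod_add_div i C.L, mul_comm, isPos_add_mul_L hn, h]
  conv_rhs => rw [← Nat.mod_add_div j C.L, mul_comm, isPos_add_mul_L hn]

theorem isPos_edge {p : Ω} {i : ℕ} (h : IsPos C n E p i) : edge p (C.l i) ∈ E := by
  have := h.2 i
  rwa [act_inv_act] at this

/-- The key counting inequality -/
theorem count_le (hp : C.Prim) (hn : 0 < n) (hI : Irred C n E) :
    (W0 C n E).ncard + (verts E).card ≤ E.card := by
  classical
  obtain ⟨ρ, hρ, hsame, hopp⟩ := C.exists_height hp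
  have hsucc : ∀ i j : ℕ, (i + 1) % C.L = (j + 1) % C.L → i % C.L = j % C.L := by
    intro i j h
    exact Nat.ModEq.add_right_cancel' 1 h
  have hsucc' : ∀ i j : ℕ, i % C.L = j % C.L → (i + 1) % C.L = (j + 1) % C.L := by
    intro i j h
    exact Nat.ModEq.add_right 1 h
  let HE : ℕ → ℕ := fun i => if (C.l i).2 then ρ i else ρ (i + 1)
  have HE_congr : ∀ i j, i % C.L = j % C.L → HE i = HE j := by
    intro i j h
    simp only [HE, C.l_congr h, (hρ i j).mpr h, (hρ (i+1) (j+1)).mpr (hsucc' _ _ h)]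
  -- comparison
  have cmp_same : ∀ i j, C.l i = C.l j → (HE i ≤ HE j ↔ ρ i ≤ ρ j) ∧ (HE i ≤ HE j ↔ ρ (i+1) ≤ ρ (j+1)) := by
    intro i j h
    have h1 := hsame j i h.symm
    simp only [HE, h]
    cases (C.l j).2 <;> simp <;> omega
  have cmp_opp : ∀ i j, C.l j = linv (C.l i) → (HE i ≤ HE j ↔ ρ i ≤ ρ (j+1)) ∧ (HE i ≤ HE j ↔ ρ (i+1) ≤ ρ j) ∧
      (HE j ≤ HE i ↔ ρ (j + 1) ≤ ρ i) ∧ (HE j ≤ HE i ↔ ρ j ≤ ρ (i+1)) := by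
    intro i j h
    have h' : C.l i = linv (C.l j) := by rw [h, linv_linv]
    have h1 := hopp i j h
    have h2 := hopp j i h'
    simp only [HE, h]
    have h3 : ρ i ≠ ρ (j+1) := by
      intro h3
      rw [hρ] at h3
      apply C.red j
      rw [← C.l_congr h3, h']
    have h4 : ρ (i+1) ≠ ρ j := by
      intro h3
      rw [hρ] at h3
      apply C.red i
      rw [C.l_congr h3, h]
    have h5 : (linv (C.l i)).2 = !(C.l i).2 := rfl
    rw [h5]
    cases (C.l i).2 <;> simp <;> omega
  -- crossings of the same edge with the same height agree
  have HE_inj : ∀ (p : Ω) i (q : Ω) j, edge p (C.l i) = edge q (C.l j) → HE i = HE j → p = q ∧ i % C.L = j % C.L := by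
    intro p i q j he hh
    rcases edge_eq_cases he with ⟨h1, h2⟩ | ⟨h1, h2⟩
    · refine ⟨h2, ?_⟩
      rw [← hρ]
      have a := (cmp_same i j h1).1
      have b := (cmp_same j i h1.symm).1
      omega
    · exfalso
      have a := cmp_opp i j h1
      have : ρ i = ρ (j+1) := by omega
      rw [hρ] at this
      apply C.red j
      rw [← C.l_congr this, h1, linv_linv]
  let Top : Ω → ℕ → Prop := fun p i => IsPos C n E p i ∧
    ∀ q j, IsPos C n E q j → edge q (C.l j) = edge p (C.l i) → HE j ≤ HE i
  have Top_congr : ∀ p i j, i % C.L = j % C.L → (Top p i → Top p j) := by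
    intro p i j h ⟨h1, h2⟩
    refine ⟨(isPos_congr hn h).mp h1, ?_⟩
    rw [← C.l_congr h, ← HE_congr i j h]
    exact h2
  have Top_uniq : ∀ p i q j, Top p i → Top q j → edge p (C.l i) = edge q (C.l j) →
      p = q ∧ i % C.L = j % C.L := by
    intro p i q j h1 h2 he
    exact HE_inj p i q j he (le_antisymm (h2.2 _ _ h1.1 he) (h1.2 _ _ h2.1 he.symm))
  -- transitions
  have exU : ∃ ip, ∀ i, ρ i ≤ ρ ip := by
    obtain ⟨ip, hip, hmax⟩ := Finset.exists_max_image (Finset.range C.L) ρ ⟨0, Finset.mem_range.mpr C.hL⟩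
    refine ⟨ip, fun i => ?_⟩
    rw [(hρ i (i % C.L)).mpr (by rw [Nat.mod_mod])]
    exact hmax _ (Finset.mem_range.mpr (Nat.mod_lt _ C.hL))
  have exD : ∃ im, ∀ i, ρ im ≤ ρ i := by
    obtain ⟨ip, hip, hmax⟩ := Finset.exists_min_image (Finset.range C.L) ρ ⟨0, Finset.mem_range.mpr C.hL⟩
    refine ⟨ip, fun i => ?_⟩
    rw [(hρ i (i % C.L)).mpr (by rw [Nat.mod_mod])]
    exact hmax _ (Finset.mem_range.mpr (Nat.mod_lt _ C.hL))
  obtain ⟨ip, hip⟩ := exU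
  obtain ⟨im, him⟩ := exD
  have topU : ∀ p, IsPos C n E p ip → Top p ip := by
    intro p hp
    refine ⟨hp, fun q j hq he => ?_⟩
    rcases edge_eq_cases he with ⟨h1, h2⟩ | ⟨h1, h2⟩
    · exact (cmp_same _ _ h1).1.mpr (hip _)
    · exact (cmp_opp _ _ h1).2.1.mpr (hip _)
  have notTop : ∀ p, ¬ Top p im := by
    rintro p ⟨h1, h2⟩
    have hE := isPos_edge h1
    have key : ∀ q j, IsPos C n E q j → edge q (C.l j) = edge p (C.l im) → p = q ∧ im % C.L = j % C.L := by
      intro q j hq he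
      refine HE_inj _ _ _ _ he.symm (le_antisymm ?_ (h2 q j hq he))
      rcases edge_eq_cases he with ⟨h1, h2⟩ | ⟨h1, h2⟩
      · exact (cmp_same _ _ h1.symm).1.mpr (him _)
      · exact (cmp_opp _ _ h1).2.2.2.mpr (him _)
    obtain ⟨u, u', i, i', hu, hu', hi, hi', hne, he, he'⟩ := hI _ hE
    have a := key _ _ (isPos_of u hu i) he
    have b := key _ _ (isPos_of u' hu' i') he'
    have : i = i' := by
      rw [← Nat.mod_eq_of_lt hi, ← Nat.mod_eq_of_lt hi', ← a.2, ← b.2]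
    subst this
    apply hne
    rw [act_inj (a.1.symm.trans b.1)]
  have trans : ∀ u ∈ W0 C n E, ∃ i, ip ≤ i ∧ i < ip + C.L ∧ Top (act u (C.h i)) i ∧
      ¬ Top (act u (C.h (i+1))) (i+1) := by
    intro u hu
    -- first index after ip which is not top
    have hex : ∃ k, ¬ Top (act u (C.h (ip + k))) (ip + k) ∧ k ≤ C.L := by
      obtain ⟨k, hk, hk'⟩ : ∃ k, k ≤ C.L ∧ (ip + k) % C.L = im % C.L := by
        refine ⟨(im + (C.L - ip % C.L)) % C.L, (Nat.mod_lt _ C.hL).le, ?_⟩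
        have h0 := Nat.mod_lt ip C.hL
        have h1 : ip + (im + (C.L - ip % C.L)) = im + C.L * (ip / C.L + 1) := by
          have := Nat.mod_add_div ip C.L
          rw [mul_add]
          omega
        rw [Nat.add_mod, Nat.mod_mod, ← Nat.add_mod, h1]
        simp
      exact ⟨k, fun h => notTop _ (Top_congr _ _ _ hk' h), hk⟩
    have hk := Nat.find_spec hex
    set k := Nat.find hex with hkdef
    have hk0 : k ≠ 0 := by
      intro h0
      rw [h0] at hk
      exact hk.1 (topU _ (isPos_of u hu ip))
    refine ⟨ip + (k - 1), by omega, by omega, ?_, ?_⟩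
    · have := Nat.find_min hex (m := k - 1) (by omega)
      by_contra hcon
      exact this ⟨hcon, by omega⟩
    · have : ip + (k - 1) + 1 = ip + k := by omega
      rw [this]; exact hk.1
  have vtop : ∀ v ∈ verts E, ∃ p i, Top p i ∧ act p (ltr (C.l i)) = v ∧ Top v (i+1) := by
    intro v hv
    obtain ⟨a, ha⟩ := mem_verts.mp hv
    have hpos : ∃ i, IsPos C n E v i := by
      obtain ⟨u, -, i, -, hu, -, -, -, -, he, -⟩ := hI _ ha
      rcases edge_eq_cases he with ⟨h1, h2⟩ | ⟨h1, h2⟩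
      · exact ⟨i, h2 ▸ isPos_of u hu i⟩
      · exact ⟨i + 1, by rw [h2, isPos_succ]; exact isPos_of u hu i⟩
    obtain ⟨i0, hi0⟩ := hpos
    have hmod : ∀ i, IsPos C n E v (i % C.L) ↔ IsPos C n E v i := fun i =>
      isPos_congr hn (Nat.mod_mod _ _)
    obtain ⟨i1, hi1, hmax⟩ := Finset.exists_max_image
      ((Finset.range C.L).filter (fun i => IsPos C n E v i)) ρ
      ⟨i0 % C.L, Finset.mem_filter.mpr ⟨Finset.mem_range.mpr (Nat.mod_lt _ C.hL), (hmod _).mpr hi0⟩⟩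
    have hi1' := (Finset.mem_filter.mp hi1).2
    -- shift
    obtain ⟨i, hi⟩ : ∃ i, i + 1 = i1 + C.L := ⟨i1 + C.L - 1, by have := C.hL; omega⟩
    have hipos : IsPos C n E v (i + 1) := by rw [hi, isPos_add_L hn]; exact hi1'
    have hmax' : ∀ j, IsPos C n E v j → ρ j ≤ ρ (i + 1) := by
      intro j hj
      rw [(hρ j (j % C.L)).mpr (Nat.mod_mod _ _).symm, (hρ (i+1) i1).mpr (by rw [hi]; simp)]
      exact hmax _ (Finset.mem_filter.mpr ⟨Finset.mem_range.mpr (Nat.mod_lt _ C.hL), (hmod _).mpr hj⟩)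
    have hvp : v = act (act v (ltr (C.l i))⁻¹) (ltr (C.l i)) := (act_inv_act _ _).symm
    refine ⟨act v (ltr (C.l i))⁻¹, i, ⟨?_, ?_⟩, hvp.symm, hipos, ?_⟩
    · rw [← isPos_succ, ← hvp]; exact hipos
    · intro q j hq he
      rcases edge_eq_cases he with ⟨h1, h2⟩ | ⟨h1, h2⟩
      · refine (cmp_same _ _ h1).2.mpr (hmax' _ ?_)
        rw [hvp, ← h2, ← h1, isPos_succ]; exact hq
      · refine (cmp_opp _ _ h1).1.mpr (hmax' _ ?_)
        have : q = v := by
          rw [hvp, h2, h1, ltr_linv, act_act_inv]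
        rw [← this]; exact hq
    · intro q j hq he
      rcases edge_eq_cases he with ⟨h1, h2⟩ | ⟨h1, h2⟩
      · exact (cmp_same _ _ h1).1.mpr (hmax' _ (h2 ▸ hq))
      · refine (cmp_opp _ _ h1).2.1.mpr (hmax' _ ?_)
        rw [h2, isPos_succ]; exact hq
  choose! tu htu1 htu2 htu3 htu4 using trans
  choose! vp vi hv1 hv2 hv3 using vtop
  let F : Ω ⊕ Ω → Ω × X := fun s => match s with
    | Sum.inl u => edge (act u (C.h (tu u))) (C.l (tu u))
    | Sum.inr v => edge (vp v) (C.l (vi v))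
  have hWf : (W0 C n E).Finite := W0_finite
  have hcard : (W0 C n E).ncard + (verts E).card = (hWf.toFinset.disjSum (verts E)).card := by
    rw [Finset.card_disjSum, Set.ncard_eq_toFinset_card _ hWf]
  rw [hcard]
  apply Finset.card_le_card_of_injOn F
  · intro s hs
    rcases s with u | v
    · have hu : u ∈ W0 C n E := by simpa using hs
      exact hu.2 _
    · have hv : v ∈ verts E := by simpa using hs
      exact isPos_edge (hv1 v hv).1
  · intro s hs s' hs' heq
    rcases s with u | v <;> rcases s' with u' | v'
    · have hu : u ∈ W0 C n E := by simpa using hs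
      have hu' : u' ∈ W0 C n E := by simpa using hs'
      obtain ⟨a, b⟩ := Top_uniq _ _ _ _ (htu3 u hu) (htu3 u' hu') heq
      have h1 := htu1 u hu
      have h2 := htu2 u hu
      have h1' := htu1 u' hu'
      have h2' := htu2 u' hu'
      have : tu u = tu u' := by
        rcases le_total (tu u) (tu u') with h | h
        · have := (Nat.modEq_iff_dvd' h).mp b
          have := Nat.eq_zero_of_dvd_of_lt this (by omega)
          omega
        · have := (Nat.modEq_iff_dvd' h).mp b.symm
          have := Nat.eq_zero_of_dvd_of_lt this (by omega)
          omega
      rw [this] at a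
      rw [act_inj a]
    · exfalso
      have hu : u ∈ W0 C n E := by simpa using hs
      have hv : v' ∈ verts E := by simpa using hs'
      obtain ⟨a, b⟩ := Top_uniq _ _ _ _ (htu3 u hu) (hv1 v' hv) heq
      apply htu4 u hu
      rw [C.h_succ, act_mul, a, C.l_congr b, hv2 v' hv]
      exact Top_congr _ _ _ (hsucc' _ _ b.symm) (hv3 v' hv)
    · exfalso
      have hu : u' ∈ W0 C n E := by simpa using hs'
      have hv : v ∈ verts E := by simpa using hs
      obtain ⟨a, b⟩ := Top_uniq _ _ _ _ (htu3 u' hu) (hv1 v hv) heq.symm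
      apply htu4 u' hu
      rw [C.h_succ, act_mul, a, C.l_congr b, hv2 v hv]
      exact Top_congr _ _ _ (hsucc' _ _ b.symm) (hv3 v hv)
    · have hv : v ∈ verts E := by simpa using hs
      have hv' : v' ∈ verts E := by simpa using hs'
      obtain ⟨a, b⟩ := Top_uniq _ _ _ _ (hv1 v hv) (hv1 v' hv') heq
      congr 1
      rw [← hv2 v hv, ← hv2 v' hv', a, C.l_congr b]
end
end Pride

namespace Pride
variable {X Ω : Type} [MulAction (FreeGroup X) Ω]

theorem trav_h {C : CW X} {n : ℕ} {E : Finset (Ω × X)} {u : Ω} (hu : u ∈ W0 C n E) (i : ℕ) :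
    Trav E u (C.h i) := by
  induction i with
  | zero => exact Trav.one _
  | succ i ih => rw [C.h_succ]; exact ih.mul (Trav.single (hu.2 i))

theorem trav_R_pow {C : CW X} {n : ℕ} {E : Finset (Ω × X)} {u : Ω} (hu : u ∈ W0 C n E) (k : ℕ) :
    Trav E u (C.R ^ k) := by
  rw [← C.h_mul_L]; exact trav_h hu _

theorem R_pow_mem_pi1 {C : CW X} {n : ℕ} {E : Finset (Ω × X)} {u : Ω} (hu : u ∈ W0 C n E) :
    C.R ^ n ∈ pi1 E u := ⟨hu.1, trav_R_pow hu n⟩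

/-- normal closure of the lifts of `R ^ n` -/
def Nn (C : CW X) (n : ℕ) (E : Finset (Ω × X)) (v : Ω) : Subgroup (FreeGroup X) :=
  Subgroup.closure {g | ∃ t, Trav E v t ∧ act v t ∈ W0 C n E ∧ g = t * C.R ^ n * t⁻¹}

section
variable {C : CW X} {n : ℕ} {E E' : Finset (Ω × X)} {v : Ω}

theorem Nn_gen {t : FreeGroup X} (ht : Trav E v t) (hu : act v t ∈ W0 C n E) :
    t * C.R ^ n * t⁻¹ ∈ Nn C n E v := Subgroup.subset_closure ⟨t, ht, hu, rfl⟩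

theorem Nn_le_pi1 : Nn C n E v ≤ pi1 E v := by
  unfold Nn
  rw [Subgroup.closure_le]
  rintro _ ⟨t, ht, hu, rfl⟩
  exact conj_mem_pi1 ht (R_pow_mem_pi1 hu)

theorem Nn_conj {u : Ω} {g x : FreeGroup X} (hg : Trav E v g) (hu : act v g = u) (hx : x ∈ Nn C n E u) :
    g * x * g⁻¹ ∈ Nn C n E v := by
  subst hu
  have : Nn C n E (act v g) ≤ (Nn C n E v).comap (MulAut.conj g).toMonoidHom := by
    rw [Nn, Subgroup.closure_le]
    rintro _ ⟨t, ht, hu, rfl⟩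
    rw [← act_mul] at hu
    have := Nn_gen (hg.mul ht) hu
    simpa [mul_assoc] using this
  simpa using this hx

theorem Nn_mono (h : E ⊆ E') : Nn C n E v ≤ Nn C n E' v := by
  apply Subgroup.closure_mono
  rintro _ ⟨t, ht, hu, rfl⟩
  exact ⟨t, ht.mono h, W0_mono h hu, rfl⟩

variable (C n E v) in
/-- as a subgroup of the fundamental group -/
def Nk : Subgroup (pi1 E v) := (Nn C n E v).subgroupOf (pi1 E v)

instance : (Nk C n E v).Normal := by
  constructor
  rintro ⟨x, hx'⟩ hx ⟨g, hg⟩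
  exact Nn_conj hg.2 hg.1 hx

theorem mem_Nk {k : pi1 E v} : k ∈ Nk C n E v ↔ (k : FreeGroup X) ∈ Nn C n E v := Iff.rfl

variable (C n E v) in
/-- fundamental group of the two-complex -/
abbrev Q : Type := pi1 E v ⧸ Nk C n E v

/-- conjugation map on fundamental groups -/
def conjPi (h : E' ⊆ E) {u : Ω} {g : FreeGroup X} (hg : Trav E v g) (hu : act v g = u) :
    pi1 E' u →* pi1 E v where
  toFun k := ⟨g * k * g⁻¹, conj_mem_pi1 hg (by rw [hu]; exact pi1_mono h _ k.2)⟩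
  map_one' := by ext; simp
  map_mul' a b := by ext; simp

/-- the induced map of quotients -/
def Qmap (h : E' ⊆ E) {u : Ω} {g : FreeGroup X} (hg : Trav E v g) (hu : act v g = u) :
    Q C n E' u →* Q C n E v :=
  QuotientGroup.map _ _ (conjPi h hg hu) (by
    rintro ⟨k, hk⟩ hk'
    exact Nn_conj hg hu (Nn_mono h hk'))

theorem Qmap_mk (h : E' ⊆ E) {u : Ω} {g : FreeGroup X} (hg : Trav E v g) (hu : act v g = u) (k : pi1 E' u) :
    Qmap (C := C) (n := n) h hg hu (QuotientGroup.mk k) = QuotientGroup.mk (conjPi h hg hu k) := rfl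

theorem Qmap_comp {E'' : Finset (Ω × X)} (h : E' ⊆ E) {u : Ω} {g : FreeGroup X} (hg : Trav E v g)
    (hu : act v g = u) (h' : E'' ⊆ E') {u' : Ω} {g' : FreeGroup X} (hg' : Trav E' u g')
    (hu' : act u g' = u') (q : Q C n E'' u') :
    Qmap (h'.trans h) (hg.mul (by rw [hu]; exact hg'.mono h)) (by rw [act_mul, hu, hu']) q =
      Qmap (C := C) (n := n) h hg hu (Qmap h' hg' hu' q) := by
  obtain ⟨k, rfl⟩ := QuotientGroup.mk_surjective q
  rw [Qmap_mk, Qmap_mk, Qmap_mk]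
  congr 1
  ext
  simp [conjPi, mul_assoc]

/-- reachability -/
def Reach (E : Finset (Ω × X)) (v ω : Ω) : Prop := ∃ t, Trav E v t ∧ act v t = ω

/-- connectedness -/
def Conn (E : Finset (Ω × X)) (v : Ω) : Prop := ∀ e ∈ E, Reach E v e.1

theorem Reach.refl (v : Ω) : Reach E v v := ⟨1, Trav.one _, act_one _⟩
theorem Reach.trans {a b c : Ω} : Reach E a b → Reach E b c → Reach E a c := by
  rintro ⟨t, ht, rfl⟩ ⟨s, hs, rfl⟩
  exact ⟨t * s, ht.mul hs, act_mul _ _ _⟩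
theorem Reach.symm {a b : Ω} : Reach E a b → Reach E b a := by
  rintro ⟨t, ht, rfl⟩
  exact ⟨t⁻¹, ht.inv, act_act_inv _ _⟩
theorem Reach.edge {a : Ω} {l : X × Bool} (h : edge a l ∈ E) : Reach E a (act a (ltr l)) :=
  ⟨ltr l, Trav.single h, rfl⟩
theorem Reach.mono (h : E ⊆ E') {a b : Ω} : Reach E a b → Reach E' a b := by
  rintro ⟨t, ht, rfl⟩
  exact ⟨t, ht.mono h, rfl⟩

theorem Conn.reach (h : Conn E v) {ω : Ω} {a : X × Bool} (he : Pride.edge ω a ∈ E) : Reach E v ω := by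
  obtain ⟨x, b⟩ := a
  cases b
  · have h1 := h _ he
    rw [edge_false] at he h1
    have := Reach.edge (E := E) (a := act ω (FreeGroup.of x)⁻¹) (l := (x, true)) he
    rw [ltr_true, act_inv_act] at this
    exact h1.trans this
  · exact h _ he

theorem Conn.reach_W0 (h : Conn E v) {u : Ω} (hu : u ∈ W0 C n E) : Reach E v u := by
  have := hu.2 0
  rw [C.h_zero, act_one] at this
  exact h.reach this

/-- A homomorphism killing one lift per starting point kills `Nk`. -/
theorem Nk_le_ker {P : Type} [Group P] (ρ : pi1 E v →* P)
    (H : ∀ u ∈ W0 C n E, Reach E v u → ∃ t, Trav E v t ∧ act v t = u ∧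
      ∀ k : pi1 E v, (k : FreeGroup X) = t * C.R ^ n * t⁻¹ → ρ k = 1) :
    Nk C n E v ≤ ρ.ker := by
  have key : Nn C n E v ≤ ρ.ker.map (pi1 E v).subtype := by
    rw [Nn, Subgroup.closure_le]
    rintro _ ⟨t, ht, hu, rfl⟩
    obtain ⟨s, hs, hsu, hk⟩ := H _ hu ⟨t, ht, rfl⟩
    have hz : t * s⁻¹ ∈ pi1 E v := mul_inv_mem_pi1 ht hs hsu.symm
    have hk2 : s * C.R ^ n * s⁻¹ ∈ pi1 E v :=
      conj_mem_pi1 hs (by rw [hsu]; exact R_pow_mem_pi1 hu)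
    refine ⟨⟨_, hz⟩ * ⟨_, hk2⟩ * ⟨_, hz⟩⁻¹, ?_, ?_⟩
    · change ρ _ = 1
      rw [map_mul, map_mul, map_inv, hk ⟨_, hk2⟩ rfl]; simp
    · simp [mul_assoc]
  rintro ⟨k, hk⟩ hk'
  obtain ⟨k2, h2, h3⟩ := key hk'
  have : k2 = ⟨k, hk⟩ := Subtype.ext h3
  rw [← this]; exact h2

end

/-- recognizing a free product -/
noncomputable def coprodEquiv {A B G : Type} [Group A] [Group B] [Group G] (i : A →* G) (j : B →* G)
    (ρ : G →* Monoid.Coprod A B) (hi : ∀ a, ρ (i a) = Monoid.Coprod.inl a)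
    (hj : ∀ b, ρ (j b) = Monoid.Coprod.inr b)
    (hgen : Subgroup.closure (Set.range i ∪ Set.range j) = ⊤) : G ≃* Monoid.Coprod A B :=
  MonoidHom.toMulEquiv ρ (Monoid.Coprod.lift i j) (by
    apply MonoidHom.eq_of_eqOn_dense hgen
    rintro _ (⟨a, rfl⟩ | ⟨b, rfl⟩)
    · simp [hi]
    · simp [hj]) (by
    ext x
    · simp [hi]
    · simp [hj])

/-- a free product decomposition, with a given first factor map -/
def SplitAs {A B G : Type} [Group A] [Group B] [Group G] (i : A →* G) (j : B →* G) : Prop :=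
  (∃ ρ : G →* Monoid.Coprod A B, (∀ a, ρ (i a) = Monoid.Coprod.inl a) ∧
    (∀ b, ρ (j b) = Monoid.Coprod.inr b)) ∧ Subgroup.closure (Set.range i ∪ Set.range j) = ⊤

theorem SplitAs.equiv {A B G : Type} [Group A] [Group B] [Group G] {i : A →* G} {j : B →* G}
    (h : SplitAs i j) : Nonempty (G ≃* Monoid.Coprod A B) := by
  obtain ⟨⟨ρ, h1, h2⟩, h3⟩ := h
  exact ⟨coprodEquiv i j ρ h1 h2 h3⟩

theorem SplitAs.bij_left {A B G : Type} [Group A] [Group B] [Group G] {i : A →* G} {j : B →* G}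
    (h : SplitAs i j) [Subsingleton B] : Function.Bijective i := by
  obtain ⟨⟨ρ, h1, h2⟩, h3⟩ := h
  constructor
  · intro a b hab
    have : ρ (i a) = ρ (i b) := by rw [hab]
    rw [h1, h1] at this
    exact Monoid.Coprod.inl_injective this
  · rw [← MonoidHom.range_eq_top, ← h3]
    apply le_antisymm
    · rw [h3]; exact le_top
    · rw [Subgroup.closure_le]
      rintro _ (⟨a, rfl⟩ | ⟨b, rfl⟩)
      · exact ⟨a, rfl⟩
      · rw [Subsingleton.elim b 1, map_one]; exact one_mem _

theorem SplitAs.bij_right {A B G : Type} [Group A] [Group B] [Group G] {i : A →* G} {j : B →* G}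
    (h : SplitAs i j) [Subsingleton A] : Function.Bijective j := by
  obtain ⟨⟨ρ, h1, h2⟩, h3⟩ := h
  constructor
  · intro a b hab
    have : ρ (j a) = ρ (j b) := by rw [hab]
    rw [h2, h2] at this
    exact Monoid.Coprod.inr_injective this
  · rw [← MonoidHom.range_eq_top, ← h3]
    apply le_antisymm
    · rw [h3]; exact le_top
    · rw [Subgroup.closure_le]
      rintro _ (⟨a, rfl⟩ | ⟨b, rfl⟩)
      · rw [Subsingleton.elim a 1, map_one]; exact one_mem _
      · exact ⟨b, rfl⟩

/-- maps out of cyclic groups -/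
theorem exists_zmodHom {G : Type} [Group G] (m : ℕ) (s : G) (hs : s ^ m = 1) :
    ∃ j : Multiplicative (ZMod m) →* G, j (Multiplicative.ofAdd 1) = s := by
  refine ⟨AddMonoidHom.toMultiplicativeLeft (ZMod.lift m ⟨(zmultiplesHom (Additive G)) (Additive.ofMul s), ?_⟩), ?_⟩
  · simp [← ofMul_pow, hs]
  · have := ZMod.lift_coe m (⟨(zmultiplesHom (Additive G)) (Additive.ofMul s), by simp [← ofMul_pow, hs]⟩ : {f : ℤ →+ Additive G // f m = 0}) 1
    simp at this
    simp [this]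

theorem zmodHom_ext {G : Type} [Group G] {m : ℕ} {f g : Multiplicative (ZMod m) →* G}
    (h : f (Multiplicative.ofAdd 1) = g (Multiplicative.ofAdd 1)) : f = g := by
  refine MonoidHom.ext fun x => ?_
  obtain ⟨k, hk⟩ := ZMod.intCast_surjective (Multiplicative.toAdd x)
  have : x = (Multiplicative.ofAdd (1 : ZMod m)) ^ k := by
    rw [← ofAdd_zsmul]; simp [hk]
  rw [this, map_zpow, map_zpow, h]

theorem zmod_range {G : Type} [Group G] {m : ℕ} (f : Multiplicative (ZMod m) →* G) (b) :
    f b ∈ Subgroup.zpowers (f (Multiplicative.ofAdd 1)) := by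
  obtain ⟨k, hk⟩ := ZMod.intCast_surjective (Multiplicative.toAdd b)
  have : b = (Multiplicative.ofAdd (1 : ZMod m)) ^ k := by
    rw [← ofAdd_zsmul]; simp [hk]
  exact ⟨k, by rw [this, map_zpow]⟩
end Pride

namespace Pride
variable {X Ω : Type} [MulAction (FreeGroup X) Ω]
section
variable {C : CW X} {n : ℕ} {E E1 : Finset (Ω × X)} {v : Ω}

/-- letter version of the generation lemma -/
theorem gen_of_gauge' (E : Finset (Ω × X)) (Γ : Subgroup (FreeGroup X)) (T : Ω → FreeGroup X)
    (hf : ∀ e ∈ E, ∃ ω a, edge ω a = e ∧ T ω * ltr a * (T (act ω (ltr a)))⁻¹ ∈ Γ)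
    {ω : Ω} {g : FreeGroup X} (h : Trav E ω g) : T ω * g * (T (act ω g))⁻¹ ∈ Γ := by
  apply gen_of_gauge E Γ T _ h
  intro ω x he
  obtain ⟨ω', a, h1, h2⟩ := hf _ he
  rw [← edge_true] at h1
  rcases edge_eq_cases h1 with ⟨h3, h4⟩ | ⟨h3, h4⟩
  · subst h3 h4; exact h2
  · have h5 : a = (x, false) := by rw [← linv_linv a, ← h3]; rfl
    subst h5
    have := inv_mem h2
    rw [h4]
    simpa [ltr_false, act_inv_act, mul_assoc] using this

theorem Trav.reach_of_endpoints {e : Ω × X} [DecidableEq (Ω × X)]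
    (hs : ∀ ω a, edge ω a = e → Reach (E.erase e) v ω)
    {ω : Ω} {g : FreeGroup X} (h : Trav E ω g) (hr : Reach (E.erase e) v ω) :
    Reach (E.erase e) v (act ω g) := by
  induction h with
  | one ω => rwa [act_one]
  | cons ω a g he t ih =>
    rw [act_mul]
    apply ih
    by_cases h1 : edge ω a = e
    · exact hs _ (linv a) (by rw [edge_linv, h1])
    · exact hr.trans (Reach.edge (Finset.mem_erase.mpr ⟨h1, he⟩))

/-- a choice of paths -/
theorem exists_tau (E : Finset (Ω × X)) (v : Ω) : ∃ τ : Ω → FreeGroup X, τ v = 1 ∧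
    ∀ ω, Reach E v ω → Trav E v (τ ω) ∧ act v (τ ω) = ω := by
  classical
  refine ⟨fun ω => if ω = v then 1 else if h : Reach E v ω then h.choose else 1, by simp, ?_⟩
  intro ω h
  by_cases h1 : ω = v
  · subst h1; simp [Trav.one, act_one]
  · simp only [h1, if_false, h, dite_true]
    exact h.choose_spec

theorem tau_edge_mem {τ : Ω → FreeGroup X} (hτ : ∀ ω, Reach E v ω → Trav E v (τ ω) ∧ act v (τ ω) = ω)
    {ω : Ω} {g : FreeGroup X} (h : Trav E ω g) (hr : Reach E v ω) :
    τ ω * g * (τ (act ω g))⁻¹ ∈ pi1 E v := by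
  have h1 := hτ _ hr
  have h2 := hτ _ (hr.trans ⟨g, h, rfl⟩)
  apply mul_inv_mem_pi1 _ h2.1
  · rw [act_mul, h1.2, h2.2]
  · exact h1.1.mul (by rw [h1.2]; exact h)

/-- A multiplicative cocycle built from a homomorphism and a choice of paths -/
theorem hol_tau {P : Type} [Group P] {τ : Ω → FreeGroup X}
    (hτ : ∀ ω, Reach E v ω → Trav E v (τ ω) ∧ act v (τ ω) = ω) (α : pi1 E v →* P) (f : Ω × X → P)
    (hf : ∀ ω x, (ω, x) ∈ E → ∀ k : pi1 E v, (k : FreeGroup X) =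
      τ ω * FreeGroup.of x * (τ (act ω (FreeGroup.of x)))⁻¹ → f (ω, x) = α k) (hE : Conn E v)
    {ω : Ω} {g : FreeGroup X} (h : Trav E ω g) (hr : Reach E v ω) (k : pi1 E v)
    (hk : (k : FreeGroup X) = τ ω * g * (τ (act ω g))⁻¹) : hol f ω g = α k := by
  classical
  let c : Ω → FreeGroup X → P := fun ω g =>
    if h : τ ω * g * (τ (act ω g))⁻¹ ∈ pi1 E v then α ⟨_, h⟩ else 1
  have key : ∀ ω g, Trav E ω g → Reach E v ω → hol f ω g = c ω g := by
    intro ω g h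
    induction h with
    | one ω =>
      intro hr
      have : τ ω * 1 * (τ (act ω (1 : FreeGroup X)))⁻¹ = 1 := by rw [act_one]; simp
      simp only [c, hol_one]
      rw [dif_pos (by rw [this]; exact one_mem _)]
      rw [← map_one α]
      congr 1
      exact Subtype.ext this.symm
    | cons ω a g he t ih =>
      intro hr
      have hr' := hr.trans (Reach.edge he)
      rw [hol_mul, ih hr']
      have m1 := tau_edge_mem hτ (Trav.single he) hr
      have m2 := tau_edge_mem hτ t hr'
      have m3 := tau_edge_mem hτ ((Trav.single he).mul t) hr
      have e1 : ∀ k : pi1 E v, (k : FreeGroup X) = τ ω * ltr a * (τ (act ω (ltr a)))⁻¹ →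
          hol f ω (ltr a) = α k := by
        intro k hk
        obtain ⟨x, b⟩ := a
        cases b
        · rw [edge_false] at he
          rw [ltr_false] at hk ⊢
          have h1 := hol_inv f (act ω (FreeGroup.of x)⁻¹) (FreeGroup.of x)
          rw [act_inv_act, hol_of] at h1
          rw [h1, hf _ _ he (k⁻¹) (by simp [hk, act_inv_act, mul_assoc]), map_inv, inv_inv]
        · rw [ltr_true] at hk ⊢
          rw [hol_of]
          exact hf _ _ he _ hk
      replace e1 := e1 ⟨_, m1⟩ rfl
      simp only [c]
      rw [dif_pos m2, dif_pos m3, e1, ← map_mul]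
      congr 1
      ext
      simp [act_mul, mul_assoc]
  rw [key ω g h hr]
  simp only [c]
  have hm : τ ω * g * (τ (act ω g))⁻¹ ∈ pi1 E v := hk ▸ k.2
  rw [dif_pos hm]
  congr 1
  exact Subtype.ext hk.symm

/-- extending homomorphisms over a nonseparating edge -/
theorem ext_edge [DecidableEq (Ω × X)] {e : Ω × X} (hE1 : Conn (E.erase e) v)
    {τ : Ω → FreeGroup X} (hτv : τ v = 1)
    (hτ : ∀ ω, Reach (E.erase e) v ω → Trav (E.erase e) v (τ ω) ∧ act v (τ ω) = ω)
    {ω0 : Ω} {a0 : X × Bool} (he : edge ω0 a0 = e) (hr0 : Reach (E.erase e) v ω0)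
    (hr1 : Reach (E.erase e) v (act ω0 (ltr a0)))
    {P : Type} [Group P] (α : pi1 (E.erase e) v →* P) (c : P) :
    ∃ β : pi1 E v →* P, (∀ (k : pi1 (E.erase e) v) (k' : pi1 E v), (k' : FreeGroup X) = k → β k' = α k) ∧
      ∀ k : pi1 E v, (k : FreeGroup X) = τ ω0 * ltr a0 * (τ (act ω0 (ltr a0)))⁻¹ → β k = c := by
  classical
  let f : Ω × X → P := fun p => if p = e then (if a0.2 then c else c⁻¹) else
    if h : τ p.1 * FreeGroup.of p.2 * (τ (act p.1 (FreeGroup.of p.2)))⁻¹ ∈ pi1 (E.erase e) v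
      then α ⟨_, h⟩ else 1
  have hf : ∀ ω x, (ω, x) ∈ E.erase e → ∀ k : pi1 (E.erase e) v, (k : FreeGroup X) =
      τ ω * FreeGroup.of x * (τ (act ω (FreeGroup.of x)))⁻¹ → f (ω, x) = α k := by
    intro ω x he k hk
    have hne := (Finset.mem_erase.mp he).1
    simp only [f, hne, if_false]
    rw [dif_pos (hk ▸ k.2)]
    congr 1
    exact Subtype.ext hk.symm
  have hpath : ∀ ω, Reach (E.erase e) v ω → hol f v (τ ω) = 1 := by
    intro ω hr
    have h1 := hτ ω hr
    have := hol_tau hτ α f hf hE1 h1.1 (Reach.refl v) 1 (by rw [h1.2, hτv]; simp)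
    rw [this, map_one]
  refine ⟨holPi f E v, ?_, ?_⟩
  · intro k k' hk
    have := hol_tau hτ α f hf hE1 k.2.2 (Reach.refl v) k (by rw [k.2.1, hτv]; simp)
    rw [← this, ← hk]; rfl
  · intro k hk
    have : holPi f E v k = hol f v (k : FreeGroup X) := rfl
    rw [this, hk, hol_mul, hol_mul, hpath _ hr0, act_mul, (hτ _ hr0).2]
    have h2 := hol_inv f v (τ (act ω0 (ltr a0)))
    rw [(hτ _ hr1).2] at h2
    rw [h2, hpath _ hr1]
    simp only [one_mul, inv_one, mul_one]
    obtain ⟨x, b⟩ := a0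
    cases b
    · rw [edge_false] at he
      have h1 := hol_inv f (act ω0 (FreeGroup.of x)⁻¹) (FreeGroup.of x)
      rw [act_inv_act, hol_of, he] at h1
      rw [ltr_false, h1]
      simp [f]
    · rw [edge_true] at he
      rw [ltr_true, hol_of, he]
      simp [f]

theorem ext_gen [DecidableEq (Ω × X)] {e : Ω × X} (hE1 : Conn (E.erase e) v)
    {τ : Ω → FreeGroup X} (hτv : τ v = 1)
    (hτ : ∀ ω, Reach (E.erase e) v ω → Trav (E.erase e) v (τ ω) ∧ act v (τ ω) = ω)
    {ω0 : Ω} {a0 : X × Bool} (he : edge ω0 a0 = e) (Γ : Subgroup (FreeGroup X))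
    (h1 : pi1 (E.erase e) v ≤ Γ) (h2 : τ ω0 * ltr a0 * (τ (act ω0 (ltr a0)))⁻¹ ∈ Γ) : pi1 E v ≤ Γ := by
  intro k hk
  have := gen_of_gauge' E Γ τ (fun f hf => ?_) hk.2
  · rw [hk.1, hτv] at this; simpa using this
  · by_cases hfe : f = e
    · subst hfe; exact ⟨ω0, a0, he, h2⟩
    · have hf' : f ∈ E.erase e := Finset.mem_erase.mpr ⟨hfe, hf⟩
      exact ⟨f.1, (f.2, true), rfl, h1 (tau_edge_mem hτ (Trav.single hf') (hE1 _ hf'))⟩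

/-- splitting along a nonseparating edge, abstract form -/
theorem split_ns [DecidableEq (Ω × X)] {e : Ω × X} (hE1 : Conn (E.erase e) v)
    {τ : Ω → FreeGroup X} (hτv : τ v = 1)
    (hτ : ∀ ω, Reach (E.erase e) v ω → Trav (E.erase e) v (τ ω) ∧ act v (τ ω) = ω)
    {ω0 : Ω} {a0 : X × Bool} (he : edge ω0 a0 = e) (hr0 : Reach (E.erase e) v ω0)
    (hr1 : Reach (E.erase e) v (act ω0 (ltr a0))) (heE : e ∈ E)
    (m : ℕ) (y1 y2 : FreeGroup X) (hy1 : y1 ∈ pi1 (E.erase e) v) (hy2 : y2 ∈ pi1 (E.erase e) v)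
    (S : FreeGroup X) (hS : S = y1 * (τ ω0 * ltr a0 * (τ (act ω0 (ltr a0)))⁻¹) * y2)
    (hSm : S ^ m ∈ Nn C n E v)
    (hrel : ∀ u ∈ W0 C n E, Reach E v u → u ∈ W0 C n (E.erase e) ∨
      ∃ t, Trav E v t ∧ act v t = u ∧ t * C.R ^ n * t⁻¹ = S ^ m) :
    ∃ j : Multiplicative (ZMod m) →* Q C n E v,
      SplitAs (Qmap (C := C) (n := n) (E.erase_subset e) (Trav.one v) (act_one v)) j := by
  have hsub := E.erase_subset e
  have hz : τ ω0 * ltr a0 * (τ (act ω0 (ltr a0)))⁻¹ ∈ pi1 E v := by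
    have a := hτ _ hr0
    have b := hτ _ hr1
    apply mul_inv_mem_pi1
    · exact (a.1.mono hsub).mul (Trav.single (by rw [a.2, he]; exact heE))
    · exact b.1.mono hsub
    · rw [act_mul, a.2, b.2]
  have hy1' := pi1_mono hsub v hy1
  have hy2' := pi1_mono hsub v hy2
  have hSp : S ∈ pi1 E v := by rw [hS]; exact mul_mem (mul_mem hy1' hz) hy2'
  let q1 : pi1 (E.erase e) v →* Monoid.Coprod (Q C n (E.erase e) v) (Multiplicative (ZMod m)) :=
    Monoid.Coprod.inl.comp (QuotientGroup.mk' _)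
  let b1 : Monoid.Coprod (Q C n (E.erase e) v) (Multiplicative (ZMod m)) := Monoid.Coprod.inr (Multiplicative.ofAdd (1 : ZMod m))
  obtain ⟨β, hβ1, hβ2⟩ := ext_edge hE1 hτv hτ he hr0 hr1 q1
    ((q1 ⟨y1, hy1⟩)⁻¹ * b1 * (q1 ⟨y2, hy2⟩)⁻¹)
  have hβS : β ⟨S, hSp⟩ = b1 := by
    have : (⟨S, hSp⟩ : pi1 E v) = ⟨y1, hy1'⟩ * ⟨_, hz⟩ * ⟨y2, hy2'⟩ := Subtype.ext hS
    rw [this, map_mul, map_mul, hβ1 ⟨y1, hy1⟩ ⟨y1, hy1'⟩ rfl, hβ1 ⟨y2, hy2⟩ ⟨y2, hy2'⟩ rfl,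
      hβ2 ⟨_, hz⟩ rfl]
    simp only [mul_assoc, inv_mul_cancel, mul_one, mul_inv_cancel_left]
  have hb1 : b1 ^ m = 1 := by
    simp only [b1]
    rw [← map_pow, ← ofAdd_nsmul]; simp
  have hker : Nk C n E v ≤ β.ker := by
    apply Nk_le_ker
    intro u hu hr
    rcases hrel u hu hr with h | ⟨t, ht, htu, htS⟩
    · obtain ⟨a, b⟩ := hτ u (hE1.reach_W0 h)
      refine ⟨τ u, a.mono hsub, b, fun k hk => ?_⟩
      have hm : τ u * C.R ^ n * (τ u)⁻¹ ∈ Nn C n (E.erase e) v := Nn_gen a (by rwa [b])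
      rw [hβ1 ⟨_, Nn_le_pi1 hm⟩ k hk]
      simp only [q1, MonoidHom.comp_apply]
      have : QuotientGroup.mk' (Nk C n (E.erase e) v) ⟨_, Nn_le_pi1 hm⟩ = 1 :=
        (QuotientGroup.eq_one_iff _).mpr hm
      rw [this, map_one]
    · refine ⟨t, ht, htu, fun k hk => ?_⟩
      have : k = ⟨S, hSp⟩ ^ m := Subtype.ext (by rw [hk, htS]; rfl)
      rw [this, map_pow, hβS, hb1]
  obtain ⟨j, hj⟩ := exists_zmodHom (G := Q C n E v) m (QuotientGroup.mk ⟨S, hSp⟩)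
    (by
      have h0 : (QuotientGroup.mk ((⟨S, hSp⟩ : pi1 E v) ^ m) : Q C n E v) = 1 :=
        (QuotientGroup.eq_one_iff _).mpr hSm
      rw [← h0]; rfl)
  refine ⟨j, ⟨QuotientGroup.lift _ β hker, ?_, ?_⟩, ?_⟩
  · intro a
    obtain ⟨k, rfl⟩ := QuotientGroup.mk_surjective a
    rw [Qmap_mk, QuotientGroup.lift_mk, hβ1 k _ (by simp [conjPi])]
    rfl
  · have : (QuotientGroup.lift _ β hker).comp j = Monoid.Coprod.inr := by
      apply zmodHom_ext
      rw [MonoidHom.comp_apply, hj, QuotientGroup.lift_mk, hβS]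
    intro b
    exact DFunLike.congr_fun this b
  · set Γ := Subgroup.closure (Set.range (Qmap (C := C) (n := n) (E.erase_subset e) (Trav.one v) (act_one v)) ∪ Set.range j) with hΓ
    have hle : pi1 E v ≤ (Γ.comap (QuotientGroup.mk' (Nk C n E v))).map (pi1 E v).subtype := by
      have hin : ∀ y (hy : y ∈ pi1 (E.erase e) v), (⟨y, pi1_mono hsub v hy⟩ : pi1 E v) ∈ Γ.comap (QuotientGroup.mk' (Nk C n E v)) := by
        intro y hy
        apply Subgroup.subset_closure
        left
        refine ⟨QuotientGroup.mk ⟨y, hy⟩, ?_⟩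
        rw [Qmap_mk]
        apply congrArg QuotientGroup.mk
        ext; simp [conjPi]
      have hSin : (⟨S, hSp⟩ : pi1 E v) ∈ Γ.comap (QuotientGroup.mk' (Nk C n E v)) :=
        Subgroup.subset_closure (Or.inr ⟨_, hj⟩)
      apply ext_gen hE1 hτv hτ he
      · intro y hy
        exact ⟨_, hin y hy, rfl⟩
      · refine ⟨⟨y1, hy1'⟩⁻¹ * ⟨S, hSp⟩ * ⟨y2, hy2'⟩⁻¹, mul_mem (mul_mem (inv_mem (hin _ hy1)) hSin) (inv_mem (hin _ hy2)), ?_⟩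
        simp [hS, mul_assoc]
    rw [eq_top_iff]
    intro q _
    obtain ⟨k, rfl⟩ := QuotientGroup.mk_surjective q
    obtain ⟨k', h1, h2⟩ := hle k.2
    have : k' = k := Subtype.ext h2
    rw [← this]; exact h1
end
end Pride

namespace Pride
variable {X Ω : Type} [MulAction (FreeGroup X) Ω]
section
variable {C : CW X} {n : ℕ} {E E1 : Finset (Ω × X)} {v : Ω}

theorem Trav.hit [DecidableEq (Ω × X)] {e : Ω × X} {ω : Ω} {g : FreeGroup X} (h : Trav E ω g)
    (hr : Reach (E.erase e) v ω) : Reach (E.erase e) v (act ω g) ∨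
      ∃ ω a, edge ω a = e ∧ Reach (E.erase e) v ω := by
  induction h with
  | one ω => left; rwa [act_one]
  | cons ω a g he t ih =>
    by_cases h1 : edge ω a = e
    · right; exact ⟨ω, a, h1, hr⟩
    · rw [act_mul]
      exact ih (hr.trans (Reach.edge (Finset.mem_erase.mpr ⟨h1, he⟩)))

theorem Conn.hit [DecidableEq (Ω × X)] {e : Ω × X} (hE : Conn E v) (he : e ∈ E) :
    ∃ ω a, edge ω a = e ∧ Reach (E.erase e) v ω := by
  obtain ⟨g, hg, hg'⟩ := hE e he
  rcases hg.hit (e := e) (Reach.refl v) with h | h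
  · rw [hg'] at h
    exact ⟨e.1, (e.2, true), rfl, h⟩
  · exact h

/-- the endpoints of an edge -/
theorem endpoint_cases {ω ω0 : Ω} {a a0 : X × Bool} {P : Ω → Prop} (h : edge ω a = edge ω0 a0)
    (h0 : P ω0) (h1 : P (act ω0 (ltr a0))) : P ω := by
  rcases edge_eq_cases h with ⟨_, rfl⟩ | ⟨h2, h3⟩
  · exact h0
  · rw [h3, h2, ltr_linv, act_act_inv] at h1; exact h1

theorem conn_erase [DecidableEq (Ω × X)] {e : Ω × X} (hE : Conn E v) {ω0 : Ω} {a0 : X × Bool}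
    (he : edge ω0 a0 = e) (hr0 : Reach (E.erase e) v ω0) (hr1 : Reach (E.erase e) v (act ω0 (ltr a0))) :
    Conn (E.erase e) v := by
  intro f hf
  obtain ⟨g, hg, hg'⟩ := hE f (Finset.mem_of_mem_erase hf)
  rw [← hg']
  exact hg.reach_of_endpoints (fun ω a h => endpoint_cases (h.trans he.symm) hr0 hr1) (Reach.refl v)

theorem W0_erase [DecidableEq (Ω × X)] {e : Ω × X} {u : Ω} (hu : u ∈ W0 C n E)
    (h : ∀ i, edge (act u (C.h i)) (C.l i) ≠ e) : u ∈ W0 C n (E.erase e) :=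
  ⟨hu.1, fun i => Finset.mem_erase.mpr ⟨h i, hu.2 i⟩⟩

theorem split_zero [DecidableEq (Ω × X)] {e : Ω × X} (hE : Conn E v) {ω0 : Ω} {a0 : X × Bool}
    (he : edge ω0 a0 = e) (heE : e ∈ E)
    (hr0 : Reach (E.erase e) v ω0) (hr1 : Reach (E.erase e) v (act ω0 (ltr a0)))
    (h0 : ∀ u ∈ W0 C n E, ∀ i, edge (act u (C.h i)) (C.l i) ≠ e) :
    ∃ j : Multiplicative (ZMod 0) →* Q C n E v,
      SplitAs (Qmap (C := C) (n := n) (E.erase_subset e) (Trav.one v) (act_one v)) j := by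
  obtain ⟨τ, hτv, hτ⟩ := exists_tau (E.erase e) v
  exact split_ns (conn_erase hE he hr0 hr1) hτv hτ he hr0 hr1 heE 0 1 1 (one_mem _) (one_mem _) _ rfl
    (by simp [one_mem]) (fun u hu _ => Or.inl (W0_erase hu (h0 u hu)))

theorem trav_segment {u : Ω} {a : ℕ} (b : ℕ)
    (h : ∀ i, a ≤ i → i < a + b → edge (act u (C.h i)) (C.l i) ∈ E) :
    Trav E (act u (C.h a)) ((C.h a)⁻¹ * C.h (a + b)) := by
  induction b with
  | zero => simpa using Trav.one _
  | succ b ih =>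
    have h1 := ih (fun i hi hi' => h i hi (by omega))
    rw [← add_assoc, C.h_succ, ← mul_assoc]
    refine h1.mul (Trav.single ?_)
    rw [act_mul, act_act_inv]
    exact h _ (by omega) (by omega)

theorem split_once [DecidableEq (Ω × X)] {e : Ω × X} (hn : 0 < n) (hE : Conn E v) (heE : e ∈ E)
    {u1 : Ω} {i1 : ℕ} (hu1 : u1 ∈ W0 C n E) (hi1 : i1 < C.L) (he : edge (act u1 (C.h i1)) (C.l i1) = e)
    (huniq : ∀ u ∈ W0 C n E, ∀ i < C.L, edge (act u (C.h i)) (C.l i) = e → u = u1 ∧ i = i1) :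
    Conn (E.erase e) v ∧ ∃ m, m ∣ n ∧ ∃ j : Multiplicative (ZMod m) →* Q C n E v,
      SplitAs (Qmap (C := C) (n := n) (E.erase_subset e) (Trav.one v) (act_one v)) j := by
  have hsub := E.erase_subset e
  -- period
  let F : Ω → Ω := fun u => act u C.R
  have hFk : ∀ k u, F^[k] u = act u (C.R ^ k) := by
    intro k
    induction k with
    | zero => intro u; simp [act_one]
    | succ k ih => intro u; rw [Function.iterate_succ_apply, ih, ← act_mul, ← pow_succ']
  have hper : Function.IsPeriodicPt F n u1 := by
    rw [Function.IsPeriodicPt, Function.IsFixedPt, hFk]; exact hu1.1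
  set d := Function.minimalPeriod F u1 with hd
  have hdn : d ∣ n := hper.minimalPeriod_dvd
  have hd0 : 0 < d := hper.minimalPeriod_pos hn
  have hdp : act u1 (C.R ^ d) = u1 := by
    rw [← hFk]; exact Function.isPeriodicPt_minimalPeriod F u1
  -- general crossing description
  have hcross : ∀ u ∈ W0 C n E, ∀ i, edge (act u (C.h i)) (C.l i) = e →
      act u (C.R ^ (i / C.L)) = u1 ∧ i % C.L = i1 := by
    intro u hu i hi
    apply huniq _ (W0_R_pow hu _) _ (Nat.mod_lt _ C.hL)
    rw [← act_mul, ← C.h_mod, C.l_mod, hi]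
  have hseg : ∀ i, i < d * C.L → i ≠ i1 → edge (act u1 (C.h i)) (C.l i) ∈ E.erase e := by
    intro i hi hne
    refine Finset.mem_erase.mpr ⟨fun h => ?_, hu1.2 i⟩
    obtain ⟨h1, h2⟩ := hcross u1 hu1 i h
    have h3 : i / C.L < d := Nat.div_lt_of_lt_mul (by rwa [mul_comm])
    have h4 : i / C.L = 0 := by
      have : Function.IsPeriodicPt F (i / C.L) u1 := by
        rw [Function.IsPeriodicPt, Function.IsFixedPt, hFk]; exact h1
      exact Nat.eq_zero_of_dvd_of_lt this.minimalPeriod_dvd h3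
    apply hne
    rw [← h2, Nat.mod_eq_of_lt]
    rw [Nat.div_eq_zero_iff] at h4
    have := C.hL
    omega
  have hdL : C.L ≤ d * C.L := Nat.le_mul_of_pos_left _ hd0
  have t1 : Trav (E.erase e) u1 (C.h i1) := by
    have := trav_segment (C := C) (E := E.erase e) (u := u1) (a := 0) i1
      (fun i _ hi => hseg i (by omega) (by omega))
    simpa [C.h_zero, act_one] using this
  have t2 : Trav (E.erase e) (act u1 (C.h (i1 + 1))) ((C.h (i1 + 1))⁻¹ * C.R ^ d) := by
    have := trav_segment (C := C) (E := E.erase e) (u := u1) (a := i1 + 1) (d * C.L - (i1 + 1))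
      (fun i hi hi' => hseg i (by omega) (by omega))
    rwa [Nat.add_sub_cancel' (by omega), C.h_mul_L] at this
  have a2 : act (act u1 (C.h (i1 + 1))) ((C.h (i1 + 1))⁻¹ * C.R ^ d) = u1 := by
    rw [act_mul, act_act_inv, hdp]
  have etgt : act (act u1 (C.h i1)) (ltr (C.l i1)) = act u1 (C.h (i1 + 1)) := by
    rw [C.h_succ, act_mul]
  have r1 : Reach (E.erase e) u1 (act u1 (C.h i1)) := ⟨_, t1, rfl⟩
  have r2 : Reach (E.erase e) (act u1 (C.h (i1 + 1))) u1 := ⟨_, t2, a2⟩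
  have rv : Reach (E.erase e) v u1 := by
    obtain ⟨ω, a, hω, hr⟩ := hE.hit heE
    have : Reach (E.erase e) u1 ω := by
      refine endpoint_cases (P := fun ω => Reach (E.erase e) u1 ω) (hω.trans he.symm) r1 ?_
      rw [etgt]; exact r2.symm
    exact hr.trans this.symm
  have hr0 := rv.trans r1
  have hr1 : Reach (E.erase e) v (act (act u1 (C.h i1)) (ltr (C.l i1))) := by
    rw [etgt]; exact rv.trans r2.symm
  have hE1 := conn_erase hE he hr0 hr1
  refine ⟨hE1, n / d, Nat.div_dvd_of_dvd hdn, ?_⟩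
  obtain ⟨τ, hτv, hτ⟩ := exists_tau (E.erase e) v
  have m1 := tau_edge_mem hτ t1 rv
  have m2 := tau_edge_mem hτ t2 (rv.trans r2.symm)
  rw [a2] at m2
  have hSpow : (τ u1 * C.R ^ d * (τ u1)⁻¹) ^ (n / d) = τ u1 * C.R ^ n * (τ u1)⁻¹ := by
    rw [conj_pow, ← pow_mul, Nat.mul_div_cancel' hdn]
  refine split_ns hE1 hτv hτ he hr0 hr1 heE (n / d) _ _ m1 m2 (τ u1 * C.R ^ d * (τ u1)⁻¹) ?_ ?_ ?_
  · rw [etgt]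
    simp only [C.h_succ]
    group
  · rw [hSpow]
    have := hτ _ rv
    exact Nn_gen (this.1.mono hsub) (by rw [this.2]; exact hu1)
  · intro u hu _
    by_cases hc : ∃ i, edge (act u (C.h i)) (C.l i) = e
    · right
      obtain ⟨i, hi⟩ := hc
      obtain ⟨h1, h2⟩ := hcross u hu i hi
      have := hτ _ rv
      refine ⟨τ u1 * (C.R ^ (i / C.L))⁻¹, (this.1.mono hsub).mul ?_, ?_, ?_⟩
      · rw [this.2, ← h1]; exact (trav_R_pow hu _).inv
      · rw [act_mul, this.2, ← h1, act_act_inv]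
      · rw [hSpow]; group
    · left
      push Not at hc
      exact W0_erase hu hc
end
end Pride

namespace Pride
variable {X Ω : Type} [MulAction (FreeGroup X) Ω]
section
variable {C : CW X} {n : ℕ} {E E1 E2 E' : Finset (Ω × X)} {v b : Ω}

theorem reach_edge_iff {P : Ω → Prop} (hP : ∀ ω a, edge ω a ∈ E → P ω → P (act ω (ltr a)))
    {ω : Ω} {a : X × Bool} (h : edge ω a ∈ E) : P ω ↔ P (edge ω a).1 := by
  obtain ⟨x, c⟩ := a
  cases c
  · constructor
    · intro h1; exact hP _ _ h h1
    · intro h1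
      have := hP (act ω (FreeGroup.of x)⁻¹) (x, true) h h1
      rwa [ltr_true, act_inv_act] at this
  · rfl

theorem Trav.restrict {P : Ω → Prop} (hP : ∀ ω a, edge ω a ∈ E → P ω → P (act ω (ltr a)))
    (hE' : ∀ e ∈ E, P e.1 → e ∈ E') {ω : Ω} {g : FreeGroup X} (h : Trav E ω g) (hω : P ω) :
    Trav E' ω g := by
  induction h with
  | one ω => exact Trav.one _
  | cons ω a g he t ih =>
    refine Trav.cons _ _ _ (hE' _ he ((reach_edge_iff hP he).mp hω)) (ih (hP _ _ he hω))

theorem tau_val {P : Type} [Group P] {τ : Ω → FreeGroup X} (hτv : τ v = 1)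
    (hτ : ∀ ω, Reach E v ω → Trav E v (τ ω) ∧ act v (τ ω) = ω) (α : pi1 E v →* P) (f : Ω × X → P)
    (hf : ∀ ω x, (ω, x) ∈ E → ∀ k : pi1 E v, (k : FreeGroup X) =
      τ ω * FreeGroup.of x * (τ (act ω (FreeGroup.of x)))⁻¹ → f (ω, x) = α k) (hE : Conn E v) :
    (∀ ω, Reach E v ω → hol f v (τ ω) = 1) ∧ ∀ k : pi1 E v, hol f v k = α k := by
  constructor
  · intro ω hr
    have h1 := hτ ω hr
    have := hol_tau hτ α f hf hE h1.1 (Reach.refl v) 1 (by rw [h1.2, hτv]; simp)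
    rw [this, map_one]
  · intro k
    exact hol_tau hτ α f hf hE k.2.2 (Reach.refl v) k (by rw [k.2.1, hτv]; simp)

/-- splitting along a separating edge, abstract form -/
theorem split_sep_aux [DecidableEq (Ω × X)] {e : Ω × X} (hE1 : Conn E1 v) (hE2 : Conn E2 b)
    {ω0 : Ω} {a0 : X × Bool} (he : edge ω0 a0 = e) (heE : e ∈ E) (h1 : E1 ⊆ E) (h2 : E2 ⊆ E)
    (hun : ∀ f ∈ E, f = e ∨ f ∈ E1 ∨ f ∈ E2) (hdis : ∀ f ∈ E2, f ∉ E1) (he1 : e ∉ E1) (he2 : e ∉ E2)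
    (hr0 : Reach E1 v ω0) (hb : b = act ω0 (ltr a0)) (hsep : ∀ ω, Reach E1 v ω → ¬ Reach E2 b ω)
    (hW : ∀ u ∈ W0 C n E, u ∈ W0 C n E1 ∨ u ∈ W0 C n E2) :
    ∃ (g : FreeGroup X) (hg : Trav E v g) (hgb : act v g = b),
      SplitAs (Qmap (C := C) (n := n) h1 (Trav.one v) (act_one v)) (Qmap (C := C) (n := n) h2 hg hgb) := by
  classical
  obtain ⟨τ, hτv, hτ⟩ := exists_tau E1 v
  obtain ⟨σ, hσv, hσ⟩ := exists_tau E2 b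
  have h0 := hτ _ hr0
  have hg : Trav E v (τ ω0 * ltr a0) := (h0.1.mono h1).mul (Trav.single (by rw [h0.2, he]; exact heE))
  have hgb : act v (τ ω0 * ltr a0) = b := by rw [act_mul, h0.2, hb]
  refine ⟨_, hg, hgb, ?_⟩
  let Pp := Monoid.Coprod (Q C n E1 v) (Q C n E2 b)
  let α : pi1 E1 v →* Pp := Monoid.Coprod.inl.comp (QuotientGroup.mk' _)
  let β : pi1 E2 b →* Pp := Monoid.Coprod.inr.comp (QuotientGroup.mk' _)
  let f : Ω × X → Pp := fun p => if p ∈ E1 then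
      (if h : τ p.1 * FreeGroup.of p.2 * (τ (act p.1 (FreeGroup.of p.2)))⁻¹ ∈ pi1 E1 v
        then α ⟨_, h⟩ else 1) else if p ∈ E2 then
      (if h : σ p.1 * FreeGroup.of p.2 * (σ (act p.1 (FreeGroup.of p.2)))⁻¹ ∈ pi1 E2 b
        then β ⟨_, h⟩ else 1) else 1
  obtain ⟨ft, fα⟩ := tau_val hτv hτ α f (by
    intro ω x he k hk
    simp only [f, he, if_true]
    rw [dif_pos (hk ▸ k.2)]
    congr 1
    exact Subtype.ext hk.symm) hE1
  obtain ⟨fs, fβ⟩ := tau_val hσv hσ β f (by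
    intro ω x he k hk
    simp only [f, he, hdis _ he, if_true, if_false]
    rw [dif_pos (hk ▸ k.2)]
    congr 1
    exact Subtype.ext hk.symm) hE2
  have hfe : f e = 1 := by simp only [f, he1, he2, if_false]
  have hfl : hol f ω0 (ltr a0) = 1 := by
    obtain ⟨x, c⟩ := a0
    cases c
    · rw [edge_false] at he
      have h1 := hol_inv f (act ω0 (FreeGroup.of x)⁻¹) (FreeGroup.of x)
      rw [act_inv_act, hol_of, he] at h1
      rw [ltr_false, h1, hfe, inv_one]
    · rw [edge_true] at he
      rw [ltr_true, hol_of, he, hfe]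
  have hfg : hol f v (τ ω0 * ltr a0) = 1 := by
    rw [hol_mul, ft _ hr0, h0.2, hfl, one_mul]
  set g := τ ω0 * ltr a0 with hgdef
  have hconj : ∀ k : pi1 E2 b, hol f v (g * k * g⁻¹) = β k := by
    intro k
    have h3 := hol_inv f v g
    rw [hgb, hfg, inv_one] at h3
    rw [hol_mul, hol_mul, act_mul v g, hgb, k.2.1, h3, hfg, fβ, one_mul, mul_one]
  have hker : Nk C n E v ≤ (holPi f E v).ker := by
    apply Nk_le_ker
    intro u hu hr
    rcases hW u hu with h | h
    · obtain ⟨a, b⟩ := hτ u (hE1.reach_W0 h)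
      refine ⟨τ u, a.mono h1, b, fun k hk => ?_⟩
      have hm : τ u * C.R ^ n * (τ u)⁻¹ ∈ Nn C n E1 v := Nn_gen a (by rwa [b])
      have h4 := fα ⟨_, Nn_le_pi1 hm⟩
      have h5 : holPi f E v k = hol f v (k : FreeGroup X) := rfl
      rw [h5, hk]
      refine h4.trans ?_
      have : QuotientGroup.mk' (Nk C n E1 v) ⟨_, Nn_le_pi1 hm⟩ = 1 :=
        (QuotientGroup.eq_one_iff _).mpr hm
      simp only [α, MonoidHom.comp_apply]
      rw [this, map_one]
    · obtain ⟨a, b⟩ := hσ u (hE2.reach_W0 h)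
      refine ⟨g * σ u, hg.mul (by rw [hgb]; exact a.mono h2), by rw [act_mul, hgb, b], fun k hk => ?_⟩
      have hm : σ u * C.R ^ n * (σ u)⁻¹ ∈ Nn C n E2 _ := Nn_gen a (by rwa [b])
      have h4 := hconj ⟨_, Nn_le_pi1 hm⟩
      have h5 : holPi f E v k = hol f v (k : FreeGroup X) := rfl
      rw [h5, hk]
      have h6 : g * σ u * C.R ^ n * (g * σ u)⁻¹ = g * (σ u * C.R ^ n * (σ u)⁻¹) * g⁻¹ := by group
      rw [h6]
      refine h4.trans ?_
      have : QuotientGroup.mk' (Nk C n E2 _) ⟨_, Nn_le_pi1 hm⟩ = 1 :=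
        (QuotientGroup.eq_one_iff _).mpr hm
      simp only [β, MonoidHom.comp_apply]
      rw [this, map_one]
  refine ⟨⟨QuotientGroup.lift _ (holPi f E v) hker, ?_, ?_⟩, ?_⟩
  · intro a
    obtain ⟨k, rfl⟩ := QuotientGroup.mk_surjective a
    rw [Qmap_mk, QuotientGroup.lift_mk]
    have h5 : holPi f E v (conjPi h1 (Trav.one v) (act_one v) k) = hol f v (k : FreeGroup X) := by
      have : holPi f E v (conjPi h1 (Trav.one v) (act_one v) k) = hol f v (1 * (k : FreeGroup X) * 1⁻¹) := rfl
      rw [this]; simp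
    rw [h5, fα]; rfl
  · intro a
    obtain ⟨k, rfl⟩ := QuotientGroup.mk_surjective a
    rw [Qmap_mk, QuotientGroup.lift_mk]
    exact hconj k
  · set Γ := Subgroup.closure (Set.range (Qmap (C := C) (n := n) h1 (Trav.one v) (act_one v)) ∪
      Set.range (Qmap (C := C) (n := n) h2 hg hgb)) with hΓ
    let Γ' := (Γ.comap (QuotientGroup.mk' (Nk C n E v))).map (pi1 E v).subtype
    have in1 : ∀ y (hy : y ∈ pi1 E1 v), y ∈ Γ' := by
      intro y hy
      refine ⟨conjPi h1 (Trav.one v) (act_one v) ⟨y, hy⟩, ?_, by simp [conjPi]⟩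
      apply Subgroup.subset_closure
      left
      exact ⟨QuotientGroup.mk ⟨y, hy⟩, rfl⟩
    have in2 : ∀ y (hy : y ∈ pi1 E2 b), g * y * g⁻¹ ∈ Γ' := by
      intro y hy
      refine ⟨conjPi h2 hg hgb ⟨y, hy⟩, ?_, by simp [conjPi]⟩
      apply Subgroup.subset_closure
      right
      exact ⟨QuotientGroup.mk ⟨y, hy⟩, rfl⟩
    have hle : pi1 E v ≤ Γ' := by
      intro k hk
      let T : Ω → FreeGroup X := fun ω => if Reach E1 v ω then τ ω else g * σ ω
      have hT1 : ∀ ω, Reach E1 v ω → T ω = τ ω := fun ω h => if_pos h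
      have hT2 : ∀ ω, Reach E2 b ω → T ω = g * σ ω := fun ω h => if_neg (fun h' => hsep _ h' h)
      have := gen_of_gauge' E Γ' T (fun p hp => ?_) hk.2
      · rw [hk.1, hT1 v (Reach.refl v), hτv] at this; simpa using this
      · rcases hun p hp with rfl | hp1 | hp2
        · refine ⟨ω0, a0, he, ?_⟩
          rw [← hb, hT1 _ hr0, hT2 _ (Reach.refl b), hσv]
          simp [hgdef, one_mem]
        · refine ⟨p.1, (p.2, true), rfl, ?_⟩
          have hr := hE1 _ hp1
          rw [hT1 _ hr, hT1 _ (hr.trans (Reach.edge (l := (p.2, true)) hp1))]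
          exact in1 _ (tau_edge_mem hτ (Trav.single hp1) hr)
        · refine ⟨p.1, (p.2, true), rfl, ?_⟩
          have hr := hE2 _ hp2
          rw [hT2 _ hr, hT2 _ (hr.trans (Reach.edge (l := (p.2, true)) hp2))]
          have := in2 _ (tau_edge_mem hσ (Trav.single (a := (p.2, true)) hp2) hr)
          convert this using 1
          group
    rw [eq_top_iff]
    intro q _
    obtain ⟨k, rfl⟩ := QuotientGroup.mk_surjective q
    obtain ⟨k', h1, h2⟩ := hle k.2
    have : k' = k := Subtype.ext h2
    rw [← this]; exact h1

theorem split_sep [DecidableEq (Ω × X)] {e : Ω × X} (hE : Conn E v) {ω0 : Ω} {a0 : X × Bool}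
    (he : edge ω0 a0 = e) (heE : e ∈ E)
    (hr0 : Reach (E.erase e) v ω0) (hr1 : ¬ Reach (E.erase e) v (act ω0 (ltr a0)))
    (h0 : ∀ u ∈ W0 C n E, ∀ i, edge (act u (C.h i)) (C.l i) ≠ e) :
    ∃ (E1 E2 : Finset (Ω × X)) (b g : _) (h1 : E1 ⊆ E) (h2 : E2 ⊆ E) (hg : Trav E v g) (hb : act v g = b),
      e ∉ E1 ∧ e ∉ E2 ∧ Conn E1 v ∧ Conn E2 b ∧ (∀ f ∈ E2, f ∉ E1) ∧
      (∀ f ∈ E, f = e ∨ f ∈ E1 ∨ f ∈ E2) ∧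
      (∀ u ∈ W0 C n E, u ∈ W0 C n E1 ∨ u ∈ W0 C n E2) ∧
      SplitAs (Qmap (C := C) (n := n) h1 (Trav.one v) (act_one v)) (Qmap (C := C) (n := n) h2 hg hb) := by
  classical
  let P : Ω → Prop := fun ω => Reach (E.erase e) v ω
  have hP : ∀ ω a, edge ω a ∈ E.erase e → P ω → P (act ω (ltr a)) := fun ω a h hp =>
    hp.trans (Reach.edge h)
  have hP' : ∀ ω a, edge ω a ∈ E.erase e → ¬ P ω → ¬ P (act ω (ltr a)) := fun ω a h hp hp' =>
    hp (hp'.trans (Reach.edge h).symm)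
  set E1 := (E.erase e).filter (fun f => P f.1) with hE1
  set E2 := (E.erase e).filter (fun f => ¬ P f.1) with hE2
  have t1 : ∀ {ω g}, Trav (E.erase e) ω g → P ω → Trav E1 ω g := fun t h =>
    t.restrict hP (fun f hf hf' => Finset.mem_filter.mpr ⟨hf, hf'⟩) h
  have t2 : ∀ {ω g}, Trav (E.erase e) ω g → ¬ P ω → Trav E2 ω g := fun t h =>
    t.restrict hP' (fun f hf hf' => Finset.mem_filter.mpr ⟨hf, hf'⟩) h
  have s1 : E1 ⊆ E.erase e := Finset.filter_subset _ _
  have s2 : E2 ⊆ E.erase e := Finset.filter_subset _ _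
  have c1 : Conn E1 v := by
    intro f hf
    obtain ⟨g, hg, hg'⟩ := (Finset.mem_filter.mp hf).2
    exact ⟨g, t1 hg (Reach.refl v), hg'⟩
  have hr0' : Reach E1 v ω0 := by
    obtain ⟨g, hg, hg'⟩ := hr0
    exact ⟨g, t1 hg (Reach.refl v), hg'⟩
  have key : ∀ {ω g}, Trav E ω g → (P ω ∨ Reach (E.erase e) (act ω0 (ltr a0)) ω) →
      (P (act ω g) ∨ Reach (E.erase e) (act ω0 (ltr a0)) (act ω g)) := by
    intro ω g t
    induction t with
    | one ω => rw [act_one]; exact id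
    | cons ω a g hE t ih =>
      intro h
      rw [act_mul]
      apply ih
      by_cases hh : edge ω a = e
      · exact endpoint_cases (P := fun ω => P ω ∨ Reach (E.erase e) (act ω0 (ltr a0)) ω)
          (ω := act ω (ltr a)) (a := linv a) (by rw [edge_linv, hh, he]) (Or.inl hr0)
          (Or.inr (Reach.refl _))
      · have h3 := Reach.edge (Finset.mem_erase.mpr ⟨hh, hE⟩)
        rcases h with h | h
        · exact Or.inl (h.trans h3)
        · exact Or.inr (h.trans h3)
  have c2 : Conn E2 (act ω0 (ltr a0)) := by
    intro f hf
    obtain ⟨hf1, hf2⟩ := Finset.mem_filter.mp hf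
    obtain ⟨g, hg, hg'⟩ := hE f (Finset.mem_of_mem_erase hf1)
    have := key hg (Or.inl (Reach.refl v))
    rw [hg'] at this
    rcases this with h | ⟨g, hg, hg'⟩
    · exact absurd h hf2
    · exact ⟨g, t2 hg hr1, hg'⟩
  have hdis : ∀ f ∈ E2, f ∉ E1 := fun f hf hf' =>
    (Finset.mem_filter.mp hf).2 (Finset.mem_filter.mp hf').2
  have hun : ∀ f ∈ E, f = e ∨ f ∈ E1 ∨ f ∈ E2 := by
    intro f hf
    by_cases h1 : f = e
    · exact Or.inl h1
    · have := Finset.mem_erase.mpr ⟨h1, hf⟩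
      by_cases h2 : P f.1
      · exact Or.inr (Or.inl (Finset.mem_filter.mpr ⟨this, h2⟩))
      · exact Or.inr (Or.inr (Finset.mem_filter.mpr ⟨this, h2⟩))
  have hW : ∀ u ∈ W0 C n E, u ∈ W0 C n E1 ∨ u ∈ W0 C n E2 := by
    intro u hu
    have hu' := W0_erase hu (h0 u hu)
    have ht : ∀ i, Trav (E.erase e) u (C.h i) := trav_h hu'
    have ex : ∀ i, act u (C.h (i + 1)) = act (act u (C.h i)) (ltr (C.l i)) := fun i => by
      rw [C.h_succ, act_mul]
    by_cases hp : P u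
    · left
      refine ⟨hu.1, fun i => Finset.mem_filter.mpr ⟨hu'.2 i, ?_⟩⟩
      exact (reach_edge_iff hP (hu'.2 i)).mp (hp.trans ⟨_, ht i, rfl⟩)
    · right
      refine ⟨hu.1, fun i => Finset.mem_filter.mpr ⟨hu'.2 i, fun h => hp ?_⟩⟩
      have := (reach_edge_iff hP (hu'.2 i)).mpr h
      exact this.trans (Reach.symm ⟨_, ht i, rfl⟩)
  have he1 : e ∉ E1 := fun h => (Finset.mem_erase.mp (s1 h)).1 rfl
  have he2 : e ∉ E2 := fun h => (Finset.mem_erase.mp (s2 h)).1 rfl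
  have hsub := E.erase_subset e
  obtain ⟨g, hg, hgb, hs⟩ := split_sep_aux (C := C) (n := n) c1 c2 he heE (s1.trans hsub) (s2.trans hsub) hun hdis he1 he2
    hr0' rfl (fun ω h h' => hr1 ((h.mono s1).trans (h'.mono s2).symm)) hW
  exact ⟨E1, E2, _, g, s1.trans hsub, s2.trans hsub, hg, hgb, he1, he2, c1, c2, hdis, hun, hW, hs⟩
end
end Pride

namespace Pride
variable {X Ω : Type} [MulAction (FreeGroup X) Ω]
section
variable {C : CW X} {n : ℕ} {E E1 E2 E' : Finset (Ω × X)} {v b : Ω}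

theorem mem_verts_of_edge {ω : Ω} {a : X × Bool} (h : edge ω a ∈ E) :
    ω ∈ verts E ∧ act ω (ltr a) ∈ verts E :=
  ⟨mem_verts.mpr ⟨a, h⟩, mem_verts.mpr ⟨linv a, by rwa [edge_linv]⟩⟩

theorem Conn.base_mem (hE : Conn E v) (hne : E.Nonempty) : v ∈ verts E := by
  obtain ⟨e, he⟩ := hne
  obtain ⟨g, hg, hg'⟩ := hE e he
  cases hg with
  | one => rw [act_one] at hg'; rw [hg']; exact mem_verts.mpr ⟨(e.2, true), he⟩
  | cons _ _ _ h t => exact mem_verts.mpr ⟨_, h⟩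

theorem pi1_fg (hE : Conn E v) : Group.FG (pi1 E v) := by
  classical
  obtain ⟨τ, hτv, hτ⟩ := exists_tau E v
  have hmem : ∀ e : E, τ e.1.1 * FreeGroup.of e.1.2 * (τ (act e.1.1 (FreeGroup.of e.1.2)))⁻¹ ∈ pi1 E v :=
    fun e => tau_edge_mem hτ (Trav.single (a := (e.1.2, true)) e.2) (hE _ e.2)
  refine Group.fg_iff.mpr ⟨Set.range (fun e : E => (⟨_, hmem e⟩ : pi1 E v)), ?_, Set.finite_range _⟩
  rw [eq_top_iff]
  intro k _
  set Γ := Subgroup.closure (Set.range (fun e : E => (⟨_, hmem e⟩ : pi1 E v))) with hΓ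
  have := gen_of_gauge E (Γ.map (pi1 E v).subtype) τ (fun ω x he => ?_) k.2.2
  · rw [k.2.1, hτv] at this
    simp only [one_mul, inv_one, mul_one] at this
    obtain ⟨k', h1, h2⟩ := this
    have : k' = k := Subtype.ext h2
    rwa [← this]
  · exact ⟨⟨_, hmem ⟨(ω, x), he⟩⟩, Subgroup.subset_closure ⟨⟨(ω, x), he⟩, rfl⟩, rfl⟩

theorem finite_hom_of_fg {G P : Type} [Group G] [Group P] [Finite P] (h : Group.FG G) :
    Finite (G →* P) := by
  obtain ⟨S, hS, hfin⟩ := Group.fg_iff.mp h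
  have := hfin.to_subtype
  apply Finite.of_injective (fun (f : G →* P) (s : S) => f s)
  intro f g hfg
  apply MonoidHom.eq_of_eqOn_dense hS
  intro s hs
  exact congrFun hfg ⟨s, hs⟩

theorem finite_basis {G ι : Type} [Group G] (b : FreeGroupBasis ι G) (h : Group.FG G) : Finite ι := by
  have h1 : Finite (G →* Multiplicative (ZMod 2)) := finite_hom_of_fg h
  have h2 : Finite (ι → Multiplicative (ZMod 2)) := Finite.of_equiv _ b.lift.symm
  classical
  apply Finite.of_injective (fun (i : ι) (j : ι) =>
    if i = j then (Multiplicative.ofAdd (1 : ZMod 2)) else 1)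
  intro i j hij
  have := congrFun hij i
  by_contra hne
  simp only [if_true, if_neg (Ne.symm hne)] at this
  exact absurd this (by decide)

theorem hom_count (hE : Conn E v) (hne : E.Nonempty) :
    ∃ (ι : Type) (_ : FreeGroupBasis ι (pi1 E v)), Finite ι ∧
      E.card + 1 ≤ Nat.card ι + (verts E).card := by
  classical
  have b := IsFreeGroup.basis (pi1 E v)
  have hfin := finite_basis b (pi1_fg hE)
  refine ⟨_, b, hfin, ?_⟩
  set ι := IsFreeGroup.Generators (pi1 E v)
  let A := Multiplicative (ZMod 2)
  obtain ⟨τ, hτv, hτ⟩ := exists_tau E v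
  let ex : (E → A) → (Ω × X → A) := fun f e => if h : e ∈ E then f ⟨e, h⟩ else 1
  let V' := (verts E).erase v
  let Φ : (E → A) → (ι → A) × (V' → A) := fun f =>
    (b.lift.symm (holPi (ex f) E v), fun w => hol (ex f) v (τ w))
  have hinj : Function.Injective Φ := by
    intro f g hfg
    have h1 : holPi (ex f) E v = holPi (ex g) E v := b.lift.symm.injective (Prod.ext_iff.mp hfg).1
    have h2 : ∀ w ∈ verts E, hol (ex f) v (τ w) = hol (ex g) v (τ w) := by
      intro w hw
      by_cases hwv : w = v
      · rw [hwv, hτv, hol_one, hol_one]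
      · exact congrFun (Prod.ext_iff.mp hfg).2 ⟨w, Finset.mem_erase.mpr ⟨hwv, hw⟩⟩
    funext ⟨⟨ω, x⟩, he⟩
    have hr : Reach E v ω := hE _ he
    have hT : Trav E ω (FreeGroup.of x) := Trav.single (a := (x, true)) he
    have hr' : Reach E v (act ω (FreeGroup.of x)) := hr.trans ⟨_, hT, rfl⟩
    have hm := tau_edge_mem hτ hT hr
    have hv := mem_verts_of_edge (a := (x, true)) (E := E) (ω := ω) he
    have formula : ∀ f : E → A, holPi (ex f) E v ⟨_, hm⟩ =
        hol (ex f) v (τ ω) * f ⟨(ω, x), he⟩ * (hol (ex f) v (τ (act ω (FreeGroup.of x))))⁻¹ := by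
      intro f
      have h0 : holPi (ex f) E v ⟨_, hm⟩ = hol (ex f) v (τ ω * FreeGroup.of x * (τ (act ω (FreeGroup.of x)))⁻¹) := rfl
      rw [h0, hol_mul, hol_mul, act_mul, (hτ _ hr).2, hol_of]
      have h3 := hol_inv (ex f) v (τ (act ω (FreeGroup.of x)))
      rw [(hτ _ hr').2] at h3
      rw [h3]
      simp only [ex, he, dite_true]
    have e1 := formula f
    rw [ltr_true] at hv
    rw [h1, formula g, h2 _ hv.1, h2 _ hv.2] at e1
    simpa using e1.symm
  have := Nat.card_le_card_of_injective Φ hinj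
  have hA : Nat.card A = 2 := by simp [A]
  have hV : Nat.card V' + 1 = (verts E).card := by
    rw [Nat.card_eq_fintype_card, Fintype.card_coe]
    exact Finset.card_erase_add_one (hE.base_mem hne)
  rw [Nat.card_prod, Nat.card_fun, Nat.card_fun, Nat.card_fun, hA, ← pow_add] at this
  have h3 := (Nat.pow_le_pow_iff_right (by norm_num : 1 < 2)).mp this
  have h4 : Nat.card E = E.card := by simp
  omega
end
end Pride

namespace Pride

theorem twist_surj {K Z ι κ : Type} [Group K] [CommGroup Z] [Finite Z] [Finite ι] [Finite κ]
    (b : FreeGroupBasis ι K) (T : κ → K) (x y : K) (hk : Nat.card κ + 2 ≤ Nat.card ι)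
    (hinj : ∀ χ : K →* Z, (∀ i, χ (T i) = 1) → χ x = 1 → χ y = 1 → χ = 1)
    (c : κ → Z) (z w : Z) : ∃ χ : K →* Z, (∀ i, χ (T i) = c i) ∧ χ x = z ∧ χ y = w := by
  classical
  have hf : Finite (K →* Z) := Finite.of_equiv _ b.lift
  let Φ : (K →* Z) →* (κ → Z) × Z × Z :=
    { toFun := fun χ => (fun i => χ (T i), χ x, χ y)
      map_one' := rfl
      map_mul' := fun _ _ => rfl }
  have hΦ : Function.Injective Φ := by
    rw [injective_iff_map_eq_one]
    intro χ h
    have h1 := Prod.ext_iff.mp h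
    have h2 := Prod.ext_iff.mp h1.2
    exact hinj χ (fun i => congrFun h1.1 i) h2.1 h2.2
  have hcard : Nat.card ((κ → Z) × Z × Z) ≤ Nat.card (K →* Z) := by
    rw [← Nat.card_congr b.lift, Nat.card_fun, Nat.card_prod, Nat.card_prod, Nat.card_fun]
    calc Nat.card Z ^ Nat.card κ * (Nat.card Z * Nat.card Z) = Nat.card Z ^ (Nat.card κ + 2) := by ring
      _ ≤ _ := Nat.pow_le_pow_right Nat.card_pos hk
  have hbij : Function.Bijective Φ := hΦ.bijective_of_nat_card_le hcard
  obtain ⟨χ, hχ⟩ := hbij.2 (c, z, w)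
  have h1 := Prod.ext_iff.mp hχ
  have h2 := Prod.ext_iff.mp h1.2
  exact ⟨χ, fun i => congrFun h1.1 i, h2.1, h2.2⟩

theorem hom_to_nilp {K ι κ : Type} [Group K] [Finite ι] [Finite κ]
    (b : FreeGroupBasis ι K) (T : κ → K) (x y : K) (hk : Nat.card κ + 2 ≤ Nat.card ι)
    (hinj : ∀ (Z : Type) [CommGroup Z] (χ : K →* Z), (∀ i, χ (T i) = 1) → χ x = 1 → χ y = 1 → χ = 1)
    (P : Type) [Group P] [Group.IsNilpotent P] : Finite P → ∀ p q : P,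
      ∃ θ : K →* P, (∀ i, θ (T i) = 1) ∧ θ x = p ∧ θ y = q := by
  refine Group.nilpotent_center_quotient_ind (P := fun P _ _ => Finite P → ∀ p q : P,
      ∃ θ : K →* P, (∀ i, θ (T i) = 1) ∧ θ x = p ∧ θ y = q) P ?_ ?_
  · intro P _ _ _ p q
    exact ⟨1, fun _ => rfl, Subsingleton.elim _ _, Subsingleton.elim _ _⟩
  · intro P _ _ ih
    intro hfin p q
    obtain ⟨θ', h1, h2, h3⟩ := ih inferInstance p q
    obtain ⟨θ, hθ⟩ : ∃ θ : K →* P, (QuotientGroup.mk' (Subgroup.center P)).comp θ = θ' := by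
      refine ⟨b.lift (fun i => (θ' (b i)).out), b.ext_hom _ _ fun i => ?_⟩
      simp
    have hθ' : ∀ k, (QuotientGroup.mk (θ k) : P ⧸ Subgroup.center P) = θ' k :=
      fun k => DFunLike.congr_fun hθ k
    have m1 : ∀ i, (θ (T i))⁻¹ ∈ Subgroup.center P := fun i =>
      inv_mem ((QuotientGroup.eq_one_iff _).mp ((hθ' _).trans (h1 i)))
    have m2 : (θ x)⁻¹ * p ∈ Subgroup.center P := QuotientGroup.eq.mp ((hθ' _).trans h2)
    have m3 : (θ y)⁻¹ * q ∈ Subgroup.center P := QuotientGroup.eq.mp ((hθ' _).trans h3)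
    let _ : CommGroup (Subgroup.center P) := { (inferInstance : Group (Subgroup.center P)) with
      mul_comm := fun a c => Subtype.ext (Subgroup.mem_center_iff.mp c.2 a) }
    obtain ⟨χ, c1, c2, c3⟩ := twist_surj (Z := Subgroup.center P) b T x y hk (hinj _)
      (fun i => ⟨_, m1 i⟩) ⟨_, m2⟩ ⟨_, m3⟩
    refine ⟨{ toFun := fun k => θ k * χ k
              map_one' := by simp
              map_mul' := fun k l => ?_ }, fun i => ?_, ?_, ?_⟩
    · have := Subgroup.mem_center_iff.mp (χ k).2 (θ l)
      simp only [map_mul, Subgroup.coe_mul]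
      rw [mul_assoc, ← mul_assoc (θ l), this]
      simp only [mul_assoc]
    · show θ (T i) * χ (T i) = 1
      rw [c1]; simp
    · show θ x * χ x = _
      rw [c2]; simp
    · show θ y * χ y = _
      rw [c3]; simp

/-- the free group of rank two -/
abbrev F2 : Type := Monoid.CoprodI (fun _ : Bool => Multiplicative (ZMod 0))

open Matrix in
/-- the Sanov matrices -/
def sanov (i : Bool) : Multiplicative (ZMod 0) →* SpecialLinearGroup (Fin 2) ℤ where
  toFun k := if i then ⟨!![1, 2 * (Multiplicative.toAdd k : ℤ); 0, 1], by simp [det_fin_two]⟩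
    else ⟨!![1, 0; 2 * (Multiplicative.toAdd k : ℤ), 1], by simp [det_fin_two]⟩
  map_one' := by
    cases i <;> ext a c <;> fin_cases a <;> fin_cases c <;> simp <;> rfl
  map_mul' k l := by
    have h : (Multiplicative.toAdd (k * l) : ℤ) = (Multiplicative.toAdd k : ℤ) + (Multiplicative.toAdd l : ℤ) := rfl
    cases i
    · apply Subtype.ext
      show !![1, 0; 2 * (Multiplicative.toAdd (k * l) : ℤ), 1] =
        !![1, 0; 2 * (Multiplicative.toAdd k : ℤ), 1] * !![1, 0; 2 * (Multiplicative.toAdd l : ℤ), 1]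
      rw [Matrix.mul_fin_two, h]; simp [mul_add]
    · apply Subtype.ext
      show !![1, 2 * (Multiplicative.toAdd (k * l) : ℤ); 0, 1] =
        !![1, 2 * (Multiplicative.toAdd k : ℤ); 0, 1] * !![1, 2 * (Multiplicative.toAdd l : ℤ); 0, 1]
      rw [Matrix.mul_fin_two, h]; simp [mul_add, add_comm]

theorem sanov_true (k : Multiplicative (ZMod 0)) :
    (sanov true k).1 = !![1, 2 * (Multiplicative.toAdd k : ℤ); 0, 1] := rfl
theorem sanov_false (k : Multiplicative (ZMod 0)) :
    (sanov false k).1 = !![1, 0; 2 * (Multiplicative.toAdd k : ℤ), 1] := rfl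

theorem sanov_inj : Function.Injective (Monoid.CoprodI.lift sanov) := by
  classical
  let _ : MulAction (Matrix.SpecialLinearGroup (Fin 2) ℤ) (Fin 2 → ℤ) :=
    { smul := fun g v => g.1.mulVec v
      one_smul := fun v => Matrix.one_mulVec v
      mul_smul := fun g h v => (Matrix.mulVec_mulVec v g.1 h.1).symm }
  have hs : ∀ (g : Matrix.SpecialLinearGroup (Fin 2) ℤ) (v : Fin 2 → ℤ), g • v = g.1.mulVec v := fun _ _ => rfl
  apply Monoid.CoprodI.lift_injective_of_ping_pong sanov
    (X := fun i => if i then {v : Fin 2 → ℤ | |v 1| < |v 0|} else {v : Fin 2 → ℤ | |v 0| < |v 1|})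
  · right
    refine ⟨true, ?_⟩
    have : Infinite (Multiplicative (ZMod 0)) := inferInstanceAs (Infinite ℤ)
    exact (Cardinal.natCast_lt_aleph0 (n := 3)).le.trans (Cardinal.aleph0_le_mk _)
  · rintro (_ | _)
    · exact ⟨![0, 1], by simp⟩
    · exact ⟨![1, 0], by simp⟩
  · rintro (_ | _) (_ | _) hij
    · exact absurd rfl hij
    · simp only [Function.onFun]
      rw [Set.disjoint_left]
      intro v hv hv'
      simp at hv hv'
      omega
    · simp only [Function.onFun]
      rw [Set.disjoint_left]
      intro v hv hv'
      simp at hv hv'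
      omega
    · exact absurd rfl hij
  · have key : ∀ k a c : ℤ, k ≠ 0 → |a| < |c| → |c| < |a + 2 * k * c| := by
      intro k a c hk h
      have h1 : 1 ≤ |k| := Int.one_le_abs hk
      have h2 : |2 * k * c| = 2 * |k| * |c| := by rw [abs_mul, abs_mul]; rfl
      have h3 : |2 * k * c| ≤ |a + 2 * k * c| + |a| := by
        calc |2 * k * c| = |(a + 2 * k * c) - a| := by ring_nf
          _ ≤ _ := abs_sub _ _
      nlinarith [abs_nonneg c, abs_nonneg a]
    rintro (_ | _) (_ | _) hij h hh
    · exact absurd rfl hij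
    · rintro _ ⟨v, hv, rfl⟩
      have := key (Multiplicative.toAdd h : ℤ) (v 1) (v 0) hh (by simpa using hv)
      simp only [hs, sanov_false]
      simp [dotProduct, Fin.sum_univ_two]
      rwa [add_comm] at this
    · rintro _ ⟨v, hv, rfl⟩
      have := key (Multiplicative.toAdd h : ℤ) (v 0) (v 1) hh (by simpa using hv)
      simp only [hs, sanov_true]
      simp [dotProduct, Fin.sum_univ_two]
      exact this
    · exact absurd rfl hij

theorem sanov_mod (w : F2) : ∃ A : Matrix (Fin 2) (Fin 2) ℤ,
    (Monoid.CoprodI.lift sanov w).1 = 1 + (2 : ℤ) • A := by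
  induction w using Monoid.CoprodI.induction_on with
  | one => exact ⟨0, by simp⟩
  | of i m =>
    rw [Monoid.CoprodI.lift_of]
    cases i
    · refine ⟨!![0, 0; (Multiplicative.toAdd m : ℤ), 0], ?_⟩
      rw [sanov_false]
      ext a c; fin_cases a <;> fin_cases c <;> simp
    · refine ⟨!![0, (Multiplicative.toAdd m : ℤ); 0, 0], ?_⟩
      rw [sanov_true]
      ext a c; fin_cases a <;> fin_cases c <;> simp
  | mul x y hx hy =>
    obtain ⟨A, hA⟩ := hx
    obtain ⟨B, hB⟩ := hy
    refine ⟨A + B + (2 : ℤ) • (A * B), ?_⟩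
    rw [map_mul, Matrix.SpecialLinearGroup.coe_mul, hA, hB]
    simp only [add_mul, mul_add, one_mul, mul_one, Matrix.smul_mul, Matrix.mul_smul, smul_add, smul_smul]
    abel

theorem pow_mod {g A : Matrix (Fin 2) (Fin 2) ℤ} (h : g = 1 + (2 : ℤ) • A) (k : ℕ) :
    ∃ B : Matrix (Fin 2) (Fin 2) ℤ, g ^ (2 ^ k) = 1 + (2 ^ (k + 1) : ℤ) • B := by
  induction k with
  | zero => exact ⟨A, by simpa using h⟩
  | succ k ih =>
    obtain ⟨B, hB⟩ := ih
    refine ⟨B + (2 ^ k : ℤ) • (B * B), ?_⟩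
    rw [pow_succ 2 k, pow_mul, hB, sq]
    simp only [add_mul, mul_add, one_mul, mul_one, Matrix.smul_mul, Matrix.mul_smul, smul_add, smul_smul]
    have : (2 : ℤ) ^ (k + 1 + 1) * 2 ^ k = 2 ^ (k + 1) * 2 ^ (k + 1) := by ring
    rw [this, pow_succ (2 : ℤ) (k + 1), mul_two, add_smul]
    abel

theorem resid_nilp (w : F2) (hw : w ≠ 1) : ∃ (P : Type) (_ : Group P) (_ : Finite P)
    (_ : Group.IsNilpotent P) (f : F2 →* P), f w ≠ 1 := by
  classical
  have h1 : Monoid.CoprodI.lift sanov w ≠ 1 := fun h => hw (sanov_inj (by rw [h, map_one]))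
  obtain ⟨i, j, hij⟩ : ∃ i j, (Monoid.CoprodI.lift sanov w).1 i j - (1 : Matrix (Fin 2) (Fin 2) ℤ) i j ≠ 0 := by
    by_contra hcon
    push Not at hcon
    apply h1
    ext i j
    exact sub_eq_zero.mp (hcon i j)
  set d := (Monoid.CoprodI.lift sanov w).1 i j - (1 : Matrix (Fin 2) (Fin 2) ℤ) i j with hd
  let k := d.natAbs
  let φ := (Matrix.SpecialLinearGroup.map (n := Fin 2) (Int.castRingHom (ZMod (2 ^ k)))).comp (Monoid.CoprodI.lift sanov)
  have hfin : Finite φ.range := inferInstance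
  have hp : IsPGroup 2 φ.range := by
    rintro ⟨_, u, rfl⟩
    refine ⟨k, ?_⟩
    obtain ⟨A, hA⟩ := sanov_mod u
    obtain ⟨B, hB⟩ := pow_mod hA k
    apply Subtype.ext
    show φ u ^ 2 ^ k = 1
    rw [← map_pow]
    simp only [φ, MonoidHom.comp_apply, map_pow]
    rw [← map_pow]
    ext a c
    simp only [Matrix.SpecialLinearGroup.map_apply_coe, Matrix.SpecialLinearGroup.coe_pow, hB]
    have h2 : ((2 : ZMod (2 ^ k)) ^ k) = 0 := by
      have := ZMod.natCast_self (2 ^ k)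
      exact_mod_cast this
    have h3 : ((((2 : ℤ) ^ (k + 1)) • B) a c) = 2 ^ (k + 1) * B a c := rfl
    simp only [RingHom.mapMatrix_apply, Matrix.map_apply, Matrix.add_apply, h3, map_add, map_mul, map_pow]
    simp [Matrix.one_apply, pow_succ, h2]
  have : Fact (Nat.Prime 2) := ⟨Nat.prime_two⟩
  refine ⟨φ.range, inferInstance, hfin, hp.isNilpotent, φ.rangeRestrict, ?_⟩
  intro h
  have h3 : φ w = 1 := congrArg Subtype.val h
  have h4 := congrFun (congrFun (congrArg Subtype.val h3) i) j
  have h5 : ((d : ℤ) : ZMod (2 ^ k)) = 0 := by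
    rw [hd]
    push_cast
    rw [sub_eq_zero]
    have : (((1 : Matrix (Fin 2) (Fin 2) ℤ) i j : ℤ) : ZMod (2 ^ k)) = (1 : Matrix (Fin 2) (Fin 2) (ZMod (2 ^ k))) i j := by
      simp [Matrix.one_apply]
    rw [this]
    exact h4
  rw [ZMod.intCast_zmod_eq_zero_iff_dvd] at h5
  have h6 := Int.le_of_dvd (abs_pos.mpr hij) ((dvd_abs _ _).mpr h5)
  have h7 : k < 2 ^ k := Nat.lt_two_pow_self
  have h8 : ((2 ^ k : ℕ) : ℤ) ≤ (d.natAbs : ℤ) := by rw [Int.natCast_natAbs]; exact h6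
  have h9 : 2 ^ k ≤ d.natAbs := by exact_mod_cast h8
  omega

theorem freeQ {K Q ι κ : Type} [Group K] [Group Q] [Finite ι] [Finite κ]
    (b : FreeGroupBasis ι K) (T : κ → K) (x y : K) (hk : Nat.card κ + 2 ≤ Nat.card ι)
    (π : K →* Q) (hπ : Function.Surjective π) (hxy : Subgroup.closure {π x, π y} = ⊤)
    (hker : ∀ (P : Type) [Group P] (θ : K →* P), (∀ i, θ (T i) = 1) → π.ker ≤ θ.ker) :
    Nonempty (Q ≃* F2) := by
  have hinj : ∀ (P : Type) [Group P] (χ : K →* P), (∀ i, χ (T i) = 1) →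
      ∃ χ' : Q →* P, ∀ k, χ' (π k) = χ k := by
    intro P _ χ h
    exact ⟨π.liftOfSurjective hπ ⟨χ, hker P χ h⟩, fun k => π.liftOfRightInverse_comp_apply _ _ _ _⟩
  have hinj' : ∀ (Z : Type) [CommGroup Z] (χ : K →* Z), (∀ i, χ (T i) = 1) → χ x = 1 → χ y = 1 → χ = 1 := by
    intro Z _ χ h hx hy
    obtain ⟨χ', hχ⟩ := hinj Z χ h
    have : χ' = 1 := by
      apply MonoidHom.eq_of_eqOn_dense hxy
      rintro _ (rfl | rfl)
      · rw [hχ, hx]; rfl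
      · rw [hχ, hy]; rfl
    ext k
    rw [← hχ, this]; rfl
  choose j hj using fun i : Bool => exists_zmodHom (G := Q) 0 (if i then π x else π y) (pow_zero _)
  have hα : Function.Bijective (Monoid.CoprodI.lift j) := by
    constructor
    · rw [injective_iff_map_eq_one]
      intro w hw
      by_contra hne
      obtain ⟨P, _, hf, _, f, hfw⟩ := resid_nilp w hne
      obtain ⟨θ, t1, t2, t3⟩ := hom_to_nilp b T x y hk hinj' P hf
        (f (Monoid.CoprodI.of (i := true) (Multiplicative.ofAdd 1)))
        (f (Monoid.CoprodI.of (i := false) (Multiplicative.ofAdd 1)))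
      obtain ⟨θ', hθ⟩ := hinj P θ t1
      have : θ'.comp (Monoid.CoprodI.lift j) = f := by
        apply Monoid.CoprodI.ext_hom
        intro i
        apply zmodHom_ext
        simp only [MonoidHom.comp_apply, Monoid.CoprodI.lift_of, hj]
        cases i
        · simp [hθ, t3]
        · simp [hθ, t2]
      apply hfw
      rw [← this, MonoidHom.comp_apply, hw, map_one]
    · rw [← MonoidHom.range_eq_top, eq_top_iff, ← hxy, Subgroup.closure_le]
      rintro _ (rfl | rfl)
      · exact ⟨Monoid.CoprodI.of (i := true) (Multiplicative.ofAdd 1), by rw [Monoid.CoprodI.lift_of, hj]; rfl⟩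
      · exact ⟨Monoid.CoprodI.of (i := false) (Multiplicative.ofAdd 1), by rw [Monoid.CoprodI.lift_of, hj]; rfl⟩
  exact ⟨(MulEquiv.ofBijective _ hα).symm⟩
end Pride

namespace Pride

theorem F2_not_comm : ¬ ∀ a b : F2, a * b = b * a := by
  intro h
  obtain ⟨f, hf⟩ := exists_zmodHom (G := Equiv.Perm (Fin 3)) 0 (Equiv.swap 0 1) (pow_zero _)
  obtain ⟨g, hg⟩ := exists_zmodHom (G := Equiv.Perm (Fin 3)) 0 (Equiv.swap 1 2) (pow_zero _)
  let φ : F2 →* Equiv.Perm (Fin 3) := Monoid.CoprodI.lift (fun i : Bool => if i then f else g)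
  have := congrArg φ (h (Monoid.CoprodI.of (i := true) (Multiplicative.ofAdd 1))
    (Monoid.CoprodI.of (i := false) (Multiplicative.ofAdd 1)))
  simp only [map_mul, φ, Monoid.CoprodI.lift_of, if_true, hf] at this
  have h2 : (if false = true then f else g) = g := rfl
  rw [h2, hg] at this
  revert this
  decide

theorem comm_of_cyclic {G : Type} [Group G] {z : G} (h : Subgroup.closure {z} = ⊤) (a b : G) :
    a * b = b * a := by
  have ha : a ∈ Subgroup.closure {z} := h ▸ Subgroup.mem_top a
  have hb : b ∈ Subgroup.closure {z} := h ▸ Subgroup.mem_top b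
  rw [Subgroup.mem_closure_singleton] at ha hb
  obtain ⟨k, rfl⟩ := ha
  obtain ⟨l, rfl⟩ := hb
  rw [← zpow_add, ← zpow_add, add_comm]

variable {X Ω : Type} [MulAction (FreeGroup X) Ω]
section
variable {C : CW X} {n : ℕ} {E E1 E2 E' : Finset (Ω × X)} {v b : Ω}

theorem irr_aux (hp : C.Prim) (hn : 1 < n) (hI : Irred C n E) (hE : Conn E v) (hne : E.Nonempty) :
    (∀ x y : Q C n E v, Subgroup.closure {x, y} = ⊤ → Nonempty (Q C n E v ≃* F2)) ∨
    ∃ (ι : Type) (_ : FreeGroupBasis ι (pi1 E v)), Finite ι ∧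
      E.card + 1 ≤ Nat.card ι + (verts E).card ∧ (W0 C n E).ncard + (verts E).card ≤ E.card ∧
      1 ≤ (W0 C n E).ncard ∧
      ∃ p, p.Prime ∧ ∀ χ : pi1 E v →* Multiplicative (ZMod p), Nk C n E v ≤ χ.ker := by
  classical
  obtain ⟨ι, b, hfin, hcnt⟩ := hom_count hE hne
  have hct := count_le hp (by omega : 0 < n) hI
  have hWf : (W0 C n E).Finite := W0_finite
  have hD : 1 ≤ (W0 C n E).ncard := by
    obtain ⟨e, he⟩ := hne
    obtain ⟨u, u', i, i', hu, _⟩ := hI e he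
    exact (Set.ncard_pos hWf).mpr ⟨u, hu⟩
  obtain ⟨τ, hτv, hτ⟩ := exists_tau E v
  by_cases hcase : ∃ u0 ∈ W0 C n E, act u0 C.R ≠ u0
  · left
    intro x y hxy
    obtain ⟨u0, hu0, hne0⟩ := hcase
    let κ : Set Ω := W0 C n E \ {act u0 C.R}
    have hκf : Finite κ := (hWf.subset Set.diff_subset).to_subtype
    have hmem : ∀ u : κ, τ u * C.R ^ n * (τ u)⁻¹ ∈ pi1 E v := fun u =>
      Nn_le_pi1 (n := n) (Nn_gen (hτ _ (hE.reach_W0 u.2.1)).1 (by rw [(hτ _ (hE.reach_W0 u.2.1)).2]; exact u.2.1))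
    obtain ⟨x', rfl⟩ := QuotientGroup.mk_surjective x
    obtain ⟨y', rfl⟩ := QuotientGroup.mk_surjective y
    have hcardκ : Nat.card κ + 1 = (W0 C n E).ncard := by
      have := Set.ncard_diff_singleton_add_one (W0_R hu0) hWf
      exact this
    apply freeQ b (fun u : κ => ⟨_, hmem u⟩) x' y' (by omega) (QuotientGroup.mk' (Nk C n E v))
      (QuotientGroup.mk'_surjective _) hxy
    intro P _ θ hθ
    rw [QuotientGroup.ker_mk']
    apply Nk_le_ker
    intro u hu hr
    by_cases huu : u = act u0 C.R
    · have h0 := hτ _ (hE.reach_W0 hu0)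
      refine ⟨τ u0 * C.R, h0.1.mul ?_, ?_, fun k hk => ?_⟩
      · rw [h0.2]; simpa using trav_R_pow hu0 1
      · rw [act_mul, h0.2, huu]
      · rw [← hθ ⟨u0, hu0, fun h => hne0 (Eq.symm h)⟩]
        congr 1
        apply Subtype.ext
        rw [hk]
        show _ = τ u0 * C.R ^ n * (τ u0)⁻¹
        group
    · refine ⟨τ u, (hτ _ hr).1, (hτ _ hr).2, fun k hk => ?_⟩
      rw [← hθ ⟨u, hu, huu⟩]
      congr 1
      exact Subtype.ext hk
  · right
    push Not at hcase
    obtain ⟨p, hpp, hpn⟩ := Nat.exists_prime_and_dvd (by omega : n ≠ 1)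
    refine ⟨ι, b, hfin, hcnt, hct, hD, p, hpp, fun χ => ?_⟩
    apply Nk_le_ker
    intro u hu hr
    refine ⟨τ u, (hτ _ hr).1, (hτ _ hr).2, fun k hk => ?_⟩
    have hm : τ u * C.R * (τ u)⁻¹ ∈ pi1 E v := by
      apply mul_inv_mem_pi1 _ (hτ _ hr).1
      · rw [act_mul, (hτ _ hr).2, hcase u hu]
      · apply (hτ _ hr).1.mul
        rw [(hτ _ hr).2]
        simpa using trav_R_pow hu 1
    have : k = ⟨_, hm⟩ ^ n := Subtype.ext (by
      rw [hk]; show _ = (τ u * C.R * (τ u)⁻¹) ^ n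
      rw [conj_pow])
    rw [this, map_pow]
    obtain ⟨m, rfl⟩ := hpn
    rw [pow_mul]
    have h0 : ∀ a : Multiplicative (ZMod p), a ^ p = 1 := by
      intro a
      apply Multiplicative.toAdd.injective
      rw [toAdd_pow]; simp
    rw [h0, one_pow]

theorem card_hom_le {ι : Type} [Finite ι] (b : FreeGroupBasis ι (pi1 E v)) {p : ℕ} (hp : p.Prime)
    (hk : ∀ χ : pi1 E v →* Multiplicative (ZMod p), Nk C n E v ≤ χ.ker) {κ : Type} [Finite κ] (s : κ → Q C n E v)
    (hs : Subgroup.closure (Set.range s) = ⊤) : Nat.card ι ≤ Nat.card κ := by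
  have : NeZero p := ⟨hp.ne_zero⟩
  have : Finite (Multiplicative (ZMod p)) := inferInstanceAs (Finite (ZMod p))
  let Φ : (pi1 E v →* Multiplicative (ZMod p)) → (κ → Multiplicative (ZMod p)) :=
    fun χ i => QuotientGroup.lift _ χ (hk χ) (s i)
  have hΦ : Function.Injective Φ := by
    intro χ χ' hχ
    have : QuotientGroup.lift _ χ (hk χ) = QuotientGroup.lift _ χ' (hk χ') := by
      apply MonoidHom.eq_of_eqOn_dense hs
      rintro _ ⟨i, rfl⟩
      exact congrFun hχ i
    ext k
    exact congrArg _ (DFunLike.congr_fun this (QuotientGroup.mk k))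
  have h1 := Nat.card_le_card_of_injective Φ hΦ
  rw [← Nat.card_congr b.lift, Nat.card_fun, Nat.card_fun] at h1
  have h2 : Nat.card (Multiplicative (ZMod p)) = p := by
    rw [← Nat.card_congr Multiplicative.ofAdd]; simp
  rw [h2] at h1
  exact (Nat.pow_le_pow_iff_right hp.one_lt).mp h1

theorem irr_not_cyclic (hp : C.Prim) (hn : 1 < n) (hI : Irred C n E) (hE : Conn E v) (hne : E.Nonempty)
    (z : Q C n E v) : Subgroup.closure {z} ≠ ⊤ := by
  intro hz
  rcases irr_aux hp hn hI hE hne with h | ⟨ι, b, hf, h1, h2, h3, p, hpp, hk⟩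
  · obtain ⟨e⟩ := h z z (by simpa using hz)
    apply F2_not_comm
    intro a b
    apply e.symm.injective
    rw [map_mul, map_mul]
    exact comm_of_cyclic hz _ _
  · have := card_hom_le b hpp hk (fun _ : Unit => z) (by simpa using hz)
    simp at this
    omega

theorem irr_two (hp : C.Prim) (hn : 1 < n) (hI : Irred C n E) (hE : Conn E v) (hne : E.Nonempty)
    (x y : Q C n E v) (hxy : Subgroup.closure {x, y} = ⊤) : Nonempty (Q C n E v ≃* F2) ∨
    ((W0 C n E).ncard = 1 ∧ E.card = (verts E).card + 1) := by
  rcases irr_aux hp hn hI hE hne with h | ⟨ι, b, hf, h1, h2, h3, p, hpp, hk⟩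
  · exact Or.inl (h x y hxy)
  · right
    have := card_hom_le b hpp hk (fun i : Bool => if i then x else y) (by
      rw [← hxy]; congr 1; ext q; simp [eq_comm, or_comm])
    simp at this
    omega
end
end Pride

namespace Pride
open Monoid

section grushko
variable {ι : Type} [DecidableEq ι] {G : ι → Type} [∀ i, Group (G i)]

abbrev Ar (G : ι → Type) := Σ i, ℕ × G i × ℕ

inductive Gi (S : Finset (Ar G)) (i : ι) : ℕ → G i → ℕ → Prop
  | one (m : ℕ) : Gi S i m 1 m
  | fwd (m : ℕ) (g : G i) (m' : ℕ) (h : G i) (m'' : ℕ) :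
      (⟨i, (m, g, m')⟩ : Ar G) ∈ S → Gi S i m' h m'' → Gi S i m (g * h) m''
  | bwd (m : ℕ) (g : G i) (m' : ℕ) (h : G i) (m'' : ℕ) :
      (⟨i, (m', g, m)⟩ : Ar G) ∈ S → Gi S i m' h m'' → Gi S i m (g⁻¹ * h) m''

variable {S S' : Finset (Ar G)} {i : ι}

theorem Gi.mul {a b c : ℕ} {g h : G i} (h1 : Gi S i a g b) (h2 : Gi S i b h c) :
    Gi S i a (g * h) c := by
  induction h1 with
  | one m => simpa using h2
  | fwd m g m' k m'' hs _ ih => rw [mul_assoc]; exact Gi.fwd _ _ _ _ _ hs (ih h2)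
  | bwd m g m' k m'' hs _ ih => rw [mul_assoc]; exact Gi.bwd _ _ _ _ _ hs (ih h2)

theorem Gi.single {a b : ℕ} {g : G i} (h : (⟨i, (a, g, b)⟩ : Ar G) ∈ S) : Gi S i a g b := by
  simpa using Gi.fwd a g b 1 b h (Gi.one b)

theorem Gi.single' {a b : ℕ} {g : G i} (h : (⟨i, (a, g, b)⟩ : Ar G) ∈ S) : Gi S i b g⁻¹ a := by
  simpa using Gi.bwd b g a 1 a h (Gi.one a)

theorem Gi.inv {a b : ℕ} {g : G i} (h1 : Gi S i a g b) : Gi S i b g⁻¹ a := by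
  induction h1 with
  | one m => simpa using Gi.one m
  | fwd m g m' k m'' hs _ ih => rw [mul_inv_rev]; exact ih.mul (Gi.single' hs)
  | bwd m g m' k m'' hs _ ih => rw [mul_inv_rev, inv_inv]; exact ih.mul (Gi.single hs)

theorem Gi.gauge (ψ : ℕ → ℕ) (γ : ℕ → G i)
    (H : ∀ a g b, (⟨i, (a, g, b)⟩ : Ar G) ∈ S → Gi S' i (ψ a) ((γ a)⁻¹ * g * γ b) (ψ b))
    {a b : ℕ} {g : G i} (h : Gi S i a g b) : Gi S' i (ψ a) ((γ a)⁻¹ * g * γ b) (ψ b) := by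
  induction h with
  | one m => simpa using Gi.one _
  | fwd m g m' k m'' hs _ ih => simpa [mul_assoc] using (H _ _ _ hs).mul ih
  | bwd m g m' k m'' hs _ ih => simpa [mul_assoc] using (H _ _ _ hs).inv.mul ih

theorem Gi.rename (φ : ℕ → ℕ)
    (H : ∀ a g b, (⟨i, (a, g, b)⟩ : Ar G) ∈ S → Gi S' i (φ a) g (φ b))
    {a b : ℕ} {g : G i} (h : Gi S i a g b) : Gi S' i (φ a) g (φ b) := by
  simpa using Gi.gauge (S' := S') φ (fun _ => 1) (by simpa using H) h

theorem Gi.first {a b : ℕ} {g : G i} (h : Gi S i a g b) (hab : a ≠ b) :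
    ∃ s ∈ S, ∃ (k : G i) (q : ℕ), q ≠ a ∧ (s = ⟨i, (a, k, q)⟩ ∨ s = ⟨i, (q, k⁻¹, a)⟩) := by
  induction h with
  | one m => exact absurd rfl hab
  | fwd m g m' k m'' hs _ ih =>
    by_cases hm : m' = m
    · subst hm; exact ih hab
    · exact ⟨_, hs, g, m', hm, Or.inl rfl⟩
  | bwd m g m' k m'' hs _ ih =>
    by_cases hm : m' = m
    · subst hm; exact ih hab
    · exact ⟨_, hs, g⁻¹, m', hm, Or.inr (by simp)⟩

theorem Gi.closure_mem {g : G i} {a b : ℕ} (h : Gi S i a g b) :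
    g ∈ Subgroup.closure {k : G i | ∃ a b, (⟨i, (a, k, b)⟩ : Ar G) ∈ S} := by
  induction h with
  | one m => exact one_mem _
  | fwd m g m' k m'' hs _ ih => exact mul_mem (Subgroup.subset_closure ⟨_, _, hs⟩) ih
  | bwd m g m' k m'' hs _ ih => exact mul_mem (inv_mem (Subgroup.subset_closure ⟨_, _, hs⟩)) ih

inductive Gen (S : Finset (Ar G)) : ℕ → CoprodI G → ℕ → Prop
  | one (m : ℕ) : Gen S m 1 m
  | cons (i : ι) (m : ℕ) (g : G i) (m' : ℕ) (h : CoprodI G) (m'' : ℕ) :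
      Gi S i m g m' → Gen S m' h m'' → Gen S m (CoprodI.of g * h) m''

theorem Gen.mul {a b c : ℕ} {g h : CoprodI G} (h1 : Gen S a g b) (h2 : Gen S b h c) :
    Gen S a (g * h) c := by
  induction h1 with
  | one m => simpa using h2
  | cons i m g m' k m'' hs _ ih => rw [mul_assoc]; exact Gen.cons _ _ _ _ _ _ hs (ih h2)

theorem Gen.single {a b : ℕ} {g : G i} (h : Gi S i a g b) : Gen S a (CoprodI.of g) b := by
  simpa using Gen.cons i a g b 1 b h (Gen.one b)

theorem Gen.inv {a b : ℕ} {g : CoprodI G} (h1 : Gen S a g b) : Gen S b g⁻¹ a := by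
  induction h1 with
  | one m => simpa using Gen.one m
  | cons i m g m' k m'' hs _ ih =>
    rw [mul_inv_rev, ← map_inv]; exact ih.mul (Gen.single hs.inv)

theorem Gen.rename (φ : ℕ → ℕ)
    (H : ∀ i a g b, Gi S i a g b → Gi S' i (φ a) g (φ b))
    {a b : ℕ} {g : CoprodI G} (h : Gen S a g b) : Gen S' (φ a) g (φ b) := by
  induction h with
  | one m => exact Gen.one _
  | cons i m g m' k m'' hs _ ih => exact Gen.cons _ _ _ _ _ _ (H _ _ _ _ hs) ih

theorem Gi.mono (h : S ⊆ S') {a b : ℕ} {g : G i} (h1 : Gi S i a g b) : Gi S' i a g b :=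
  Gi.rename id (fun _ _ _ hs => Gi.single (h hs)) h1

theorem Gen.mono (h : S ⊆ S') {a b : ℕ} {g : CoprodI G} (h1 : Gen S a g b) : Gen S' a g b :=
  Gen.rename id (fun _ _ _ _ hs => hs.mono h) h1

/-- state of the folding process -/
def St (S : Finset (Ar G)) (M : Finset ℕ) (m0 : ℕ) : Prop :=
  (∀ g, Gen S m0 g m0) ∧ (∀ p ∈ M, ∃ g, Gen S m0 g p) ∧ S.card ≤ M.card + 1

theorem St.fold {M : Finset ℕ} {m0 : ℕ} (hS : St S M m0) {m m' : ℕ} (hg : Gi S i m 1 m')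
    (hm : m ≠ m') : ∃ (S' : Finset (Ar G)) (M' : Finset ℕ) (m1 : ℕ), S'.card < S.card ∧ St S' M' m1 := by
  classical
  obtain ⟨s, hs, h, q, hq, hsh⟩ := hg.inv.first hm.symm
  let φ : ℕ → ℕ := fun a => if a = m' then m else a
  let ψ : ι → ℕ → ℕ := fun j a => if j = i then (if a = m' then q else a) else φ a
  let γ : ∀ j, ℕ → G j := Function.update (fun _ _ => 1) i (fun a => if a = m' then h else 1)
  let T : Ar G → Ar G := fun s =>
    ⟨s.1, (ψ s.1 s.2.1, (γ s.1 s.2.1)⁻¹ * s.2.2.1 * γ s.1 s.2.2.2, ψ s.1 s.2.2.2)⟩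
  let S' := (S.erase s).image T
  have hγi : γ i = fun a => if a = m' then h else 1 := by simp [γ]
  have hγj : ∀ j, j ≠ i → γ j = fun _ => 1 := by intro j hj; simp [γ, hj]
  have hψi : ψ i = fun a => if a = m' then q else a := by funext a; simp [ψ]
  have hψj : ∀ j, j ≠ i → ψ j = φ := by intro j hj; funext a; simp [ψ, hj]
  have key : ∀ j a g b, Gi S j a g b → Gi S' j (ψ j a) ((γ j a)⁻¹ * g * γ j b) (ψ j b) := by
    intro j a g b
    apply Gi.gauge
    intro a g b hab
    by_cases hne : (⟨j, (a, g, b)⟩ : Ar G) = s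
    · have : Gi S' i q 1 q := Gi.one q
      rw [← hne] at hsh
      rcases hsh with hsh | hsh
      · obtain ⟨rfl, hh⟩ := Sigma.mk.inj_iff.1 hsh
        simp only [heq_eq_eq, Prod.mk.injEq] at hh
        obtain ⟨rfl, rfl, rfl⟩ := hh
        simpa [hγi, hψi, hq] using this
      · obtain ⟨rfl, hh⟩ := Sigma.mk.inj_iff.1 hsh
        simp only [heq_eq_eq, Prod.mk.injEq] at hh
        obtain ⟨rfl, rfl, rfl⟩ := hh
        simpa [hγi, hψi, hq] using this
    · apply Gi.single
      exact Finset.mem_image.2 ⟨_, Finset.mem_erase.2 ⟨hne, hab⟩, rfl⟩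
  have k2 : Gi S' i m h q := by
    have := key i m 1 m' hg
    simpa [hγi, hψi, hm] using this
  have k3 : ∀ j a, Gi S' j (φ a) (γ j a) (ψ j a) := by
    intro j a
    by_cases hj : j = i
    · subst hj
      by_cases ha : a = m'
      · subst ha; simpa [hγi, hψi, φ] using k2
      · simpa [hγi, hψi, φ, ha] using Gi.one _
    · rw [hγj j hj, hψj j hj]; exact Gi.one _
  have k4 : ∀ j a g b, Gi S j a g b → Gi S' j (φ a) g (φ b) := by
    intro j a g b hab
    have := ((k3 j a).mul (key j a g b hab)).mul (k3 j b).inv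
    simpa [mul_assoc] using this
  have k5 : ∀ {a g b}, Gen S a g b → Gen S' (φ a) g (φ b) := fun hh => Gen.rename φ k4 hh
  have hc : S'.card < S.card :=
    lt_of_le_of_lt Finset.card_image_le (Finset.card_erase_lt_of_mem hs)
  refine ⟨S', M.erase m', φ m0, hc, fun g => k5 (hS.1 g), ?_, ?_⟩
  · intro p hp
    obtain ⟨hp1, hp2⟩ := Finset.mem_erase.1 hp
    obtain ⟨g, hgp⟩ := hS.2.1 p hp2
    refine ⟨g, ?_⟩
    have := k5 hgp
    simpa [φ, hp1] using this
  · have := hS.2.2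
    have := Finset.pred_card_le_card_erase (s := M) (a := m')
    omega

def RP (S : Finset (Ar G)) : List (Σ i, G i) → ℕ → ℕ → Prop
  | [], m, m' => m = m'
  | s :: l, m, m' => ∃ p, Gi S s.1 m s.2 p ∧ RP S l p m'

variable [∀ i, DecidableEq (G i)]

theorem RP_rcons (ht : ∀ i m m', Gi S i m 1 m' → m = m') (p : CoprodI.Word.Pair G i) {m q m' : ℕ}
    (h1 : Gi S i m p.head q) (h2 : RP S p.tail.toList q m') :
    RP S (CoprodI.Word.rcons p).toList m m' := by
  unfold CoprodI.Word.rcons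
  split_ifs with h
  · rw [h] at h1
    rw [ht _ _ _ h1]; exact h2
  · exact ⟨q, h1, h2⟩

theorem of_RP_rcons (p : CoprodI.Word.Pair G i) {m m' : ℕ}
    (h : RP S (CoprodI.Word.rcons p).toList m m') :
    ∃ q, Gi S i m p.head q ∧ RP S p.tail.toList q m' := by
  unfold CoprodI.Word.rcons at h
  split_ifs at h with h1
  · exact ⟨m, by rw [h1]; exact Gi.one m, h⟩
  · exact h

theorem Gen.RP (ht : ∀ i m m', Gi S i m 1 m' → m = m') {m m' : ℕ} {g : CoprodI G}
    (h : Gen S m g m') : RP S (g • (CoprodI.Word.empty : CoprodI.Word G)).toList m m' := by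
  induction h with
  | one m => rw [one_smul]; rfl
  | cons i m g m' k m'' hs _ ih =>
    rw [mul_smul]
    generalize k • (CoprodI.Word.empty : CoprodI.Word G) = w at ih
    rw [CoprodI.Word.of_smul_def]
    have hw : w = CoprodI.Word.rcons (CoprodI.Word.equivPair i w) := by
      rw [← CoprodI.Word.equivPair_symm, Equiv.symm_apply_apply]
    rw [hw] at ih
    obtain ⟨q, h1, h2⟩ := of_RP_rcons _ ih
    exact RP_rcons ht _ (hs.mul h1) h2

theorem RP_det (ht : ∀ i m m', Gi S i m 1 m' → m = m') (l : List (Σ i, G i)) {m a b : ℕ}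
    (h1 : RP S l m a) (h2 : RP S l m b) : a = b := by
  induction l generalizing m with
  | nil => exact h1.symm.trans h2
  | cons s l ih =>
    obtain ⟨p, hp, h1⟩ := h1
    obtain ⟨q, hq, h2⟩ := h2
    have : p = q := ht s.1 _ _ (by simpa using hp.inv.mul hq)
    subst this
    exact ih h1 h2

theorem St.terminal {M : Finset ℕ} {m0 : ℕ} (hS : St S M m0)
    (ht : ∀ i m m', Gi S i m 1 m' → m = m') :
    S.card ≤ 2 ∧ ∀ i (g : G i), g ∈ Subgroup.closure {k : G i | ∃ a b, (⟨i, (a, k, b)⟩ : Ar G) ∈ S} := by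
  obtain ⟨h1, h2, h3⟩ := hS
  constructor
  · have : M ⊆ {m0} := by
      intro p hp
      obtain ⟨g, hg⟩ := h2 p hp
      exact Finset.mem_singleton.2 (RP_det ht _ (hg.RP ht) ((h1 g).RP ht))
    have := Finset.card_le_card this
    simp at this
    omega
  · intro i g
    have := (h1 (CoprodI.of g)).RP ht
    rw [CoprodI.Word.of_smul_def] at this
    obtain ⟨q, hq, -⟩ := of_RP_rcons _ this
    have he : (CoprodI.Word.equivPair i (CoprodI.Word.empty : CoprodI.Word G)).head = 1 := by
      rw [CoprodI.Word.equivPair_eq_of_fstIdx_ne]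
      simp [CoprodI.Word.fstIdx, CoprodI.Word.empty]
    simp only [he, mul_one] at hq
    exact hq.closure_mem

theorem St.fin (N : ℕ) : ∀ {S : Finset (Ar G)} {M : Finset ℕ} {m0 : ℕ}, S.card ≤ N → St S M m0 →
    ∃ S' : Finset (Ar G), S'.card ≤ 2 ∧
      ∀ i (g : G i), g ∈ Subgroup.closure {k : G i | ∃ a b, (⟨i, (a, k, b)⟩ : Ar G) ∈ S'} := by
  induction N with
  | zero =>
    intro S M m0 h hS
    by_cases ht : ∀ i m m', Gi S i m 1 m' → m = m'
    · exact ⟨S, hS.terminal ht⟩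
    · push Not at ht
      obtain ⟨i, m, m', h1, h2⟩ := ht
      obtain ⟨S', M', m1, h3, h4⟩ := hS.fold h1 h2
      omega
  | succ N ih =>
    intro S M m0 h hS
    by_cases ht : ∀ i m m', Gi S i m 1 m' → m = m'
    · exact ⟨S, hS.terminal ht⟩
    · push Not at ht
      obtain ⟨i, m, m', h1, h2⟩ := ht
      obtain ⟨S', M', m1, h3, h4⟩ := hS.fold h1 h2
      exact ih (by omega) h4

theorem add_path (x : CoprodI G) : ∀ (S : Finset (Ar G)) (M : Finset ℕ) (m0 m : ℕ), m ∈ M → 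
    (∀ p ∈ M, ∃ g, Gen S m0 g p) → ∃ (S' : Finset (Ar G)) (M' : Finset ℕ) (p : ℕ), S ⊆ S' ∧ M ⊆ M' ∧
    p ∈ M' ∧ Gen S' m x p ∧ (∀ p ∈ M', ∃ g, Gen S' m0 g p) ∧ S'.card + M.card ≤ S.card + M'.card := by
  classical
  induction x using CoprodI.induction_on with
  | one =>
    intro S M m0 m hm h
    exact ⟨S, M, m, subset_rfl, subset_rfl, hm, Gen.one m, h, le_rfl⟩
  | of i g =>
    intro S M m0 m hm h
    obtain ⟨p, hp⟩ := Infinite.exists_notMem_finset M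
    have hsub : S ⊆ insert (⟨i, (m, g, p)⟩ : Ar G) S := Finset.subset_insert _ _
    have hgen : Gen (insert (⟨i, (m, g, p)⟩ : Ar G) S) m (CoprodI.of g) p :=
      Gen.single (Gi.single (Finset.mem_insert_self _ _))
    refine ⟨insert ⟨i, (m, g, p)⟩ S, insert p M, p, hsub, Finset.subset_insert _ _,
      Finset.mem_insert_self _ _, hgen, ?_, ?_⟩
    · intro p' hp'
      rcases Finset.mem_insert.1 hp' with rfl | hp'
      · obtain ⟨k, hk⟩ := h m hm
        exact ⟨_, (hk.mono hsub).mul hgen⟩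
      · obtain ⟨k, hk⟩ := h p' hp'
        exact ⟨_, hk.mono hsub⟩
    · rw [Finset.card_insert_of_notMem hp]
      have := Finset.card_insert_le (⟨i, (m, g, p)⟩ : Ar G) S
      omega
  | mul x y hx hy =>
    intro S M m0 m hm h
    obtain ⟨S1, M1, p1, a1, a2, a3, a4, a5, a6⟩ := hx S M m0 m hm h
    obtain ⟨S2, M2, p2, b1, b2, b3, b4, b5, b6⟩ := hy S1 M1 m0 p1 a3 a5
    exact ⟨S2, M2, p2, a1.trans b1, a2.trans b2, b3, (a4.mono b1).mul b4, b5, by omega⟩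

theorem add_loop (x : CoprodI G) (S : Finset (Ar G)) (M : Finset ℕ) (m0 : ℕ) (hm : m0 ∈ M) 
    (h : ∀ p ∈ M, ∃ g, Gen S m0 g p) : ∃ (S' : Finset (Ar G)) (M' : Finset ℕ), 
    m0 ∈ M' ∧ (∀ g, Gen S m0 g m0 → Gen S' m0 g m0) ∧ Gen S' m0 x m0 ∧
    (∀ p ∈ M', ∃ g, Gen S' m0 g p) ∧ S'.card + M.card ≤ S.card + M'.card + 1 := by
  classical
  obtain ⟨S1, M1, p1, a1, a2, a3, a4, a5, a6⟩ := add_path x S M m0 m0 hm h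
  by_cases hp : p1 = m0
  · subst hp
    exact ⟨S1, M1, a3, fun g hg => hg.mono a1, a4, a5, by omega⟩
  let φ : ℕ → ℕ := fun a => if a = p1 then m0 else a
  let T : Ar G → Ar G := fun s => ⟨s.1, (φ s.2.1, s.2.2.1, φ s.2.2.2)⟩
  have k : ∀ {a g b}, Gen S1 a g b → Gen (S1.image T) (φ a) g (φ b) := by
    intro a g b
    apply Gen.rename
    intro i a g b
    apply Gi.rename
    intro a g b hab
    exact Gi.single (Finset.mem_image.2 ⟨_, hab, rfl⟩)
  have hφ0 : φ m0 = m0 := by simp [φ, Ne.symm hp]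
  have hφ1 : φ p1 = m0 := by simp [φ]
  refine ⟨S1.image T, M1.erase p1, Finset.mem_erase.2 ⟨Ne.symm hp, a2 hm⟩, ?_, ?_, ?_, ?_⟩
  · intro g hg
    have := k (hg.mono a1)
    rwa [hφ0] at this
  · have := k a4
    rwa [hφ0, hφ1] at this
  · intro p hp'
    obtain ⟨hp1, hp2⟩ := Finset.mem_erase.1 hp'
    obtain ⟨g, hg⟩ := a5 p hp2
    have := k hg
    rw [hφ0] at this
    exact ⟨g, by simpa [φ, hp1] using this⟩
  · have := Finset.card_image_le (s := S1) (f := T)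
    have := Finset.card_erase_add_one a3
    omega

theorem grushko_aux (x y : CoprodI G) (h : Subgroup.closure {x, y} = ⊤) :
    ∃ S : Finset (Ar G), S.card ≤ 2 ∧
      ∀ i (g : G i), g ∈ Subgroup.closure {k : G i | ∃ a b, (⟨i, (a, k, b)⟩ : Ar G) ∈ S} := by
  classical
  obtain ⟨S1, M1, a1, a2, a3, a4, a5⟩ := add_loop x (∅ : Finset (Ar G)) {0} 0 (by simp)
    (by intro p hp; simp at hp; subst hp; exact ⟨1, Gen.one _⟩)
  obtain ⟨S2, M2, b1, b2, b3, b4, b5⟩ := add_loop y S1 M1 0 a1 a4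
  apply St.fin (M := M2) (m0 := 0) _ (le_refl S2.card)
  refine ⟨?_, b4, ?_⟩
  · intro g
    have hg : g ∈ Subgroup.closure {x, y} := by rw [h]; trivial
    induction hg using Subgroup.closure_induction with
    | mem z hz =>
      rcases hz with rfl | rfl
      · exact b2 _ a3
      · exact b3
    | one => exact Gen.one _
    | mul a b _ _ ha hb => exact ha.mul hb
    | inv a _ ha => exact ha.inv
  · simp at a5
    omega

end grushko

theorem grushko_bool {G : Bool → Type} [∀ i, Group (G i)] [∀ i, Nontrivial (G i)] (x y : CoprodI G)
    (h : Subgroup.closure {x, y} = ⊤) (i : Bool) : ∃ z : G i, Subgroup.closure {z} = ⊤ := by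
  classical
  obtain ⟨S, hS, hg⟩ := grushko_aux x y h
  have hex : ∀ i, ∃ k a b, (⟨i, (a, k, b)⟩ : Ar G) ∈ S := by
    intro i
    by_contra hc
    push Not at hc
    obtain ⟨g, hg1⟩ := exists_ne (1 : G i)
    have := hg i g
    rw [show {k : G i | ∃ a b, (⟨i, (a, k, b)⟩ : Ar G) ∈ S} = ∅ by
      ext k; simpa using hc k] at this
    simp at this
    exact hg1 this
  obtain ⟨k, a, b, hk⟩ := hex i
  obtain ⟨k', a', b', hk'⟩ := hex (!i)
  refine ⟨k, ?_⟩
  rw [eq_top_iff]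
  intro g _
  refine Subgroup.closure_mono ?_ (hg i g)
  rintro l ⟨c, d, hl⟩
  by_contra hne
  have hne : k ≠ l := fun h => hne h.symm
  have : 2 < S.card := by
    rw [Finset.two_lt_card]
    refine ⟨_, hk, _, hk', _, hl, ?_, ?_, ?_⟩
    · intro he; have := congrArg Sigma.fst he; simp at this
    · intro he; simp at he; exact hne he.2.1
    · intro he; have := congrArg Sigma.fst he; simp at this
  omega

/-- `A * B` as an indexed coproduct -/
theorem coprod_bool (A B : Type) [Group A] [Group B] (C : Bool → Type) [∀ i, Group (C i)]
    (e1 : A ≃* C true) (e2 : B ≃* C false) : Nonempty (Coprod A B ≃* CoprodI C) := by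
  refine ⟨MonoidHom.toMulEquiv (Coprod.lift (CoprodI.of.comp e1.toMonoidHom) (CoprodI.of.comp e2.toMonoidHom))
    (CoprodI.lift fun b => match b with
      | true => Coprod.inl.comp e1.symm.toMonoidHom
      | false => Coprod.inr.comp e2.symm.toMonoidHom) ?_ ?_⟩
  · ext a <;> simp
  · apply CoprodI.ext_hom
    intro b
    cases b <;> (apply MonoidHom.ext; intro x; simp)

def boolFam (A B : Type) : Bool → Type
  | true => A
  | false => B

instance (A B : Type) [Group A] [Group B] : ∀ b, Group (boolFam A B b)
  | true => inferInstanceAs (Group A)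
  | false => inferInstanceAs (Group B)

theorem grushko (A B : Type) [Group A] [Group B] [Nontrivial A] [Nontrivial B] (x y : Coprod A B)
    (h : Subgroup.closure {x, y} = ⊤) :
    (∃ z : A, Subgroup.closure {z} = ⊤) ∧ (∃ z : B, Subgroup.closure {z} = ⊤) := by
  obtain ⟨e⟩ := coprod_bool A B (boolFam A B) (MulEquiv.refl A) (MulEquiv.refl B)
  have hN : ∀ b, Nontrivial (boolFam A B b) := by
    intro b; cases b
    · exact inferInstanceAs (Nontrivial B)
    · exact inferInstanceAs (Nontrivial A)
  have h2 : Subgroup.closure {e x, e y} = ⊤ := by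
    have := congrArg (Subgroup.map e.toMonoidHom) h
    rw [MonoidHom.map_closure, ← MonoidHom.range_eq_map, MonoidHom.range_eq_top.2 e.surjective] at this
    simpa [Set.image_insert_eq] using this
  exact ⟨grushko_bool _ _ h2 true, grushko_bool _ _ h2 false⟩

end Pride

namespace Pride
open Monoid

def Cyc (G : Type) [Group G] : Prop := ∃ z : G, Subgroup.closure {z} = ⊤
def TwoGen (G : Type) [Group G] : Prop := ∃ x y : G, Subgroup.closure {x, y} = ⊤

theorem closure_map_top {A B : Type} [Group A] [Group B] (f : A →* B) (hf : Function.Surjective f)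
    {s : Set A} (h : Subgroup.closure s = ⊤) : Subgroup.closure (f '' s) = ⊤ := by
  rw [← MonoidHom.map_closure, h, ← MonoidHom.range_eq_map, MonoidHom.range_eq_top.2 hf]

theorem Cyc.map {A B : Type} [Group A] [Group B] (h : Cyc A) (f : A →* B)
    (hf : Function.Surjective f) : Cyc B := by
  obtain ⟨z, hz⟩ := h
  exact ⟨f z, by simpa using closure_map_top f hf hz⟩

theorem TwoGen.map {A B : Type} [Group A] [Group B] (h : TwoGen A) (f : A →* B)
    (hf : Function.Surjective f) : TwoGen B := by
  obtain ⟨x, y, hz⟩ := h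
  exact ⟨f x, f y, by simpa [Set.image_insert_eq] using closure_map_top f hf hz⟩

theorem Cyc.of_subsingleton {A : Type} [Group A] [Subsingleton A] : Cyc A :=
  ⟨1, Subsingleton.elim _ _⟩

theorem coprodI_bool_comm {G : Bool → Type} [∀ i, Group (G i)] (a : G true) (b : G false) (ha : a ≠ 1)
    (hb : b ≠ 1) : (CoprodI.of a * CoprodI.of b : CoprodI G) ≠ CoprodI.of b * CoprodI.of a := by
  classical
  intro h
  let w1 : CoprodI.Word G := ⟨[⟨true, a⟩, ⟨false, b⟩], by simp [ha, hb], by simp⟩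
  let w2 : CoprodI.Word G := ⟨[⟨false, b⟩, ⟨true, a⟩], by simp [ha, hb], by simp⟩
  have h1 : w1.prod = w2.prod := by simpa [w1, w2, CoprodI.Word.prod] using h
  have h2 : w1 = w2 := CoprodI.Word.equiv.symm.injective h1
  have := congrArg CoprodI.Word.toList h2
  simp [w1, w2] at this

theorem coprod_not_cyc {A B : Type} [Group A] [Group B] [Nontrivial A] [Nontrivial B] :
    ¬ Cyc (Coprod A B) := by
  rintro ⟨z, hz⟩
  obtain ⟨e⟩ := coprod_bool A B (boolFam A B) (MulEquiv.refl A) (MulEquiv.refl B)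
  obtain ⟨a, ha⟩ := exists_ne (1 : A)
  obtain ⟨b, hb⟩ := exists_ne (1 : B)
  have hz' : Subgroup.closure {e z} = ⊤ := by
    simpa using closure_map_top e.toMonoidHom e.surjective hz
  exact coprodI_bool_comm (G := boolFam A B) a b ha hb (comm_of_cyclic hz' _ _)

def ok (n m : ℕ) : Prop := m = 0 ∨ m ∣ n

def Cy (n : ℕ) (G : Type) [Group G] : Prop := ∃ m, ok n m ∧ Nonempty (G ≃* Multiplicative (ZMod m))

abbrev CF (m l : ℕ) : Type := CoprodI (fun b : Bool => Multiplicative (ZMod (cond b m l)))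

def T0 (n : ℕ) (G : Type) [Group G] : Prop :=
  ∃ m l, ok n m ∧ ok n l ∧ Nonempty (G ≃* CF m l)

theorem T0.congr {n : ℕ} {G H : Type} [Group G] [Group H] (h : T0 n G) (e : H ≃* G) : T0 n H := by
  obtain ⟨m, l, h1, h2, ⟨f⟩⟩ := h
  exact ⟨m, l, h1, h2, ⟨e.trans f⟩⟩

theorem T0.of_coprod {n : ℕ} {A B : Type} [Group A] [Group B] (hA : Cy n A) (hB : Cy n B) :
    T0 n (Coprod A B) := by
  obtain ⟨m, hm, ⟨e1⟩⟩ := hA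
  obtain ⟨l, hl, ⟨e2⟩⟩ := hB
  exact ⟨m, l, hm, hl, coprod_bool A B (fun b : Bool => Multiplicative (ZMod (cond b m l))) e1 e2⟩

theorem Cy.of_subsingleton {n : ℕ} {A : Type} [Group A] [Subsingleton A] : Cy n A := by
  have h1 : Subsingleton (Multiplicative (ZMod 1)) := inferInstanceAs (Subsingleton (ZMod 1))
  exact ⟨1, Or.inr (one_dvd n), ⟨MonoidHom.toMulEquiv 1 1
    (MonoidHom.ext fun _ => Subsingleton.elim _ _) (MonoidHom.ext fun _ => Subsingleton.elim _ _)⟩⟩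

theorem Cy.congr {n : ℕ} {G H : Type} [Group G] [Group H] (h : Cy n G) (e : H ≃* G) : Cy n H := by
  obtain ⟨m, h1, ⟨f⟩⟩ := h
  exact ⟨m, h1, ⟨e.trans f⟩⟩

theorem Cy.T0 {n : ℕ} {A : Type} [Group A] (h : Cy n A) : T0 n A := by
  have h2 : Pride.T0 n (Coprod A Unit) := T0.of_coprod h Cy.of_subsingleton
  have h3 : SplitAs (MonoidHom.id A) (1 : Unit →* A) := by
    refine ⟨⟨Coprod.inl, fun a => rfl, fun b => ?_⟩, ?_⟩
    · rw [Subsingleton.elim b 1, map_one, map_one, map_one]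
    · rw [eq_top_iff]
      exact fun a _ => Subgroup.subset_closure (Or.inl ⟨a, rfl⟩)
  obtain ⟨e⟩ := h3.equiv
  exact h2.congr e

section
variable {X Ω : Type} [MulAction (FreeGroup X) Ω]
variable {C : CW X} {n : ℕ} {E E1 E2 E' : Finset (Ω × X)} {v b : Ω}

theorem Irred.inter [DecidableEq (Ω × X)] {M : Finset (Ω × X)} (hM : Irred C n M) (hME : M ⊆ E)
    (hd : ∀ f ∈ E1, f ∉ E2) (hW : ∀ u ∈ W0 C n E, u ∈ W0 C n E1 ∨ u ∈ W0 C n E2) :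
    Irred C n (M ∩ E1) := by
  have key : ∀ f ∈ E1, ∀ u ∈ W0 C n M, ∀ i, edge (act u (C.h i)) (C.l i) = f →
      u ∈ W0 C n (M ∩ E1) := by
    intro f hf u hu i hi
    rcases hW u (W0_mono hME hu) with h | h
    · exact ⟨hu.1, fun i => Finset.mem_inter.2 ⟨hu.2 i, h.2 i⟩⟩
    · exact absurd (hi ▸ h.2 i) (hd f hf)
  intro f hf
  obtain ⟨hf1, hf2⟩ := Finset.mem_inter.1 hf
  obtain ⟨u, u', i, i', h1, h2, h3, h4, h5, h6, h7⟩ := hM f hf1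
  exact ⟨u, u', i, i', key f hf2 u h1 i h6, key f hf2 u' h2 i' h7, h3, h4, h5, h6, h7⟩

theorem reduce [DecidableEq (Ω × X)] (hn : 0 < n) (hE : Conn E v) (hI : ¬ Irred C n E) :
    (∃ E1, ∃ h1 : E1 ⊆ E, E1.card < E.card ∧ Conn E1 v ∧ (∀ M ⊆ E, Irred C n M → M ⊆ E1) ∧ ∃ m, ok n m ∧
      ∃ j : Multiplicative (ZMod m) →* Q C n E v,
      SplitAs (Qmap (C := C) (n := n) h1 (Trav.one v) (act_one v)) j) ∨
    (∃ (E1 E2 : Finset (Ω × X)) (b g : _) (h1 : E1 ⊆ E) (h2 : E2 ⊆ E) (hg : Trav E v g) (hb : act v g = b),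
      E1.card < E.card ∧ E2.card < E.card ∧ Conn E1 v ∧ Conn E2 b ∧
      (∀ M ⊆ E, Irred C n M → Irred C n (M ∩ E1) ∧ Irred C n (M ∩ E2) ∧ M ⊆ E1 ∪ E2) ∧
      SplitAs (Qmap (C := C) (n := n) h1 (Trav.one v) (act_one v)) (Qmap (C := C) (n := n) h2 hg hb)) := by
  unfold Irred at hI
  push Not at hI
  obtain ⟨e, heE, hI⟩ := hI
  have hI' : ∀ u ∈ W0 C n E, ∀ u' ∈ W0 C n E, ∀ i < C.L, ∀ i' < C.L,
      edge (act u (C.h i)) (C.l i) = e → edge (act u' (C.h i')) (C.l i') = e → u = u' ∧ i = i' := by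
    intro u hu u' hu' i hi i' hi' h1 h2
    by_contra hc
    exact hI u u' i i' hu hu' hi hi' (by simpa using hc) h1 h2
  have hMe : ∀ M ⊆ E, Irred C n M → e ∉ M := by
    intro M hM hMI he
    obtain ⟨u, u', i, i', h1, h2, h3, h4, h5, h6, h7⟩ := hMI e he
    obtain ⟨rfl, rfl⟩ := hI' u (W0_mono hM h1) u' (W0_mono hM h2) i h3 i' h4 h6 h7
    exact h5 rfl
  have hMe' : ∀ M ⊆ E, Irred C n M → M ⊆ E.erase e := by
    intro M hM hMI f hf
    refine Finset.mem_erase.2 ⟨?_, hM hf⟩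
    rintro rfl
    exact hMe M hM hMI hf
  have hlt : (E.erase e).card < E.card := Finset.card_erase_lt_of_mem heE
  by_cases hcr : ∃ u1 ∈ W0 C n E, ∃ i1 < C.L, edge (act u1 (C.h i1)) (C.l i1) = e
  · obtain ⟨u1, hu1, i1, hi1, he⟩ := hcr
    obtain ⟨h1, m, hm, h2⟩ := split_once hn hE heE hu1 hi1 he
      (fun u hu i hi h => hI' u hu u1 hu1 i hi i1 hi1 h he)
    exact Or.inl ⟨E.erase e, E.erase_subset e, hlt, h1, hMe', m, Or.inr hm, h2⟩
  · have h0 : ∀ u ∈ W0 C n E, ∀ i, edge (act u (C.h i)) (C.l i) ≠ e := by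
      intro u hu i hi
      apply hcr
      refine ⟨act u (C.R ^ (i / C.L)), W0_R_pow hu _, i % C.L, Nat.mod_lt _ C.hL, ?_⟩
      rw [← act_mul, ← CW.h_mod, CW.l_mod, hi]
    obtain ⟨ω, a, he, hr⟩ := hE.hit heE
    by_cases hr1 : Reach (E.erase e) v (act ω (ltr a))
    · exact Or.inl ⟨E.erase e, E.erase_subset e, hlt, conn_erase hE he hr hr1, hMe', 0, Or.inl rfl,
        split_zero hE he heE hr hr1 h0⟩
    · obtain ⟨E1, E2, b, g, h1, h2, hg, hb, e1, e2, c1, c2, hd, hu, hW, hs⟩ :=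
        split_sep (C := C) (n := n) hE he heE hr hr1 h0
      refine Or.inr ⟨E1, E2, b, g, h1, h2, hg, hb, Finset.card_lt_card ⟨h1, fun h => e1 (h heE)⟩,
        Finset.card_lt_card ⟨h2, fun h => e2 (h heE)⟩, c1, c2, ?_, hs⟩
      intro M hM hMI
      refine ⟨hMI.inter hM (fun f hf hf' => hd f hf' hf) hW, hMI.inter hM hd (fun u hu => (hW u hu).symm), ?_⟩
      intro f hf
      rcases hu f (hM hf) with rfl | h
      · exact absurd hf (hMe M hM hMI)
      · exact Finset.mem_union.2 h

theorem Q_empty : Subsingleton (Q C n (∅ : Finset (Ω × X)) v) := by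
  have : ∀ k : pi1 (∅ : Finset (Ω × X)) v, k = 1 := by
    intro k
    ext
    have hk2 := (mem_pi1.1 k.2).2
    generalize (k : FreeGroup X) = g at hk2
    cases hk2 with
    | one => rfl
    | cons _ a g h t => exact absurd h (Finset.notMem_empty _)
  constructor
  intro a b
  obtain ⟨a, rfl⟩ := QuotientGroup.mk_surjective a
  obtain ⟨b, rfl⟩ := QuotientGroup.mk_surjective b
  rw [this a, this b]

theorem thmA (hp : C.Prim) (hn : 1 < n) (N : ℕ) : ∀ (E : Finset (Ω × X)) (v : Ω), E.card ≤ N → Conn E v →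
    Cyc (Q C n E v) → Cy n (Q C n E v) ∧ ∀ M ⊆ E, Irred C n M → M = ∅ := by
  classical
  induction N using Nat.strong_induction_on with
  | _ N ih =>
  intro E v hN hE hc
  rcases E.eq_empty_or_nonempty with rfl | hne
  · have := Q_empty (C := C) (n := n) (v := v)
    exact ⟨Cy.of_subsingleton, fun M hM _ => Finset.subset_empty.1 hM⟩
  by_cases hI : Irred C n E
  · obtain ⟨z, hz⟩ := hc
    exact absurd hz (irr_not_cyclic hp hn hI hE hne z)
  rcases reduce (by omega) hE hI with ⟨E1, h1, hlt, hc1, hM, m, hm, j, hs⟩ |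
    ⟨E1, E2, b, g, h1, h2, hg, hb, hlt1, hlt2, hc1, hc2, hM, hs⟩
  · obtain ⟨e⟩ := hs.equiv
    rcases subsingleton_or_nontrivial (Multiplicative (ZMod m)) with hB | hB
    · let e' := MulEquiv.ofBijective _ hs.bij_left
      obtain ⟨a1, a2⟩ := ih _ (lt_of_lt_of_le hlt hN) E1 v le_rfl hc1
        (hc.map e'.symm.toMonoidHom e'.symm.surjective)
      exact ⟨a1.congr e'.symm, fun M hME hMI => a2 M (hM M hME hMI) hMI⟩
    · rcases subsingleton_or_nontrivial (Q C n E1 v) with hA | hA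
      · obtain ⟨a1, a2⟩ := ih _ (lt_of_lt_of_le hlt hN) E1 v le_rfl hc1 Cyc.of_subsingleton
        refine ⟨?_, fun M hME hMI => a2 M (hM M hME hMI) hMI⟩
        exact ⟨m, hm, ⟨(MulEquiv.ofBijective _ hs.bij_right).symm⟩⟩
      · exact absurd (hc.map e.toMonoidHom e.surjective) coprod_not_cyc
  · obtain ⟨e⟩ := hs.equiv
    have hcyc : Cyc (Q C n E1 v) ∧ Cyc (Q C n E2 b) ∧ (Cy n (Q C n E1 v) → Cy n (Q C n E2 b) →
        Cy n (Q C n E v)) := by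
      rcases subsingleton_or_nontrivial (Q C n E2 b) with hB | hB
      · let e' := MulEquiv.ofBijective _ hs.bij_left
        exact ⟨hc.map e'.symm.toMonoidHom e'.symm.surjective, Cyc.of_subsingleton, fun h _ => h.congr e'.symm⟩
      · rcases subsingleton_or_nontrivial (Q C n E1 v) with hA | hA
        · let e' := MulEquiv.ofBijective _ hs.bij_right
          exact ⟨Cyc.of_subsingleton, hc.map e'.symm.toMonoidHom e'.symm.surjective, fun _ h => h.congr e'.symm⟩
        · exact absurd (hc.map e.toMonoidHom e.surjective) coprod_not_cyc
    obtain ⟨a1, a2⟩ := ih _ (lt_of_lt_of_le hlt1 hN) E1 v le_rfl hc1 hcyc.1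
    obtain ⟨b1, b2⟩ := ih _ (lt_of_lt_of_le hlt2 hN) E2 b le_rfl hc2 hcyc.2.1
    refine ⟨hcyc.2.2 a1 b1, fun M hME hMI => ?_⟩
    obtain ⟨m1, m2, m3⟩ := hM M hME hMI
    have k1 := a2 _ Finset.inter_subset_right m1
    have k2 := b2 _ Finset.inter_subset_right m2
    rw [Finset.eq_empty_iff_forall_notMem]
    intro f hf
    rcases Finset.mem_union.1 (m3 hf) with h | h
    · have : f ∈ M ∩ E1 := Finset.mem_inter.2 ⟨hf, h⟩
      simp [k1] at this
    · have : f ∈ M ∩ E2 := Finset.mem_inter.2 ⟨hf, h⟩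
      simp [k2] at this

/-- the one-relator type core -/
def T1 (C : CW X) (n : ℕ) (E : Finset (Ω × X)) (v : Ω) : Prop :=
  ∃ (E' : Finset (Ω × X)) (u : Ω) (g : FreeGroup X) (h : E' ⊆ E) (hg : Trav E v g) (hu : act v g = u),
    Conn E' u ∧ Irred C n E' ∧ E'.Nonempty ∧ (W0 C n E').ncard = 1 ∧ E'.card = (verts E').card + 1 ∧
    (∀ M ⊆ E, Irred C n M → M ⊆ E') ∧ Function.Bijective (Qmap (C := C) (n := n) h hg hu)

theorem T1.trans (h : T1 C n E1 b) (h1 : E1 ⊆ E) {g : FreeGroup X} (hg : Trav E v g) (hb : act v g = b)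
    (hM : ∀ M ⊆ E, Irred C n M → M ⊆ E1) (hbij : Function.Bijective (Qmap (C := C) (n := n) h1 hg hb)) :
    T1 C n E v := by
  obtain ⟨E', u, g', h', hg', hu', c1, c2, c3, c4, c5, c6, c7⟩ := h
  refine ⟨E', u, g * g', h'.trans h1, (hg.mul (by rw [hb]; exact hg'.mono h1)), (by rw [act_mul, hb, hu']),
    c1, c2, c3, c4, c5, fun M hME hMI => c6 M (hM M hME hMI) hMI, ?_⟩
  have := hbij.comp c7
  convert this using 1
  funext q
  exact Qmap_comp h1 hg hb h' hg' hu' q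

theorem thmB (hp : C.Prim) (hn : 1 < n) (N : ℕ) : ∀ (E : Finset (Ω × X)) (v : Ω), E.card ≤ N → Conn E v →
    TwoGen (Q C n E v) → T0 n (Q C n E v) ∨ T1 C n E v := by
  classical
  induction N using Nat.strong_induction_on with
  | _ N ih =>
  intro E v hN hE h2
  by_cases hc : Cyc (Q C n E v)
  · exact Or.inl (thmA hp hn N E v hN hE hc).1.T0
  rcases E.eq_empty_or_nonempty with rfl | hne
  · have := Q_empty (C := C) (n := n) (v := v)
    exact absurd Cyc.of_subsingleton hc
  by_cases hI : Irred C n E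
  · obtain ⟨x, y, hxy⟩ := h2
    rcases irr_two hp hn hI hE hne x y hxy with ⟨⟨e⟩⟩ | ⟨h1, h2⟩
    · left
      refine ⟨0, 0, Or.inl rfl, Or.inl rfl, ⟨e.trans ?_⟩⟩
      have : (fun b : Bool => Multiplicative (ZMod (cond b 0 0))) = fun b : Bool => Multiplicative (ZMod 0) := by
        funext b; cases b <;> rfl
      have e1 : Nonempty (F2 ≃* CF 0 0) := by
        refine ⟨MonoidHom.toMulEquiv (CoprodI.lift fun b => match b with
          | true => (CoprodI.of (M := fun b : Bool => Multiplicative (ZMod (cond b 0 0))) (i := true))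
          | false => (CoprodI.of (M := fun b : Bool => Multiplicative (ZMod (cond b 0 0))) (i := false)))
          (CoprodI.lift fun b => match b with
          | true => (CoprodI.of (M := fun b : Bool => Multiplicative (ZMod 0)) (i := true))
          | false => (CoprodI.of (M := fun b : Bool => Multiplicative (ZMod 0)) (i := false))) ?_ ?_⟩
        · apply CoprodI.ext_hom
          intro b
          cases b <;> (apply MonoidHom.ext; intro x; simp)
        · apply CoprodI.ext_hom
          intro b
          cases b <;> (apply MonoidHom.ext; intro x; simp)
      exact e1.some
    · right
      refine ⟨E, v, 1, subset_rfl, Trav.one v, act_one v, hE, hI, hne, h1, h2, fun M hM _ => hM, ?_⟩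
      have : (Qmap (C := C) (n := n) (subset_refl E) (Trav.one v) (act_one v) : Q C n E v → Q C n E v) = id := by
        funext q
        obtain ⟨k, rfl⟩ := QuotientGroup.mk_surjective q
        rw [Qmap_mk]
        simp only [id]
        congr 1
        ext
        simp [conjPi]
      rw [this]
      exact Function.bijective_id
  rcases reduce (by omega) hE hI with ⟨E1, h1, hlt, hc1, hM, m, hm, j, hs⟩ |
    ⟨E1, E2, b, g, h1, h2', hg, hb, hlt1, hlt2, hc1, hc2, hM, hs⟩
  · obtain ⟨e⟩ := hs.equiv
    rcases subsingleton_or_nontrivial (Multiplicative (ZMod m)) with hB | hB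
    · let e' := MulEquiv.ofBijective _ hs.bij_left
      rcases ih _ (lt_of_lt_of_le hlt hN) E1 v le_rfl hc1
        (h2.map e'.symm.toMonoidHom e'.symm.surjective) with h | h
      · exact Or.inl (h.congr e'.symm)
      · exact Or.inr (h.trans h1 _ _ hM hs.bij_left)
    · rcases subsingleton_or_nontrivial (Q C n E1 v) with hA | hA
      · have hcy : Cy n (Q C n E v) := ⟨m, hm, ⟨(MulEquiv.ofBijective _ hs.bij_right).symm⟩⟩
        exact Or.inl hcy.T0
      · left
        obtain ⟨x, y, hxy⟩ := h2.map e.toMonoidHom e.surjective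
        obtain ⟨g1, -⟩ := grushko _ _ x y hxy
        exact (T0.of_coprod (thmA hp hn _ E1 v le_rfl hc1 g1).1 ⟨m, hm, ⟨MulEquiv.refl _⟩⟩).congr e
  · obtain ⟨e⟩ := hs.equiv
    rcases subsingleton_or_nontrivial (Q C n E2 b) with hB | hB
    · let e' := MulEquiv.ofBijective _ hs.bij_left
      rcases ih _ (lt_of_lt_of_le hlt1 hN) E1 v le_rfl hc1
        (h2.map e'.symm.toMonoidHom e'.symm.surjective) with h | h
      · exact Or.inl (h.congr e'.symm)
      · refine Or.inr (h.trans h1 _ _ ?_ hs.bij_left)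
        intro M hME hMI
        obtain ⟨m1, m2, m3⟩ := hM M hME hMI
        have k2 := (thmA hp hn _ E2 b le_rfl hc2 Cyc.of_subsingleton).2 _ Finset.inter_subset_right m2
        intro f hf
        rcases Finset.mem_union.1 (m3 hf) with h | h
        · exact h
        · have : f ∈ M ∩ E2 := Finset.mem_inter.2 ⟨hf, h⟩
          simp [k2] at this
    · rcases subsingleton_or_nontrivial (Q C n E1 v) with hA | hA
      · let e' := MulEquiv.ofBijective _ hs.bij_right
        rcases ih _ (lt_of_lt_of_le hlt2 hN) E2 b le_rfl hc2
          (h2.map e'.symm.toMonoidHom e'.symm.surjective) with h | h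
        · exact Or.inl (h.congr e'.symm)
        · refine Or.inr (h.trans h2' _ _ ?_ hs.bij_right)
          intro M hME hMI
          obtain ⟨m1, m2, m3⟩ := hM M hME hMI
          have k2 := (thmA hp hn _ E1 v le_rfl hc1 Cyc.of_subsingleton).2 _ Finset.inter_subset_right m1
          intro f hf
          rcases Finset.mem_union.1 (m3 hf) with h | h
          · have : f ∈ M ∩ E1 := Finset.mem_inter.2 ⟨hf, h⟩
            simp [k2] at this
          · exact h
      · left
        obtain ⟨x, y, hxy⟩ := h2.map e.toMonoidHom e.surjective
        obtain ⟨g1, g2⟩ := grushko _ _ x y hxy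
        exact (T0.of_coprod (thmA hp hn _ E1 v le_rfl hc1 g1).1 (thmA hp hn _ E2 b le_rfl hc2 g2).1).congr e

end
end Pride

namespace Pride
open Monoid

/-- residual finiteness -/
def RF (G : Type) [Group G] : Prop :=
  ∀ g : G, g ≠ 1 → ∃ (P : Type) (_ : Group P) (_ : Finite P) (f : G →* P), f g ≠ 1

theorem RF.finset {G : Type} [Group G] (h : RF G) (s : Finset G) :
    ∃ (P : Type) (_ : Group P) (_ : Finite P) (f : G →* P), ∀ g ∈ s, g ≠ 1 → f g ≠ 1 := by
  classical
  choose P gP fP f hf using h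
  let t := {g : G // g ∈ s ∧ g ≠ 1}
  have : Finite t := by
    apply Finite.of_injective (fun x : t => (⟨x.1, x.2.1⟩ : s))
    intro a b hab
    exact Subtype.ext (by simpa using hab)
  let _ : ∀ x : t, Group (P x.1 x.2.2) := fun x => gP x.1 x.2.2
  have : ∀ x : t, Finite (P x.1 x.2.2) := fun x => fP x.1 x.2.2
  refine ⟨∀ x : t, P x.1 x.2.2, inferInstance, inferInstance, MonoidHom.pi (fun x : t => f x.1 x.2.2), ?_⟩
  intro g hg hg1 he
  have := congrFun he ⟨g, hg, hg1⟩
  exact hf g hg1 this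

section
variable {ι : Type} [Finite ι] {P : ι → Type} [∀ i, Group (P i)] [∀ i, Finite (P i)]

theorem rf_finite_factors : RF (CoprodI P) := by
  classical
  intro g hg
  let w := CoprodI.Word.equiv g
  have hw : w.prod = g := CoprodI.Word.equiv.symm_apply_apply g
  let N := w.toList.length
  let W := {w : CoprodI.Word P // w.toList.length ≤ N}
  have hWf : Finite W := by
    have : Finite {l : List (Σ i, P i) | l.length ≤ N} := (List.finite_length_le _ N).to_subtype
    apply Finite.of_injective (fun w : W => (⟨w.1.toList, w.2⟩ : {l : List (Σ i, P i) | l.length ≤ N}))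
    intro a b hab
    apply Subtype.ext
    apply CoprodI.Word.ext
    simpa using hab
  have hlen : ∀ {i} (p : CoprodI.Word.Pair P i), (CoprodI.Word.rcons p).toList.length ≤ p.tail.toList.length + 1 := by
    intro i p
    unfold CoprodI.Word.rcons
    split_ifs
    · omega
    · simp [CoprodI.Word.cons]
  let a : ∀ i, P i → W → W := fun i x w =>
    if h : (CoprodI.Word.equivPair i w.1).tail.toList.length < N then
      ⟨(CoprodI.of x : CoprodI P) • w.1, by
        rw [CoprodI.Word.of_smul_def]
        exact (hlen _).trans h⟩
    else w
  let act : ∀ i, MulAction (P i) W := fun i =>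
    { smul := a i
      one_smul := by
        intro w
        change a i 1 w = w
        simp only [a]
        split_ifs
        · apply Subtype.ext; simp
        · rfl
      mul_smul := by
        intro x y w
        change a i (x * y) w = a i x (a i y w)
        by_cases h : (CoprodI.Word.equivPair i w.1).tail.toList.length < N
        · have h1 : a i y w = ⟨(CoprodI.of y : CoprodI P) • w.1, by
            rw [CoprodI.Word.of_smul_def]
            exact (hlen _).trans h⟩ := dif_pos h
          have h2 : (CoprodI.Word.equivPair i (a i y w).1).tail.toList.length < N := by
            rw [h1]
            simp only [CoprodI.Word.equivPair_smul_same]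
            exact h
          apply Subtype.ext
          have e1 : (a i (x * y) w).1 = (CoprodI.of (x * y) : CoprodI P) • w.1 :=
            congrArg Subtype.val (dif_pos h)
          have e2 : (a i x (a i y w)).1 = (CoprodI.of x : CoprodI P) • (a i y w).1 :=
            congrArg Subtype.val (dif_pos h2)
          rw [e1, e2, h1, map_mul, mul_smul]
        · have h1 : ∀ z, a i z w = w := fun z => dif_neg h
          rw [h1, h1, h1] }
  let Φ : CoprodI P →* Equiv.Perm W := CoprodI.lift (fun i => @MulAction.toPermHom (P i) W _ (act i))
  refine ⟨Equiv.Perm W, inferInstance, inferInstance, Φ, ?_⟩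
  have key : ∀ (w : CoprodI.Word P) (h : w.toList.length ≤ N),
      Φ w.prod ⟨CoprodI.Word.empty, Nat.zero_le _⟩ = ⟨w, h⟩ := by
    intro w
    induction w using CoprodI.Word.consRecOn with
    | empty => intro h; simp
    | cons i m w h1 h2 ih =>
      intro h
      have hl : w.toList.length < N := by
        have : (CoprodI.Word.cons m w h1 h2).toList.length = w.toList.length + 1 := by simp [CoprodI.Word.cons]
        omega
      rw [CoprodI.Word.prod_cons, map_mul, Equiv.Perm.mul_apply, ih hl.le]
      have e : Φ (CoprodI.of m) ⟨w, hl.le⟩ = a i m ⟨w, hl.le⟩ := by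
        simp only [Φ, CoprodI.lift_of]
        rfl
      rw [e]
      apply Subtype.ext
      change _ = CoprodI.Word.cons m w h1 h2
      rw [CoprodI.Word.cons_eq_smul]
      apply congrArg Subtype.val (dif_pos _)
      rw [CoprodI.Word.equivPair_eq_of_fstIdx_ne h1]
      exact hl
  intro h1
  have k := key w le_rfl
  rw [hw, h1] at k
  have k2 : CoprodI.Word.empty = w := congrArg Subtype.val k
  apply hg
  rw [← hw, ← k2, CoprodI.Word.prod_empty]

theorem rf_coprod {ι : Type} [Finite ι] {G : ι → Type} [∀ i, Group (G i)] (hG : ∀ i, RF (G i)) :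
    RF (CoprodI G) := by
  classical
  intro g hg
  let w := CoprodI.Word.equiv g
  have hw : w.prod = g := CoprodI.Word.equiv.symm_apply_apply g
  have hfs : ∀ i, ∃ s : Finset (G i), ∀ x, ⟨i, x⟩ ∈ w.toList → x ∈ s := by
    intro i
    have : (Sigma.mk i ⁻¹' {x | x ∈ w.toList} : Set (G i)).Finite :=
      Set.Finite.preimage (sigma_mk_injective.injOn) (List.finite_toSet w.toList)
    exact ⟨this.toFinset, fun x hx => by simpa using hx⟩
  choose s hs using hfs
  have := fun i => (hG i).finset (s i)
  choose P gP fP f hf using this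
  let F : CoprodI G →* CoprodI P := CoprodI.lift (fun i => CoprodI.of.comp (f i))
  let w' : CoprodI.Word P := ⟨w.toList.map (fun x => ⟨x.1, f x.1 x.2⟩), by
    intro l hl
    obtain ⟨x, hx, rfl⟩ := List.mem_map.1 hl
    exact hf x.1 x.2 (hs _ _ hx) (w.ne_one x hx), by
    rw [List.isChain_map]
    exact w.chain_ne⟩
  have hF : F g = w'.prod := by
    rw [← hw, CoprodI.Word.prod, CoprodI.Word.prod, map_list_prod]
    congr 1
    simp only [w', List.map_map]
    apply List.map_congr_left
    intro x _
    simp [F]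
  have hne : F g ≠ 1 := by
    intro h1
    rw [hF] at h1
    have h2 : w' = CoprodI.Word.empty := CoprodI.Word.equiv.symm.injective (h1.trans CoprodI.Word.prod_empty.symm)
    have h3 := congrArg CoprodI.Word.toList h2
    have h4 : w.toList = [] := by simpa [w', CoprodI.Word.empty] using h3
    apply hg
    rw [← hw, CoprodI.Word.prod, h4]
    rfl
  obtain ⟨R, gR, fR, k, hk⟩ := rf_finite_factors (P := P) (F g) hne
  exact ⟨R, gR, fR, k.comp F, hk⟩

theorem rf_zmod (m : ℕ) : RF (Multiplicative (ZMod m)) := by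
  intro g hg
  rcases Nat.eq_zero_or_pos m with rfl | hm
  · let a : ℤ := Multiplicative.toAdd g
    have ha : a ≠ 0 := hg
    have : NeZero (a.natAbs + 1) := ⟨by omega⟩
    refine ⟨Multiplicative (ZMod (a.natAbs + 1)), inferInstance, inferInstance,
      AddMonoidHom.toMultiplicative (Int.castAddHom (ZMod (a.natAbs + 1))), ?_⟩
    intro h
    have h2 : ((a : ℤ) : ZMod (a.natAbs + 1)) = 0 := h
    rw [ZMod.intCast_zmod_eq_zero_iff_dvd] at h2
    have := Int.eq_zero_of_abs_lt_dvd h2 (by push_cast; rw [Int.abs_eq_natAbs]; push_cast; omega)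
    exact ha this
  · have : NeZero m := ⟨by omega⟩
    exact ⟨_, inferInstance, inferInstance, MonoidHom.id _, hg⟩
end

theorem hopf {G : Type} [Group G] (hfg : Group.FG G) (hG : RF G) (f : G →* G)
    (hf : Function.Surjective f) : Function.Injective f := by
  rw [injective_iff_map_eq_one]
  intro k hk
  by_contra hne
  obtain ⟨P, gP, fP, φ, hφ⟩ := hG k hne
  have := finite_hom_of_fg (P := P) hfg
  have hinj : Function.Injective (fun ψ : G →* P => ψ.comp f) := by
    intro a b hab
    exact (MonoidHom.cancel_right hf).1 hab
  obtain ⟨ψ, hψ⟩ := Finite.surjective_of_injective hinj φ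
  apply hφ
  rw [← hψ]
  simp [hk]

theorem rf_CF (m l : ℕ) : RF (CF m l) := rf_coprod fun b => rf_zmod _

theorem hopf2 {G H : Type} [Group G] [Group H] (hG : TwoGen G) {m l : ℕ} (e1 : G ≃* CF m l) (e2 : H ≃* CF m l)
    (f : G →* H) (hf : Function.Surjective f) : Function.Injective f := by
  have hfg : Group.FG (CF m l) := by
    obtain ⟨x, y, h⟩ := hG.map e1.toMonoidHom e1.surjective
    exact Group.fg_iff.2 ⟨_, h, by simp⟩
  have := hopf hfg (rf_CF m l) ((e2.toMonoidHom.comp f).comp e1.symm.toMonoidHom)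
    (e2.surjective.comp (hf.comp e1.symm.surjective))
  intro a b hab
  apply e1.injective
  apply this
  simp [hab]

end Pride

namespace Pride
open Monoid

section
variable {X Ω Ω' : Type} [MulAction (FreeGroup X) Ω] [MulAction (FreeGroup X) Ω']
variable {C : CW X} {n : ℕ} {E : Finset (Ω × X)} {E1 : Finset (Ω' × X)} {v : Ω} {q : Ω → Ω'}

def push (q : Ω → Ω') (e : Ω × X) : Ω' × X := (q e.1, e.2)

theorem push_edge (hq : ∀ ω (g : FreeGroup X), q (act ω g) = act (q ω) g) (ω : Ω) (a : X × Bool) :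
    push q (edge ω a) = edge (q ω) a := by
  obtain ⟨x, _ | _⟩ := a
  · simp [push, edge_false, hq]
  · simp [push, edge_true]

theorem Trav.push (hq : ∀ ω (g : FreeGroup X), q (act ω g) = act (q ω) g) (hE : ∀ e ∈ E, push q e ∈ E1)
    {ω : Ω} {g : FreeGroup X} (h : Trav E ω g) : Trav E1 (q ω) g := by
  induction h with
  | one ω => exact Trav.one _
  | cons ω a g h t ih =>
    refine Trav.cons _ _ _ ?_ ?_
    · rw [← push_edge hq]; exact hE _ h
    · rw [← hq]; exact ih

theorem W0_push (hq : ∀ ω (g : FreeGroup X), q (act ω g) = act (q ω) g) (hE : ∀ e ∈ E, push q e ∈ E1)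
    {u : Ω} (h : u ∈ W0 C n E) : q u ∈ W0 C n E1 := by
  refine ⟨by rw [← hq, h.1], fun i => ?_⟩
  rw [← hq, ← push_edge hq]
  exact hE _ (h.2 i)

theorem Nn_push (hq : ∀ ω (g : FreeGroup X), q (act ω g) = act (q ω) g) (hE : ∀ e ∈ E, push q e ∈ E1) :
    Nn C n E v ≤ Nn C n E1 (q v) := by
  apply Subgroup.closure_mono
  rintro _ ⟨t, ht, hu, rfl⟩
  exact ⟨t, ht.push hq hE, by rw [← hq]; exact W0_push hq hE hu, rfl⟩

theorem pi1_push (hq : ∀ ω (g : FreeGroup X), q (act ω g) = act (q ω) g) (hE : ∀ e ∈ E, push q e ∈ E1) :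
    pi1 E v ≤ pi1 E1 (q v) := by
  rintro g ⟨h1, h2⟩
  exact ⟨by rw [← hq, h1], h2.push hq hE⟩

/-- lifting edges along a map injective on vertices -/
theorem lift_edge (hq : ∀ ω (g : FreeGroup X), q (act ω g) = act (q ω) g)
    (hsurj : ∀ e ∈ E1, ∃ f ∈ E, push q f = e) (hinj : ∀ a ∈ verts E, ∀ b ∈ verts E, q a = q b → a = b)
    {ω : Ω} (hω : ω ∈ verts E) {a : X × Bool} (h : edge (q ω) a ∈ E1) : edge ω a ∈ E := by
  obtain ⟨f, hf, hfe⟩ := hsurj _ h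
  obtain ⟨ω2, a2, rfl⟩ := edge_surj f
  rw [push_edge hq] at hfe
  rcases edge_eq_cases hfe with ⟨rfl, h2⟩ | ⟨rfl, h2⟩
  · rw [← hinj _ (mem_verts_of_edge hf).1 _ hω h2]; exact hf
  · rw [← hq] at h2
    rw [hinj _ hω _ (mem_verts_of_edge hf).2 h2, edge_linv]
    exact hf

theorem lift_trav (hq : ∀ ω (g : FreeGroup X), q (act ω g) = act (q ω) g)
    (hsurj : ∀ e ∈ E1, ∃ f ∈ E, push q f = e) (hinj : ∀ a ∈ verts E, ∀ b ∈ verts E, q a = q b → a = b)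
    {ω : Ω} (hω : ω ∈ verts E) {g : FreeGroup X} (h : Trav E1 (q ω) g) :
    Trav E ω g ∧ act ω g ∈ verts E := by
  generalize hp : q ω = p at h
  induction h generalizing ω with
  | one p => exact ⟨Trav.one _, by rwa [act_one]⟩
  | cons p a g he t ih =>
    subst hp
    have h1 := lift_edge hq hsurj hinj hω he
    obtain ⟨h2, h3⟩ := ih (mem_verts_of_edge h1).2 (hq _ _)
    exact ⟨Trav.cons _ _ _ h1 h2, by rw [act_mul]; exact h3⟩

theorem lift_W0 (hq : ∀ ω (g : FreeGroup X), q (act ω g) = act (q ω) g)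
    (hsurj : ∀ e ∈ E1, ∃ f ∈ E, push q f = e) (hinj : ∀ a ∈ verts E, ∀ b ∈ verts E, q a = q b → a = b)
    {ω : Ω} (hω : ω ∈ verts E) (h : q ω ∈ W0 C n E1) : ω ∈ W0 C n E := by
  refine ⟨?_, fun i => ?_⟩
  · apply hinj _ (lift_trav hq hsurj hinj hω (trav_R_pow h n)).2 _ hω
    rw [hq, h.1]
  · apply lift_edge hq hsurj hinj (lift_trav hq hsurj hinj hω (trav_h h i)).2
    rw [hq]
    exact h.2 i

theorem lift_Nn (hq : ∀ ω (g : FreeGroup X), q (act ω g) = act (q ω) g)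
    (hsurj : ∀ e ∈ E1, ∃ f ∈ E, push q f = e) (hinj : ∀ a ∈ verts E, ∀ b ∈ verts E, q a = q b → a = b)
    (hω : v ∈ verts E) : Nn C n E1 (q v) ≤ Nn C n E v := by
  apply Subgroup.closure_mono
  rintro _ ⟨t, ht, hu, rfl⟩
  obtain ⟨h1, h2⟩ := lift_trav hq hsurj hinj hω ht
  exact ⟨t, h1, lift_W0 hq hsurj hinj h2 (by rw [hq]; exact hu), rfl⟩

end

section
variable {X Ω : Type} [MulAction (FreeGroup X) Ω]

/-- `T1` with its witness -/
def T1w (C : CW X) (n : ℕ) (E : Finset (Ω × X)) (v : Ω) (E' : Finset (Ω × X)) : Prop :=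
  ∃ (u : Ω) (g : FreeGroup X) (h : E' ⊆ E) (hg : Trav E v g) (hu : act v g = u),
    Conn E' u ∧ Irred C n E' ∧ E'.Nonempty ∧ (W0 C n E').ncard = 1 ∧ E'.card = (verts E').card + 1 ∧
    (∀ M ⊆ E, Irred C n M → M ⊆ E') ∧ Function.Bijective (Qmap (C := C) (n := n) h hg hu)
end

section
variable {X Ω Ω' : Type} [MulAction (FreeGroup X) Ω] [MulAction (FreeGroup X) Ω']
variable {C : CW X} {n : ℕ} {E E' : Finset (Ω × X)} {E1 E1' : Finset (Ω' × X)} {v : Ω} {q : Ω → Ω'}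

/-- images of cores -/
theorem core_image (hq : ∀ ω (g : FreeGroup X), q (act ω g) = act (q ω) g) (hE : ∀ e ∈ E, push q e ∈ E1)
    (h : T1w C n E v E') (h1 : T1w C n E1 (q v) E1') :
    (∀ e ∈ E', push q e ∈ E1') ∧ (∀ e ∈ E1', ∃ f ∈ E', push q f = e) := by
  classical
  obtain ⟨u, g, hs, hg, hu, c1, c2, c3, c4, c5, c6, c7⟩ := h
  obtain ⟨u1, g1, hs1, hg1, hu1, d1, d2, d3, d4, d5, d6, d7⟩ := h1
  obtain ⟨w, hw⟩ := Set.ncard_eq_one.1 c4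
  obtain ⟨w1, hw1⟩ := Set.ncard_eq_one.1 d4
  have hpush : ∀ e ∈ E', push q e ∈ E'.image (push q) := fun e he => Finset.mem_image_of_mem _ he
  have hirr : Irred C n (E'.image (push q)) := by
    intro e he
    obtain ⟨f, hf, rfl⟩ := Finset.mem_image.1 he
    obtain ⟨a, a', i, i', k1, k2, k3, k4, k5, k6, k7⟩ := c2 f hf
    have e1 : a = w := by rw [hw] at k1; exact k1
    have e2 : a' = w := by rw [hw] at k2; exact k2
    subst e1
    subst e2
    refine ⟨q _, q _, i, i', W0_push hq hpush k1, W0_push hq hpush k1, k3, k4, ?_, ?_, ?_⟩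
    · intro hc
      simp only [Prod.mk.injEq, true_and] at hc
      exact k5 (by rw [hc])
    · rw [← k6, push_edge hq, hq]
    · rw [← k7, push_edge hq, hq]
  have hsub : E'.image (push q) ⊆ E1' := by
    apply d6 _ _ hirr
    intro e he
    obtain ⟨f, hf, rfl⟩ := Finset.mem_image.1 he
    exact hE f (hs hf)
  have hp : ∀ e ∈ E', push q e ∈ E1' := fun e he => hsub (hpush e he)
  refine ⟨hp, fun e he => ?_⟩
  have hwW : w ∈ W0 C n E' := by rw [hw]; rfl
  have hq1 : q w = w1 := by
    have := W0_push hq hp hwW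
    rw [hw1] at this; exact this
  obtain ⟨a, a', i, i', k1, k2, k3, k4, k5, k6, k7⟩ := d2 e he
  have e1 : a = w1 := by rw [hw1] at k1; exact k1
  refine ⟨_, hwW.2 i, ?_⟩
  rw [push_edge hq, hq, hq1, ← e1, k6]

theorem core_inj (hq : ∀ ω (g : FreeGroup X), q (act ω g) = act (q ω) g) (hE : ∀ e ∈ E, push q e ∈ E1)
    (h : T1w C n E v E') (h1 : T1w C n E1 (q v) E1') (hc : E'.card ≤ E1'.card)
    {k : FreeGroup X} (hk : k ∈ pi1 E v) (hk1 : k ∈ Nn C n E1 (q v)) : k ∈ Nn C n E v := by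
  classical
  obtain ⟨hp, hsurj⟩ := core_image hq hE h h1
  obtain ⟨u, g, hs, hg, hu, c1, c2, c3, c4, c5, c6, c7⟩ := h
  obtain ⟨u1, g1, hs1, hg1, hu1, d1, d2, d3, d4, d5, d6, d7⟩ := h1
  have himE : E1' ⊆ E'.image (push q) := by
    intro e he
    obtain ⟨f, hf, rfl⟩ := hsurj e he
    exact Finset.mem_image_of_mem _ hf
  have hcard : (verts E').card ≤ (verts E1').card := by omega
  have himV : verts E1' ⊆ (verts E').image q := by
    intro ω hω
    obtain ⟨a, ha⟩ := mem_verts.1 hω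
    obtain ⟨f, hf, hfe⟩ := hsurj _ ha
    obtain ⟨ω2, a2, rfl⟩ := edge_surj f
    rw [push_edge hq] at hfe
    rcases edge_eq_cases hfe with ⟨rfl, h2⟩ | ⟨rfl, h2⟩
    · exact Finset.mem_image.2 ⟨_, (mem_verts_of_edge hf).1, h2⟩
    · exact Finset.mem_image.2 ⟨_, (mem_verts_of_edge hf).2, by rw [hq, h2]⟩
  have hinj : ∀ a ∈ verts E', ∀ b ∈ verts E', q a = q b → a = b := by
    have h1 : ((verts E').image q).card = (verts E').card :=
      le_antisymm Finset.card_image_le (hcard.trans (Finset.card_le_card himV))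
    intro a ha b hb hab
    exact Finset.card_image_iff.1 h1 ha hb hab
  have huV : u ∈ verts E' := c1.base_mem c3
  -- write `k` as a loop in the core
  obtain ⟨y, hy⟩ := c7.2 (QuotientGroup.mk ⟨k, hk⟩)
  obtain ⟨κ, rfl⟩ := QuotientGroup.mk_surjective y
  rw [Qmap_mk, QuotientGroup.eq, mem_Nk] at hy
  have hy2 : (g * κ * g⁻¹)⁻¹ * k ∈ Nn C n E v := hy
  have hy3 : g * κ * g⁻¹ ∈ Nn C n E1 (q v) := by
    have := mul_mem hk1 (inv_mem (Nn_push (v := v) hq hE hy2))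
    simpa using this
  have hqu : act (q v) g = q u := by rw [← hq, hu]
  have hgq : Trav E1 (q v) g := hg.push hq hE
  have hκ1 : (κ : FreeGroup X) ∈ Nn C n E1 (q u) := by
    have := Nn_conj (v := q u) (g := g⁻¹) (by rw [← hqu]; exact hgq.inv)
      (by rw [← hqu, act_act_inv]) hy3
    simpa [mul_assoc] using this
  have hquV : q u ∈ verts E1' := by
    obtain ⟨a, ha⟩ := mem_verts.1 huV
    refine mem_verts.2 ⟨a, ?_⟩
    rw [← push_edge hq]; exact hp _ ha
  obtain ⟨a, ha⟩ := mem_verts.1 hquV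
  obtain ⟨t, ht, htu⟩ := d1.reach ha
  have hκp : (κ : FreeGroup X) ∈ pi1 E1' (q u) := pi1_push hq hp κ.2
  have hκ2 : t * κ * t⁻¹ ∈ pi1 E1' u1 := conj_mem_pi1 ht (by rw [htu]; exact hκp)
  have hκ3 : t * κ * t⁻¹ ∈ Nn C n E1 u1 := Nn_conj (ht.mono hs1) htu hκ1
  have hκ4 : g1 * (t * κ * t⁻¹) * g1⁻¹ ∈ Nn C n E1 (q v) := Nn_conj hg1 hu1 hκ3
  have hκ5 : t * κ * t⁻¹ ∈ Nn C n E1' u1 := by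
    have : (QuotientGroup.mk ⟨_, hκ2⟩ : Q C n E1' u1) = 1 := by
      apply d7.1
      rw [Qmap_mk, map_one]
      exact (QuotientGroup.eq_one_iff _).2 hκ4
    exact mem_Nk.1 ((QuotientGroup.eq_one_iff (N := Nk C n E1' u1) (⟨_, hκ2⟩ : pi1 E1' u1)).1 this)
  have hκ6 : (κ : FreeGroup X) ∈ Nn C n E1' (q u) := by
    have := Nn_conj (v := q u) (g := t⁻¹) (by rw [← htu]; exact ht.inv)
      (by rw [← htu, act_act_inv]) hκ5
    simpa [mul_assoc] using this
  have hκ7 := lift_Nn hq hsurj hinj huV hκ6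
  have hκ8 : g * κ * g⁻¹ ∈ Nn C n E v := Nn_conj hg hu (Nn_mono hs hκ7)
  have := mul_mem hκ8 hy2
  rwa [mul_inv_cancel_left] at this

theorem core_normal {u w : Ω} {t : FreeGroup X} (hw : W0 C n E' = {w}) (ht : Trav E' u t)
    (htw : act u t = w) (S0 : pi1 E' u) (hS0 : (S0 : FreeGroup X) = t * C.R * t⁻¹) :
    Nk C n E' u = Subgroup.normalClosure {S0 ^ n} := by
  have hwW : w ∈ W0 C n E' := by rw [hw]; rfl
  have hS : ((S0 ^ n : pi1 E' u) : FreeGroup X) = t * C.R ^ n * t⁻¹ := by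
    rw [Subgroup.coe_pow, hS0, conj_pow]
  apply le_antisymm
  · intro k hk
    have hk' : (k : FreeGroup X) ∈ Nn C n E' u := hk
    have hle : Nn C n E' u ≤ (Subgroup.normalClosure {S0 ^ n}).map (pi1 E' u).subtype := by
      rw [Nn, Subgroup.closure_le]
      rintro _ ⟨s, hs1, hs2, rfl⟩
      have hs3 : act u s = w := by rw [hw] at hs2; exact hs2
      have hmem : s * t⁻¹ ∈ pi1 E' u := mul_inv_mem_pi1 hs1 ht (by rw [hs3, htw])
      have key : ∀ s0 : pi1 E' u, (s0 : FreeGroup X) = s * t⁻¹ →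
          s * C.R ^ n * s⁻¹ ∈ (Subgroup.normalClosure {S0 ^ n}).map (pi1 E' u).subtype := by
        intro s0 h0
        have hn := Subgroup.normalClosure_normal (s := {S0 ^ n})
        have h1 : S0 ^ n ∈ Subgroup.normalClosure {S0 ^ n} :=
          Subgroup.subset_normalClosure (Set.mem_singleton _)
        refine ⟨s0 * S0 ^ n * s0⁻¹, hn.conj_mem _ h1 s0, ?_⟩
        rw [Subgroup.subtype_apply, Subgroup.coe_mul, Subgroup.coe_mul, Subgroup.coe_inv, hS, h0]
        group
      exact key ⟨_, hmem⟩ rfl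
    obtain ⟨k', hk1, hk2⟩ := hle hk'
    have h3 : k' = k := Subtype.ext hk2
    rw [← h3]; exact hk1
  · apply Subgroup.normalClosure_le_normal
    rw [Set.singleton_subset_iff]
    change ((S0 ^ n : pi1 E' u) : FreeGroup X) ∈ Nn C n E' u
    rw [hS]
    exact Nn_gen (C := C) (n := n) ht (by rw [htw]; exact hwW)

/-- presentation of the one-relator core -/
theorem core_pres (hp : C.Prim) (h : T1w C n E v E') : ∃ (ι : Type) (S : FreeGroup ι), Nontrivial ι ∧
    (∀ T k, 1 ≤ k → S = T ^ k → k = 1) ∧ Nonempty (Q C n E v ≃* PresentedGroup {S ^ n}) := by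
  obtain ⟨u, g, hs, hg, hu, c1, c2, c3, c4, c5, c6, c7⟩ := h
  obtain ⟨w, hw⟩ := Set.ncard_eq_one.1 c4
  have hwW : w ∈ W0 C n E' := by rw [hw]; rfl
  have hwR : act w C.R = w := by
    have := W0_R hwW
    rw [hw] at this; exact this
  obtain ⟨t, ht, htw⟩ := c1.reach_W0 hwW
  obtain ⟨ι, b, hfin, hcount⟩ := hom_count c1 c3
  have hnt : Nontrivial ι := by
    have := Fintype.ofFinite ι
    rw [← Fintype.one_lt_card_iff_nontrivial, ← Nat.card_eq_fintype_card]
    omega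
  have hR1 : C.R ∈ pi1 E' w := ⟨hwR, by simpa using trav_R_pow hwW 1⟩
  let S0 : pi1 E' u := ⟨t * C.R * t⁻¹, conj_mem_pi1 ht (by rw [htw]; exact hR1)⟩
  let e : pi1 E' u ≃* FreeGroup ι := b.repr
  refine ⟨ι, e S0, hnt, ?_, ?_⟩
  · intro T k hk hT
    have h1 : S0 = (e.symm T) ^ k := by rw [← map_pow, ← hT, e.symm_apply_apply]
    have h2 : t * C.R * t⁻¹ = (e.symm T : FreeGroup X) ^ k := congrArg Subtype.val h1
    apply hp (t⁻¹ * (e.symm T : FreeGroup X) * t⁻¹⁻¹) k hk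
    rw [conj_pow, ← h2]
    group
  · have hN := core_normal hw ht htw S0 rfl
    have e1 : Q C n E v ≃* Q C n E' u := (MulEquiv.ofBijective _ c7).symm
    have e2 : Q C n E' u ≃* PresentedGroup {(e S0) ^ n} := by
      refine QuotientGroup.congr _ _ e ?_
      rw [hN, Subgroup.map_normalClosure _ _ e.surjective]
      simp
    exact ⟨e1.trans e2⟩

end
end Pride

namespace Pride
open Monoid

section
variable {X Ω Ω' : Type} [MulAction (FreeGroup X) Ω] [MulAction (FreeGroup X) Ω']

open Classical in
/-- edges of the path with label `l` starting at `v` -/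
noncomputable def edgesL : Ω → List (X × Bool) → Finset (Ω × X)
  | _, [] => ∅
  | v, a :: l => insert (edge v a) (edgesL (act v (ltr a)) l)

theorem mk_cons_ltr (a : X × Bool) (l : List (X × Bool)) :
    FreeGroup.mk (a :: l) = ltr a * FreeGroup.mk l := by
  rw [ltr, FreeGroup.mul_mk]; rfl

theorem mem_edgesL_cons {e : Ω × X} {v : Ω} {a : X × Bool} {l : List (X × Bool)} :
    e ∈ edgesL v (a :: l) ↔ e = edge v a ∨ e ∈ edgesL (act v (ltr a)) l := by
  classical
  rw [edgesL, Finset.mem_insert]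

theorem edgesL_cons_subset {E : Finset (Ω × X)} {v : Ω} {a : X × Bool} {l : List (X × Bool)} :
    edgesL v (a :: l) ⊆ E ↔ edge v a ∈ E ∧ edgesL (act v (ltr a)) l ⊆ E := by
  classical
  rw [edgesL, Finset.insert_subset_iff]

theorem Nn_le_normal {C : CW X} {n : ℕ} (E : Finset (Ω × X)) (v : Ω) :
    Nn C n E v ≤ Subgroup.normalClosure {C.R ^ n} := by
  rw [Nn, Subgroup.closure_le]
  rintro _ ⟨t, -, -, rfl⟩
  have h1 : C.R ^ n ∈ Subgroup.normalClosure {C.R ^ n} :=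
    Subgroup.subset_normalClosure (Set.mem_singleton _)
  exact Subgroup.normalClosure_normal.conj_mem _ h1 _

theorem edgesL_trav {E : Finset (Ω × X)} {v : Ω} {l : List (X × Bool)} (h : edgesL v l ⊆ E) :
    Trav E v (FreeGroup.mk l) := by
  induction l generalizing v with
  | nil => exact Trav.one _
  | cons a l ih =>
    rw [edgesL_cons_subset] at h
    rw [mk_cons_ltr]
    exact Trav.cons _ _ _ h.1 (ih h.2)

theorem edge_fst_reach {E : Finset (Ω × X)} {v : Ω} {a : X × Bool} (h : edge v a ∈ E) :
    Reach E v (edge v a).1 := by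
  obtain ⟨x, _ | _⟩ := a
  · have := Reach.edge h
    rw [edge_false]
    rw [ltr_false] at this
    exact this
  · rw [edge_true]; exact Reach.refl _

theorem edgesL_reach {E : Finset (Ω × X)} {v : Ω} {l : List (X × Bool)} (h : edgesL v l ⊆ E)
    {e : Ω × X} (he : e ∈ edgesL v l) : Reach E v e.1 := by
  induction l generalizing v with
  | nil => simp [edgesL] at he
  | cons a l ih =>
    rw [edgesL_cons_subset] at h
    rw [mem_edgesL_cons] at he
    rcases he with rfl | he
    · exact edge_fst_reach h.1
    · exact (Reach.edge h.1).trans (ih h.2 he)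

theorem edgesL_push {q : Ω → Ω'} (hq : ∀ ω (g : FreeGroup X), q (act ω g) = act (q ω) g)
    {v : Ω} {l : List (X × Bool)} {e : Ω × X} (he : e ∈ edgesL v l) :
    push q e ∈ edgesL (q v) l := by
  induction l generalizing v with
  | nil => simp [edgesL] at he
  | cons a l ih =>
    rw [mem_edgesL_cons] at he ⊢
    rcases he with rfl | he
    · exact Or.inl (push_edge hq _ _)
    · right; rw [← hq]; exact ih he

theorem edgesL_append_left (v : Ω) (l1 l2 : List (X × Bool)) :
    edgesL v l1 ⊆ edgesL v (l1 ++ l2) := by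
  induction l1 generalizing v with
  | nil => simp [edgesL]
  | cons a l ih =>
    intro e he
    rw [List.cons_append, mem_edgesL_cons]
    exact (mem_edgesL_cons.1 he).imp_right fun h => ih _ h

theorem edgesL_append_right (v : Ω) (l1 l2 : List (X × Bool)) :
    edgesL (act v (FreeGroup.mk l1)) l2 ⊆ edgesL v (l1 ++ l2) := by
  induction l1 generalizing v with
  | nil => rw [← FreeGroup.one_eq_mk, act_one]; rfl
  | cons a l ih =>
    intro e he
    rw [mk_cons_ltr, act_mul] at he
    rw [List.cons_append, mem_edgesL_cons]
    exact Or.inr (ih _ he)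

theorem edgesL_range (C : CW X) (u : Ω) (m i : ℕ) (hi : i < m) :
    edge (act u (C.h i)) (C.l i) ∈ edgesL u ((List.range m).map C.l) := by
  induction m with
  | zero => omega
  | succ m ih =>
    rw [List.range_succ, List.map_append]
    rcases Nat.lt_succ_iff_lt_or_eq.1 hi with h | rfl
    · exact edgesL_append_left _ _ _ (ih h)
    · apply edgesL_append_right
      rw [← CW.h_eq_mk]
      simp [edgesL]

theorem edgesL_W0 {C : CW X} {n : ℕ} (hn : 0 < n) {E : Finset (Ω × X)} {u : Ω}
    (h1 : act u (C.R ^ n) = u) (h2 : edgesL u ((List.range (n * C.L)).map C.l) ⊆ E) :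
    u ∈ W0 C n E := by
  refine ⟨h1, fun i => h2 ?_⟩
  have hpos : 0 < n * C.L := Nat.mul_pos hn C.hL
  have key := edgesL_range C u (n * C.L) (i % (n * C.L)) (Nat.mod_lt _ hpos)
  have hi : i = i % (n * C.L) + (n * (i / (n * C.L))) * C.L := by
    have := Nat.mod_add_div i (n * C.L)
    rw [mul_right_comm]; exact this.symm
  have hpow : ∀ k, act u ((C.R ^ n) ^ k) = u := by
    intro k
    induction k with
    | zero => rw [pow_zero, act_one]
    | succ k ih => rw [pow_succ, act_mul, ih, h1]
  have e1 : C.l i = C.l (i % (n * C.L)) := by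
    conv_lhs => rw [hi]
    exact C.l_add_mul_L _ _
  have e2 : act u (C.h i) = act u (C.h (i % (n * C.L))) := by
    conv_lhs => rw [hi]
    rw [C.h_add_mul_L, act_mul, pow_mul, hpow]
  rw [e1, e2]
  exact key

end

section
variable {X : Type}

noncomputable def wd (g : FreeGroup X) : List (X × Bool) := Quot.out g

theorem mk_wd (g : FreeGroup X) : FreeGroup.mk (wd g) = g := Quot.out_eq g

variable (C : CW X) (n : ℕ) (x y : FreeGroup X)

def KJ (J : Finset (FreeGroup X)) : Subgroup (FreeGroup X) :=
  Subgroup.closure ({x, y} ∪ {k | ∃ g ∈ J, k = g * C.R ^ n * g⁻¹})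

abbrev OJ (J : Finset (FreeGroup X)) : Type := FreeGroup X ⧸ KJ C n x y J

def vJ (J : Finset (FreeGroup X)) : OJ C n x y J := ((1 : FreeGroup X) : FreeGroup X ⧸ KJ C n x y J)

open Classical in
noncomputable def WJ (J : Finset (FreeGroup X)) : Finset (List (X × Bool)) :=
  insert (wd x) (insert (wd y) (J.image fun g => wd g ++ (List.range (n * C.L)).map C.l))

open Classical in
noncomputable def EJ (J : Finset (FreeGroup X)) : Finset (OJ C n x y J × X) :=
  (WJ C n x y J).biUnion (edgesL (vJ C n x y J))

variable {C n x y} {J J' : Finset (FreeGroup X)}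

theorem mem_EJ {e : OJ C n x y J × X} : e ∈ EJ C n x y J ↔
    ∃ w ∈ WJ C n x y J, e ∈ edgesL (vJ C n x y J) w := by
  classical
  rw [EJ, Finset.mem_biUnion]

theorem KJ_le {P : Subgroup (FreeGroup X)} (hx : x ∈ P) (hy : y ∈ P)
    (hg : ∀ g ∈ J, g * C.R ^ n * g⁻¹ ∈ P) : KJ C n x y J ≤ P := by
  rw [KJ, Subgroup.closure_le]
  rintro k ((rfl | h) | ⟨g, hg1, rfl⟩)
  · exact hx
  · rw [Set.mem_singleton_iff] at h
    subst h
    exact hy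
  · exact hg g hg1

theorem EJ_sub {w : List (X × Bool)} (h : w ∈ WJ C n x y J) :
    edgesL (vJ C n x y J) w ⊆ EJ C n x y J := by
  classical
  exact Finset.subset_biUnion_of_mem (edgesL (vJ C n x y J)) h

theorem act_vJ {g : FreeGroup X} : act (vJ C n x y J) g = vJ C n x y J ↔ g ∈ KJ C n x y J := by
  have h : act (vJ C n x y J) g = ((g⁻¹ * 1 : FreeGroup X) : FreeGroup X ⧸ KJ C n x y J) := rfl
  rw [h, vJ, QuotientGroup.eq]
  simp

theorem conn_J : Conn (EJ C n x y J) (vJ C n x y J) := by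
  intro e he
  obtain ⟨w, hw, hew⟩ := mem_EJ.1 he
  exact edgesL_reach (EJ_sub hw) hew

theorem WJ_x : wd x ∈ WJ C n x y J := by simp [WJ]
theorem WJ_y : wd y ∈ WJ C n x y J := by simp [WJ]
theorem WJ_g {g : FreeGroup X} (hg : g ∈ J) :
    wd g ++ (List.range (n * C.L)).map C.l ∈ WJ C n x y J := by
  classical
  rw [WJ, Finset.mem_insert, Finset.mem_insert]
  exact Or.inr (Or.inr (Finset.mem_image.2 ⟨g, hg, rfl⟩))

theorem WJ_mono (h : J ⊆ J') : WJ C n x y J ⊆ WJ C n x y J' := by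
  classical
  rw [WJ, WJ]
  exact Finset.insert_subset_insert _ (Finset.insert_subset_insert _ (Finset.image_subset_image h))

theorem KJ_mono (h : J ⊆ J') : KJ C n x y J ≤ KJ C n x y J' := by
  apply Subgroup.closure_mono
  apply Set.union_subset_union_right
  rintro k ⟨g, hg, rfl⟩
  exact ⟨g, h hg, rfl⟩

theorem trav_x : Trav (EJ C n x y J) (vJ C n x y J) x := by
  have := edgesL_trav (EJ_sub (C := C) (n := n) (y := y) (J := J) (WJ_x (x := x)))
  rwa [mk_wd] at this
theorem trav_y : Trav (EJ C n x y J) (vJ C n x y J) y := by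
  have := edgesL_trav (EJ_sub (C := C) (n := n) (x := x) (J := J) (WJ_y (y := y)))
  rwa [mk_wd] at this
theorem trav_g {g : FreeGroup X} (hg : g ∈ J) : Trav (EJ C n x y J) (vJ C n x y J) g := by
  have := edgesL_trav ((edgesL_append_left _ _ _).trans
    (EJ_sub (WJ_g (C := C) (n := n) (x := x) (y := y) hg)))
  rwa [mk_wd] at this

theorem W0_g (hn : 0 < n) {g : FreeGroup X} (hg : g ∈ J) :
    act (vJ C n x y J) g ∈ W0 C n (EJ C n x y J) := by
  apply edgesL_W0 hn
  · have h1 : act (vJ C n x y J) (g * C.R ^ n * g⁻¹) = vJ C n x y J :=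
      act_vJ.2 (Subgroup.subset_closure (Or.inr ⟨g, hg, rfl⟩))
    rw [act_mul, act_mul] at h1
    have h2 := act_eq_iff.1 h1
    rwa [inv_inv] at h2
  · have := (edgesL_append_right _ _ _).trans
      (EJ_sub (WJ_g (C := C) (n := n) (x := x) (y := y) hg))
    rwa [mk_wd] at this

theorem NnJ_g (hn : 0 < n) {g : FreeGroup X} (hg : g ∈ J) :
    g * C.R ^ n * g⁻¹ ∈ Nn C n (EJ C n x y J) (vJ C n x y J) :=
  Nn_gen (trav_g hg) (W0_g hn hg)

theorem x_mem : x ∈ KJ C n x y J := Subgroup.subset_closure (Or.inl (Or.inl rfl))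
theorem y_mem : y ∈ KJ C n x y J := Subgroup.subset_closure (Or.inl (Or.inr rfl))

theorem pi1_J (hn : 0 < n) : pi1 (EJ C n x y J) (vJ C n x y J) = KJ C n x y J := by
  apply le_antisymm
  · intro g hg
    exact act_vJ.1 (mem_pi1.1 hg).1
  · exact KJ_le (mem_pi1.2 ⟨act_vJ.2 x_mem, trav_x⟩) (mem_pi1.2 ⟨act_vJ.2 y_mem, trav_y⟩)
      fun g hg => Nn_le_pi1 (NnJ_g hn hg)

theorem mem_pi1_J (hn : 0 < n) {g : FreeGroup X} :
    g ∈ pi1 (EJ C n x y J) (vJ C n x y J) ↔ g ∈ KJ C n x y J :=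
  SetLike.ext_iff.1 (pi1_J hn) g

theorem x_pi1 (hn : 0 < n) : x ∈ pi1 (EJ C n x y J) (vJ C n x y J) := by
  exact (mem_pi1_J hn).2 x_mem
theorem y_pi1 (hn : 0 < n) : y ∈ pi1 (EJ C n x y J) (vJ C n x y J) := by
  exact (mem_pi1_J hn).2 y_mem

theorem gen_J (hn : 0 < n) : Subgroup.closure
    {(QuotientGroup.mk ⟨x, x_pi1 hn⟩ : Q C n (EJ C n x y J) (vJ C n x y J)),
     (QuotientGroup.mk ⟨y, y_pi1 hn⟩ : Q C n (EJ C n x y J) (vJ C n x y J))} = ⊤ := by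
  rw [eq_top_iff]
  intro z _
  obtain ⟨k, rfl⟩ := QuotientGroup.mk_surjective z
  generalize hP : Subgroup.closure
    {(QuotientGroup.mk ⟨x, x_pi1 hn⟩ : Q C n (EJ C n x y J) (vJ C n x y J)),
     (QuotientGroup.mk ⟨y, y_pi1 hn⟩ : Q C n (EJ C n x y J) (vJ C n x y J))} = P
  have hx : (QuotientGroup.mk ⟨x, x_pi1 hn⟩ : Q C n (EJ C n x y J) (vJ C n x y J)) ∈ P := by
    rw [← hP]; exact Subgroup.subset_closure (Or.inl rfl)
  have hy : (QuotientGroup.mk ⟨y, y_pi1 hn⟩ : Q C n (EJ C n x y J) (vJ C n x y J)) ∈ P := by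
    rw [← hP]; exact Subgroup.subset_closure (Or.inr rfl)
  have hle : KJ C n x y J ≤ (P.comap (QuotientGroup.mk' (Nk C n (EJ C n x y J) (vJ C n x y J)))).map
      (pi1 (EJ C n x y J) (vJ C n x y J)).subtype := by
    refine KJ_le ⟨⟨x, x_pi1 hn⟩, hx, rfl⟩ ⟨⟨y, y_pi1 hn⟩, hy, rfl⟩ fun g hg => ?_
    · refine ⟨⟨_, Nn_le_pi1 (NnJ_g hn hg)⟩, ?_, rfl⟩
      have h1 : (QuotientGroup.mk ⟨_, Nn_le_pi1 (NnJ_g hn hg)⟩ :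
          Q C n (EJ C n x y J) (vJ C n x y J)) = 1 :=
        (QuotientGroup.eq_one_iff _).2 (mem_Nk.2 (NnJ_g hn hg))
      change (QuotientGroup.mk ⟨_, Nn_le_pi1 (NnJ_g hn hg)⟩ :
          Q C n (EJ C n x y J) (vJ C n x y J)) ∈ P
      rw [h1]; exact one_mem _
  have hk : (k : FreeGroup X) ∈ KJ C n x y J := (mem_pi1_J hn).1 k.2
  obtain ⟨k', h1, h2⟩ := hle hk
  have h3 : k' = k := Subtype.ext h2
  subst h3
  exact h1

theorem twoGen_J (hn : 0 < n) : TwoGen (Q C n (EJ C n x y J) (vJ C n x y J)) := ⟨_, _, gen_J hn⟩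

/-! transition maps -/

def qJ (h : J ⊆ J') : OJ C n x y J → OJ C n x y J' := Subgroup.quotientMapOfLE (KJ_mono h)

theorem qJ_v (h : J ⊆ J') : qJ (C := C) (n := n) (x := x) (y := y) h (vJ C n x y J) = vJ C n x y J' := rfl

theorem qJ_act (h : J ⊆ J') (ω : OJ C n x y J) (g : FreeGroup X) :
    qJ h (act ω g) = act (qJ h ω) g := by
  obtain ⟨k, rfl⟩ := QuotientGroup.mk_surjective ω
  have h1 : ∀ J : Finset (FreeGroup X), act (QuotientGroup.mk k : OJ C n x y J) g =
      (QuotientGroup.mk (g⁻¹ * k) : OJ C n x y J) := fun J => by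
    rw [act]; exact MulAction.Quotient.smul_mk _ _ _
  have h2 : ∀ k : FreeGroup X, qJ h (QuotientGroup.mk k : OJ C n x y J) =
      (QuotientGroup.mk k : OJ C n x y J') := fun k => Subgroup.quotientMapOfLE_apply_mk _ _
  rw [h1, h2, h2, h1]

theorem qJ_E (h : J ⊆ J') : ∀ e ∈ EJ C n x y J, push (qJ h) e ∈ EJ C n x y J' := by
  intro e he
  obtain ⟨w, hw, hew⟩ := mem_EJ.1 he
  have := edgesL_push (qJ_act h) hew
  rw [qJ_v] at this
  exact EJ_sub (WJ_mono h hw) this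

theorem NnJ_mono (h : J ⊆ J') :
    Nn C n (EJ C n x y J) (vJ C n x y J) ≤ Nn C n (EJ C n x y J') (vJ C n x y J') := by
  rw [← qJ_v h]
  exact Nn_push (v := vJ C n x y J) (q := qJ h) (qJ_act h) (qJ_E h)

theorem pi1J_mono (h : J ⊆ J') :
    pi1 (EJ C n x y J) (vJ C n x y J) ≤ pi1 (EJ C n x y J') (vJ C n x y J') := by
  rw [← qJ_v h]
  exact pi1_push (v := vJ C n x y J) (q := qJ h) (qJ_act h) (qJ_E h)

theorem trans_surj (hn : 0 < n) (h : J ⊆ J') :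
    ∃ f : Q C n (EJ C n x y J) (vJ C n x y J) →* Q C n (EJ C n x y J') (vJ C n x y J'),
      Function.Surjective f ∧ ∀ k : pi1 (EJ C n x y J) (vJ C n x y J),
        f (QuotientGroup.mk k) = QuotientGroup.mk ⟨k, pi1J_mono h k.2⟩ := by
  let f : Q C n (EJ C n x y J) (vJ C n x y J) →* Q C n (EJ C n x y J') (vJ C n x y J') :=
    QuotientGroup.map _ _ (Subgroup.inclusion (pi1J_mono h)) (fun k hk => NnJ_mono h hk)
  have hf : ∀ k : pi1 (EJ C n x y J) (vJ C n x y J),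
        f (QuotientGroup.mk k) = QuotientGroup.mk ⟨k, pi1J_mono h k.2⟩ := fun k => rfl
  refine ⟨f, ?_, hf⟩
  rw [← MonoidHom.range_eq_top, eq_top_iff, ← gen_J hn, Subgroup.closure_le]
  rintro _ (rfl | h)
  · exact ⟨_, hf ⟨x, x_pi1 hn⟩⟩
  · rw [Set.mem_singleton_iff] at h
    subst h
    exact ⟨_, hf ⟨y, y_pi1 hn⟩⟩

theorem N_eventually (hn : 0 < n) {k : FreeGroup X} (hk : k ∈ Subgroup.normalClosure {C.R ^ n}) :
    ∃ J0 : Finset (FreeGroup X), ∀ J, J0 ⊆ J → k ∈ Nn C n (EJ C n x y J) (vJ C n x y J) := by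
  classical
  rw [Subgroup.normalClosure] at hk
  induction hk using Subgroup.closure_induction with
  | mem k hk =>
    obtain ⟨a, ha, hc⟩ := Group.mem_conjugatesOfSet_iff.1 hk
    rw [Set.mem_singleton_iff] at ha
    subst ha
    obtain ⟨c, rfl⟩ := isConj_iff.1 hc
    exact ⟨{c}, fun J hJ => NnJ_g hn (hJ (Finset.mem_singleton_self c))⟩
  | one => exact ⟨∅, fun J _ => one_mem _⟩
  | mul a b _ _ iha ihb =>
    obtain ⟨J1, h1⟩ := iha
    obtain ⟨J2, h2⟩ := ihb
    exact ⟨J1 ∪ J2, fun J hJ => mul_mem (h1 J (Finset.union_subset_left hJ))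
      (h2 J (Finset.union_subset_right hJ))⟩
  | inv a _ iha =>
    obtain ⟨J1, h1⟩ := iha
    exact ⟨J1, fun J hJ => inv_mem (h1 J hJ)⟩

theorem stable_iso (hn : 0 < n) {G : Type} [Group G] (π : FreeGroup X →* G)
    (hπ : π.ker = Subgroup.normalClosure {C.R ^ n})
    (hst : ∀ k ∈ KJ C n x y J, k ∈ Subgroup.normalClosure {C.R ^ n} →
      k ∈ Nn C n (EJ C n x y J) (vJ C n x y J)) :
    Nonempty ((Subgroup.closure {π x, π y} : Subgroup G) ≃* Q C n (EJ C n x y J) (vJ C n x y J)) := by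
  have hR : π (C.R ^ n) = 1 := by
    have : C.R ^ n ∈ π.ker := by rw [hπ]; exact Subgroup.subset_normalClosure rfl
    exact this
  have hr : (π.comp (pi1 (EJ C n x y J) (vJ C n x y J)).subtype).range = Subgroup.closure {π x, π y} := by
    rw [MonoidHom.range_comp, Subgroup.range_subtype, pi1_J hn, KJ, MonoidHom.map_closure]
    apply le_antisymm
    · rw [Subgroup.closure_le]
      rintro _ ⟨k, ((rfl | h) | ⟨g, hg, rfl⟩), rfl⟩
      · exact Subgroup.subset_closure (Or.inl rfl)
      · rw [Set.mem_singleton_iff] at h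
        subst h
        exact Subgroup.subset_closure (Or.inr rfl)
      · rw [map_mul, map_mul, hR, mul_one, ← map_mul, mul_inv_cancel, map_one]
        exact one_mem _
    · apply Subgroup.closure_mono
      rintro _ (rfl | h)
      · exact ⟨x, Or.inl (Or.inl rfl), rfl⟩
      · rw [Set.mem_singleton_iff] at h
        subst h
        exact ⟨y, Or.inl (Or.inr rfl), rfl⟩
  have hker : (π.comp (pi1 (EJ C n x y J) (vJ C n x y J)).subtype).ker =
      Nk C n (EJ C n x y J) (vJ C n x y J) := by
    ext k
    have h1 : k ∈ (π.comp (pi1 (EJ C n x y J) (vJ C n x y J)).subtype).ker ↔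
      (k : FreeGroup X) ∈ π.ker := Iff.rfl
    rw [h1, mem_Nk, hπ]
    constructor
    · intro h
      exact hst _ ((mem_pi1_J hn).1 k.2) h
    · intro h
      exact Nn_le_normal _ _ h
  rw [← hr]
  exact ⟨(QuotientGroup.quotientKerEquivRange _).symm.trans (QuotientGroup.quotientMulEquivOfEq hker)⟩

theorem caseA (hn : 0 < n) 
    (hA : ∀ J0 : Finset (FreeGroup X), ∃ J, J0 ⊆ J ∧ ∃ E', T1w C n (EJ C n x y J) (vJ C n x y J) E') :
    ∃ J, (∃ E', T1w C n (EJ C n x y J) (vJ C n x y J) E') ∧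
      ∀ k ∈ KJ C n x y J, k ∈ Subgroup.normalClosure {C.R ^ n} →
      k ∈ Nn C n (EJ C n x y J) (vJ C n x y J) := by
  classical
  have hex : ∃ c : ℕ, ∃ J, ∃ E', T1w C n (EJ C n x y J) (vJ C n x y J) E' ∧ E'.card = c := by
    obtain ⟨J, -, E', h⟩ := hA ∅
    exact ⟨_, J, E', h, rfl⟩
  obtain ⟨J, E', h, hc⟩ := Nat.find_spec hex
  refine ⟨J, ⟨E', h⟩, fun k hk hkN => ?_⟩
  obtain ⟨J0, hJ0⟩ := N_eventually (x := x) (y := y) hn hkN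
  obtain ⟨J', hJ', E1', h1⟩ := hA (J ∪ J0)
  have hs : J ⊆ J' := Finset.union_subset_left hJ'
  have hmin : E'.card ≤ E1'.card := by
    rw [hc]; exact Nat.find_min' hex ⟨J', E1', h1, rfl⟩
  have h3 := hJ0 J' (Finset.union_subset_right hJ')
  rw [← qJ_v hs] at h1 h3
  exact core_inj (qJ_act hs) (qJ_E hs) h h1 hmin ((mem_pi1_J hn).2 hk) h3

theorem caseB (hn : 0 < n) {J0 : Finset (FreeGroup X)}
    (hB : ∀ J, J0 ⊆ J → T0 n (Q C n (EJ C n x y J) (vJ C n x y J))) :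
    ∃ J, T0 n (Q C n (EJ C n x y J) (vJ C n x y J)) ∧
      ∀ k ∈ KJ C n x y J, k ∈ Subgroup.normalClosure {C.R ^ n} →
      k ∈ Nn C n (EJ C n x y J) (vJ C n x y J) := by
  classical
  have hcof : ∃ m l, ∀ J1 : Finset (FreeGroup X), ∃ J, J1 ⊆ J ∧
      Nonempty (Q C n (EJ C n x y J) (vJ C n x y J) ≃* CF m l) := by
    by_contra hcon
    push Not at hcon
    choose Jf hJf using hcon
    let D := Finset.range (n + 1)
    obtain ⟨m, l, hm, hl, he⟩ := hB (J0 ∪ D.biUnion fun m => D.biUnion fun l => Jf m l)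
      Finset.subset_union_left
    have hok : ∀ m, ok n m → m ∈ D := by
      rintro m (rfl | h)
      · simp [D]
      · have := Nat.le_of_dvd hn h
        simp only [D, Finset.mem_range]; omega
    refine (not_isEmpty_iff.2 he) (hJf m l _ ?_)
    intro g hg
    apply Finset.mem_union_right
    exact Finset.mem_biUnion.2 ⟨m, hok m hm, Finset.mem_biUnion.2 ⟨l, hok l hl, hg⟩⟩
  obtain ⟨m, l, hml⟩ := hcof
  obtain ⟨J, hJ, ⟨e⟩⟩ := hml J0
  refine ⟨J, hB J hJ, fun k hk hkN => ?_⟩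
  obtain ⟨J1, hJ1⟩ := N_eventually (x := x) (y := y) hn hkN
  obtain ⟨J', hJ', ⟨e'⟩⟩ := hml (J ∪ J1)
  have hs : J ⊆ J' := Finset.union_subset_left hJ'
  obtain ⟨f, hf, hfk⟩ := trans_surj (C := C) (x := x) (y := y) hn hs
  have hinj := hopf2 (twoGen_J hn) e e' f hf
  have hkp : k ∈ pi1 (EJ C n x y J) (vJ C n x y J) := (mem_pi1_J hn).2 hk
  have h1 : (QuotientGroup.mk ⟨k, hkp⟩ : Q C n (EJ C n x y J) (vJ C n x y J)) = 1 := by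
    apply hinj
    rw [hfk, map_one]
    exact (QuotientGroup.eq_one_iff _).2 (mem_Nk.2 (hJ1 J' (Finset.union_subset_right hJ')))
  exact mem_Nk.1 ((QuotientGroup.eq_one_iff (N := Nk C n (EJ C n x y J) (vJ C n x y J))
    (⟨k, hkp⟩ : pi1 (EJ C n x y J) (vJ C n x y J))).1 h1)

theorem main_alt (hp : C.Prim) (hn : 1 < n) {G : Type} [Group G] (π : FreeGroup X →* G)
    (hπ : π.ker = Subgroup.normalClosure {C.R ^ n}) (x y : FreeGroup X) :
    T0 n (Subgroup.closure {π x, π y} : Subgroup G) ∨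
    ∃ (ι : Type) (S : FreeGroup ι), Nontrivial ι ∧ (∀ T k, 1 ≤ k → S = T ^ k → k = 1) ∧
      Nonempty ((Subgroup.closure {π x, π y} : Subgroup G) ≃* PresentedGroup {S ^ n}) := by
  have hn0 : 0 < n := by omega
  by_cases hA : ∀ J0 : Finset (FreeGroup X), ∃ J, J0 ⊆ J ∧ ∃ E', T1w C n (EJ C n x y J) (vJ C n x y J) E'
  · right
    obtain ⟨J, ⟨E', h⟩, hst⟩ := caseA hn0 hA
    obtain ⟨e⟩ := stable_iso hn0 π hπ hst
    obtain ⟨ι, S, h1, h2, ⟨e2⟩⟩ := core_pres hp h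
    exact ⟨ι, S, h1, h2, ⟨e.trans e2⟩⟩
  · left
    push Not at hA
    obtain ⟨J0, hJ0⟩ := hA
    have hB : ∀ J, J0 ⊆ J → T0 n (Q C n (EJ C n x y J) (vJ C n x y J)) := by
      intro J hJ
      rcases thmB hp hn _ (EJ C n x y J) (vJ C n x y J) le_rfl conn_J (twoGen_J hn0) with h | ⟨E', h⟩
      · exact h
      · exact (hJ0 J hJ E' h).elim
    obtain ⟨J, ⟨m, l, hm, hl, ⟨e2⟩⟩, hst⟩ := caseB hn0 hB
    obtain ⟨e⟩ := stable_iso hn0 π hπ hst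
    exact ⟨m, l, hm, hl, ⟨e.trans e2⟩⟩

end
end Pride

namespace Pride
open Monoid

section
variable {X : Type}

/-- the bi-infinite (here: periodic) word of a nonempty cyclically reduced word -/
theorem exists_CW (w : List (X × Bool)) (hw : w ≠ []) (hc : FreeGroup.IsCyclicallyReduced w) :
    ∃ C : CW X, C.R = FreeGroup.mk w := by
  have hL : 0 < w.length := List.length_pos_iff.2 hw
  let l : ℕ → X × Bool := fun i => w[i % w.length]'(Nat.mod_lt _ hL)
  have hne : ∀ a b : X × Bool, (a.1 = b.1 → a.2 = b.2) → b ≠ linv a := by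
    rintro ⟨a, i⟩ ⟨b, j⟩ h hb
    simp only [linv, Prod.mk.injEq] at hb
    have := h hb.1.symm
    simp only at this
    rw [this] at hb
    cases j <;> simp at hb
  refine ⟨⟨w.length, hL, l, fun i => ?_, fun i => ?_⟩, ?_⟩
  · simp [l]
  · apply hne
    have hi := Nat.mod_lt i hL
    rcases Nat.lt_or_ge (i % w.length + 1) w.length with h | h
    · have h1 : (i + 1) % w.length = i % w.length + 1 := by
        rw [Nat.add_mod]
        rw [Nat.mod_eq_of_lt (a := 1) (by omega), Nat.mod_eq_of_lt h]
      have h2 := List.isChain_iff_getElem.1 hc.1 (i % w.length) h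
      simpa only [l, h1] using h2
    · have h0 : i % w.length = w.length - 1 := by omega
      have h1 : (i + 1) % w.length = 0 := by
        rw [← Nat.mod_add_mod, h0, Nat.sub_add_cancel hL, Nat.mod_self]
      have h2 := hc.2 (w[w.length - 1]'(by omega))
        (by rw [Option.mem_def, List.getLast?_eq_getElem?, List.getElem?_eq_getElem])
        (w[0]'hL) (by rw [Option.mem_def, List.head?_eq_getElem?, List.getElem?_eq_getElem])
      simpa only [l, h1, h0] using h2
  · rw [CW.R, CW.h_eq_mk]
    congr 1
    apply List.ext_getElem
    · simp
    · intro i h1 h2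
      simp [l, Nat.mod_eq_of_lt h2]

theorem exists_CW_conj (R : FreeGroup X) (hR : R ≠ 1) :
    ∃ (C : CW X) (c : FreeGroup X), R = c * C.R * c⁻¹ := by
  classical
  have h := FreeGroup.reduceCyclically.conj_conjugator_reduceCyclically R.toWord
  have h2 : R = FreeGroup.mk (FreeGroup.reduceCyclically.conjugator R.toWord) *
      FreeGroup.mk (FreeGroup.reduceCyclically R.toWord) *
      (FreeGroup.mk (FreeGroup.reduceCyclically.conjugator R.toWord))⁻¹ := by
    rw [FreeGroup.inv_mk, FreeGroup.mul_mk, FreeGroup.mul_mk, h, FreeGroup.mk_toWord]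
  have hne : FreeGroup.reduceCyclically R.toWord ≠ [] := by
    intro h0
    rw [h0, ← FreeGroup.one_eq_mk, mul_one, mul_inv_cancel] at h2
    exact hR h2
  obtain ⟨C, hC⟩ := exists_CW _ hne
    (FreeGroup.reduceCyclically.isCyclicallyReduced FreeGroup.isReduced_toWord)
  exact ⟨C, _, by rw [hC]; exact h2⟩

end

theorem cyc_zmod {G : Type} [Group G] (h : ∃ z : G, Subgroup.closure {z} = ⊤) :
    ∃ m, Nonempty (G ≃* Multiplicative (ZMod m)) := by
  obtain ⟨z, hz⟩ := h
  have hc : IsCyclic G := ⟨z, fun g => by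
    have : g ∈ Subgroup.zpowers z := by
      rw [Subgroup.zpowers_eq_closure, hz]; exact Subgroup.mem_top _
    exact this⟩
  exact ⟨_, ⟨(zmodCyclicMulEquiv hc).symm⟩⟩

theorem decomp {G : Type} [Group G] (h2 : TwoGen G) (h : FreelyDecomposable G) :
    IsFreeProductOfCyclics G := by
  obtain ⟨A, B, gA, gB, nA, nB, ⟨e⟩⟩ := h
  obtain ⟨x, y, hxy⟩ := TwoGen.map h2 e.toMonoidHom e.surjective
  obtain ⟨cA, cB⟩ := grushko A B x y hxy
  obtain ⟨m, ⟨eA⟩⟩ := cyc_zmod cA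
  obtain ⟨l, ⟨eB⟩⟩ := cyc_zmod cB
  obtain ⟨e2⟩ := coprod_bool A B (fun b : Bool => Multiplicative (ZMod (cond b m l))) eA eB
  exact ⟨Bool, fun b => cond b m l, ⟨e.trans e2⟩⟩

theorem twoGen_closure {G : Type} [Group G] (x y : G) :
    TwoGen (Subgroup.closure {x, y} : Subgroup G) := by
  refine ⟨⟨x, Subgroup.subset_closure (Or.inl rfl)⟩, ⟨y, Subgroup.subset_closure (Or.inr rfl)⟩, ?_⟩
  rw [← Subgroup.closure_closure_coe_preimage (k := ({x, y} : Set G))]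
  congr 1
  ext ⟨z, hz⟩
  simp [Subtype.ext_iff]

end Pride

/-- Pride.  A two-generated subgroup of a one-relator group with torsion
is either a freely indecomposable one-relator group with torsion or a free product of
cyclic groups. -/
theorem statement_1 {X : Type} [Nontrivial X] (R : FreeGroup X) (n : ℕ)
    (hn : 1 < n) (hR : ∀ (S : FreeGroup X) (k : ℕ), 1 ≤ k → R = S ^ k → k = 1)
    (H : Subgroup (PresentedGroup {R ^ n})) (x y : PresentedGroup {R ^ n})
    (hH : H = Subgroup.closure {x, y}) :
    (IsOneRelatorGroupWithTorsion H ∧ FreelyIndecomposable H) ∨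
      IsFreeProductOfCyclics H := by
  have hR1 : R ≠ 1 := by
    intro h
    have := hR 1 2 (by norm_num) (by rw [h, one_pow])
    omega
  obtain ⟨C, c, hC⟩ := Pride.exists_CW_conj R hR1
  have hp : C.Prim := by
    intro S k hk hS
    apply hR (c * S * c⁻¹) k hk
    rw [conj_pow, ← hS]; exact hC
  have hRn : R ^ n = c * C.R ^ n * c⁻¹ := by rw [hC, conj_pow]
  have hN : Subgroup.normalClosure {R ^ n} = Subgroup.normalClosure {C.R ^ n} := by
    apply le_antisymm
    · apply Subgroup.normalClosure_le_normal
      rw [Set.singleton_subset_iff, hRn]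
      exact Subgroup.normalClosure_normal.conj_mem _
        (Subgroup.subset_normalClosure (Set.mem_singleton _)) _
    · apply Subgroup.normalClosure_le_normal
      rw [Set.singleton_subset_iff]
      have h1 : C.R ^ n = c⁻¹ * R ^ n * c⁻¹⁻¹ := by rw [hRn]; group
      rw [h1]
      exact Subgroup.normalClosure_normal.conj_mem _
        (Subgroup.subset_normalClosure (Set.mem_singleton _)) _
  let π : FreeGroup X →* PresentedGroup {R ^ n} := PresentedGroup.mk {R ^ n}
  have hπ : π.ker = Subgroup.normalClosure {C.R ^ n} := by
    rw [← hN]; exact QuotientGroup.ker_mk' _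
  obtain ⟨x', rfl⟩ := PresentedGroup.mk_surjective _ x
  obtain ⟨y', rfl⟩ := PresentedGroup.mk_surjective _ y
  subst hH
  rcases Pride.main_alt hp hn π hπ x' y' with ⟨m, l, -, -, ⟨e⟩⟩ | ⟨ι, S, h1, h2, ⟨e⟩⟩
  · exact Or.inr ⟨Bool, fun b => cond b m l, ⟨e⟩⟩
  · by_cases hd : FreelyDecomposable (Subgroup.closure
        {PresentedGroup.mk {R ^ n} x', PresentedGroup.mk {R ^ n} y'} : Subgroup _)
    · exact Or.inr (Pride.decomp (Pride.twoGen_closure _ _) hd)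
    · exact Or.inl ⟨⟨ι, S, n, h1, hn, h2, ⟨e⟩⟩, hd⟩
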